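/- For every ε > 0 one has the bound ∫₁^T |ζ(1/2+it)|² dS(t) ≪_ε T log²T (log log T)^{3/2+ε}, where the (Riemann–Stieltjes) integral equals |ζ(1/2+it)|² S(t) |₁^T − 2 ∫₁^T S(t) Z(t) Z'(t) dt with Z Hardy's function. -/

import Mathlib

open Complex Real MeasureTheory Set Filter

noncomputable section

/-- The multiplicity of `ρ` as a zero of the Riemann zeta function
(the order of vanishing, i.e. the least `n` with `ζ⁽ⁿ⁾(ρ) ≠ 0`). -/
def zetaMult (ρ : ℂ) : ℕ := sInf {n : ℕ | iteratedDeriv n riemannZeta ρ ≠ 0}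

/-- `ρ` is a nontrivial zero of the Riemann zeta function. -/
def IsNontrivialZero (ρ : ℂ) : Prop := riemannZeta ρ = 0 ∧ 0 < ρ.re ∧ ρ.re < 1

/-- `S` is the function `S(T) = (1/π) arg ζ(1/2 + iT)`, where the argument is obtained by
continuous variation along the straight segments joining `2`, `2 + iT`, `1/2 + iT`, starting
with the value `0` at `2`; if `T` is an ordinate of a zero then `S(T) = S(T+0)`
(right-continuity). -/
def IsS (S : ℝ → ℝ) : Prop :=
  (∀ T : ℝ, 0 < T →
    (∀ σ : ℝ, 1/2 ≤ σ → σ ≤ 2 → riemannZeta (σ + T * I) ≠ 0) →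
    ∃ θ : ℝ → ℂ, ContinuousOn θ (Icc 0 2) ∧
      θ 0 = Complex.log (riemannZeta 2) ∧
      (∀ u ∈ Icc (0:ℝ) 1, Complex.exp (θ u) = riemannZeta (2 + u * T * I)) ∧
      (∀ u ∈ Icc (1:ℝ) 2, Complex.exp (θ u) = riemannZeta (2 - 3/2 * (u - 1) + T * I)) ∧
      S T = (θ 2).im / π) ∧
  (∀ T : ℝ, 0 < T → Tendsto S (nhdsWithin T (Ioi T)) (nhds (S T)))

/-- The factor `χ(s) = 2^s π^(s-1) sin(πs/2) Γ(1-s)` from the functional equation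
`ζ(s) = χ(s) ζ(1-s)`. -/
def chi (s : ℂ) : ℂ :=
  2 ^ s * (π : ℂ) ^ (s - 1) * Complex.sin (π * s / 2) * Complex.Gamma (1 - s)

/-! ### Polynomial growth of the zeta function -/

open Topology in
lemma fractIndicator_mellin_differentiableAt {s : ℂ} (hs : 0 < s.re) :
    DifferentiableAt ℂ (fun z : ℂ => mellin
      (fun t : ℝ => (((Ioi (1:ℝ)).indicator (fun t => Int.fract t) t : ℝ) : ℂ)) (-z)) s := by
  have hm : Measurable
      (fun t : ℝ => (((Ioi (1:ℝ)).indicator (fun t => Int.fract t) t : ℝ) : ℂ)) :=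
    Complex.measurable_ofReal.comp (measurable_fract.indicator measurableSet_Ioi)
  have hb : ∀ t : ℝ, ‖(((Ioi (1:ℝ)).indicator (fun t => Int.fract t) t : ℝ) : ℂ)‖ ≤ 1 := by
    intro t
    by_cases ht : t ∈ Ioi (1:ℝ)
    · rw [indicator_of_mem ht, Complex.norm_real, Real.norm_of_nonneg (Int.fract_nonneg t)]
      exact (Int.fract_lt_one t).le
    · rw [indicator_of_notMem ht]; simp
  have h1 : DifferentiableAt ℂ (mellin
      (fun t : ℝ => (((Ioi (1:ℝ)).indicator (fun t => Int.fract t) t : ℝ) : ℂ))) (-s) := by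
    refine mellin_differentiableAt_of_isBigO_rpow (a := 0) (b := -s.re - 1) ?_ ?_ ?_ ?_ ?_
    · refine LocallyIntegrable.locallyIntegrableOn ?_ _
      refine (locallyIntegrable_const (1:ℝ)).mono hm.aestronglyMeasurable ?_
      filter_upwards with t
      simpa using hb t
    · refine Asymptotics.IsBigO.of_bound 1 ?_
      filter_upwards with t
      simpa using hb t
    · simpa using hs
    · refine Asymptotics.IsBigO.of_bound 1 ?_
      have : Iio (1:ℝ) ∈ 𝓝[>] (0:ℝ) := mem_nhdsWithin_of_mem_nhds (Iio_mem_nhds one_pos)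
      filter_upwards [this] with t ht
      rw [indicator_of_notMem (by simpa using (le_of_lt ht))]
      simp
    · simp
  exact h1.comp s (differentiableAt_id.neg)

lemma mellin_fractIndicator (z : ℂ) : mellin
      (fun t : ℝ => (((Ioi (1:ℝ)).indicator (fun t => Int.fract t) t : ℝ) : ℂ)) (-z) =
    ∫ t in Ioi (1:ℝ), ((Int.fract t : ℝ) : ℂ) * (t:ℂ) ^ (-(z + 1)) := by
  rw [mellin, ← integral_indicator measurableSet_Ioi, ← integral_indicator measurableSet_Ioi]
  congr 1
  ext t
  by_cases ht : t ∈ Ioi (1:ℝ)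
  · have h0 : t ∈ Ioi (0:ℝ) := mem_Ioi.mpr (lt_trans one_pos (mem_Ioi.mp ht))
    rw [indicator_of_mem h0, indicator_of_mem ht, indicator_of_mem ht, smul_eq_mul, mul_comm]
    congr 2; ring
  · rw [indicator_of_notMem ht]
    by_cases h0 : t ∈ Ioi (0:ℝ)
    · rw [indicator_of_mem h0, indicator_of_notMem ht]; simp
    · rw [indicator_of_notMem h0]

lemma fract_mul_cpow_integrableOn {s : ℂ} (hs : 0 < s.re) :
    IntegrableOn (fun t : ℝ => ((Int.fract t : ℝ) : ℂ) * (t:ℂ) ^ (-(s + 1))) (Ioi 1) := by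
  have h1 : IntegrableOn (fun t : ℝ => (t:ℂ) ^ (-(s + 1))) (Ioi (1:ℝ)) :=
    integrableOn_Ioi_cpow_of_lt (by simp; linarith) one_pos
  refine h1.bdd_mul (c := 1) ?_ ?_
  · exact (Complex.measurable_ofReal.comp measurable_fract).aestronglyMeasurable
  · filter_upwards with t
    rw [Complex.norm_real, Real.norm_of_nonneg (Int.fract_nonneg t)]
    exact (Int.fract_lt_one t).le

lemma riemannZeta_eq_fract_integral_of_one_lt {s : ℂ} (hs : 1 < s.re) :
    riemannZeta s = s / (s - 1) -
      s * ∫ t in Ioi (1:ℝ), ((Int.fract t : ℝ) : ℂ) * (t:ℂ) ^ (-(s + 1)) := by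
  have hs1 : s - 1 ≠ 0 := by
    intro h; rw [sub_eq_zero.mp h] at hs; simp at hs
  have h := LSeries_eq_mul_integral' (1 : ℕ → ℂ) zero_le_one hs (by
    simp only [Pi.one_apply, norm_one, Finset.sum_const, Nat.card_Icc, add_tsub_cancel_right,
      nsmul_eq_mul, mul_one, Real.rpow_one]
    exact Asymptotics.isBigO_refl _ _)
  rw [LSeries_one_eq_riemannZeta hs] at h
  rw [h]
  have h2 : ∫ t in Ioi (1:ℝ), (∑ k ∈ Finset.Icc 1 ⌊t⌋₊, (1 : ℕ → ℂ) k) * (t:ℂ) ^ (-(s + 1)) =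
      (∫ t in Ioi (1:ℝ), (t:ℂ) ^ (-s)) -
        ∫ t in Ioi (1:ℝ), ((Int.fract t : ℝ) : ℂ) * (t:ℂ) ^ (-(s + 1)) := by
    rw [← integral_sub]
    · refine setIntegral_congr_fun measurableSet_Ioi fun t ht => ?_
      have ht0 : (0:ℝ) < t := lt_trans one_pos ht
      have htc : (t:ℂ) ≠ 0 := by exact_mod_cast ht0.ne'
      have e1 : (t:ℂ) ^ (-s) = (t:ℂ) * (t:ℂ) ^ (-(s + 1)) := by
        rw [show -s = 1 + (-(s+1)) by ring, Complex.cpow_add _ _ htc, Complex.cpow_one]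
      have e2 : ((⌊t⌋₊ : ℕ) : ℝ) = t - Int.fract t := by
        rw [Int.self_sub_fract, ← natCast_floor_eq_intCast_floor ht0.le]
      have e3 : ((⌊t⌋₊ : ℕ) : ℂ) = (t:ℂ) - ((Int.fract t : ℝ) : ℂ) := by
        rw [← Complex.ofReal_sub, ← e2]; simp
      simp only [Pi.one_apply, Finset.sum_const, Nat.card_Icc, add_tsub_cancel_right,
        nsmul_eq_mul, mul_one]
      rw [e1, e3]; ring
    · exact integrableOn_Ioi_cpow_of_lt (by simpa using hs) one_pos
    · exact fract_mul_cpow_integrableOn (by linarith)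
  rw [h2, integral_Ioi_cpow_of_lt (by simpa using hs) one_pos]
  have : -s + 1 ≠ 0 := by
    intro h; apply hs1; linear_combination -h
  simp only [Complex.ofReal_one, Complex.one_cpow]
  field_simp
  ring

open Topology in
lemma riemannZeta₁_eq_fract_integral {s : ℂ} (hs : 0 < s.re) :
    riemannZeta₁ s = s -
      s * (s - 1) * ∫ t in Ioi (1:ℝ), ((Int.fract t : ℝ) : ℂ) * (t:ℂ) ^ (-(s + 1)) := by
  have hU : IsOpen {z : ℂ | 0 < z.re} := isOpen_lt continuous_const Complex.continuous_re
  have hf : AnalyticOnNhd ℂ riemannZeta₁ {z : ℂ | 0 < z.re} :=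
    differentiable_riemannZeta₁.differentiableOn.analyticOnNhd hU
  have hg : AnalyticOnNhd ℂ (fun z : ℂ => z - z * (z - 1) * mellin
      (fun t : ℝ => (((Ioi (1:ℝ)).indicator (fun t => Int.fract t) t : ℝ) : ℂ)) (-z))
      {z : ℂ | 0 < z.re} := by
    refine DifferentiableOn.analyticOnNhd (fun z hz => ?_) hU
    refine DifferentiableAt.differentiableWithinAt ?_
    have := fractIndicator_mellin_differentiableAt (s := z) hz
    exact differentiableAt_id.sub ((differentiableAt_id.mul
      (differentiableAt_id.sub_const 1)).mul this)
  have hc : IsPreconnected {z : ℂ | 0 < z.re} :=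
    (convex_halfSpace_re_gt 0).isPreconnected
  have h2 : (2:ℂ) ∈ {z : ℂ | 0 < z.re} := by simp
  have key := hf.eqOn_of_preconnected_of_eventuallyEq hg hc h2 (by
    have : {z : ℂ | 1 < z.re} ∈ 𝓝 (2:ℂ) :=
      (isOpen_lt continuous_const Complex.continuous_re).mem_nhds (by simp)
    filter_upwards [this] with z hz
    have hz1 : z ≠ 1 := by
      intro h; rw [h] at hz; simp at hz
    have hz1' : z - 1 ≠ 0 := sub_ne_zero.mpr hz1
    have e := riemannZeta_eq_inv_sub_mul hz1
    rw [riemannZeta_eq_fract_integral_of_one_lt hz] at e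
    simp only [mellin_fractIndicator]
    have : riemannZeta₁ z = (z - 1) * ((z-1)⁻¹ * riemannZeta₁ z) := by field_simp
    rw [this, ← e]
    field_simp)
  have := key hs
  simp only [mellin_fractIndicator] at this
  exact this

lemma norm_fract_integral_le {s : ℂ} (hs : 0 < s.re) :
    ‖∫ t in Ioi (1:ℝ), ((Int.fract t : ℝ) : ℂ) * (t:ℂ) ^ (-(s + 1))‖ ≤ 1 / s.re := by
  have hi : IntegrableOn (fun t : ℝ => t ^ (-(s.re + 1))) (Ioi (1:ℝ)) :=
    integrableOn_Ioi_rpow_of_lt (by linarith) one_pos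
  calc _ ≤ ∫ t in Ioi (1:ℝ), t ^ (-(s.re + 1)) := by
        refine norm_integral_le_of_norm_le hi ?_
        filter_upwards [ae_restrict_mem measurableSet_Ioi] with t ht
        have ht0 : (0:ℝ) < t := lt_trans one_pos ht
        rw [norm_mul, Complex.norm_real, Real.norm_of_nonneg (Int.fract_nonneg t),
          Complex.norm_cpow_eq_rpow_re_of_pos ht0]
        have : (-(s+1)).re = -(s.re + 1) := by simp
        rw [this]
        exact mul_le_of_le_one_left (Real.rpow_nonneg ht0.le _) (Int.fract_lt_one t).le
    _ = 1 / s.re := by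
        rw [integral_Ioi_rpow_of_lt (by linarith) one_pos, Real.one_rpow]
        rw [show -(s.re + 1) + 1 = -s.re by ring, neg_div_neg_eq]

/-- Linear growth of `ζ` to the right of the line `Re s = 1/4`. -/
lemma norm_riemannZeta_le_of_quarter_le {s : ℂ} (hs : 1/4 ≤ s.re) (ht : 1 ≤ |s.im|) :
    ‖riemannZeta s‖ ≤ 5 * ‖s‖ := by
  have hs1 : s ≠ 1 := by
    intro h; rw [h] at ht; norm_num at ht
  have hn : 1 ≤ ‖s - 1‖ := by
    refine ht.trans ?_
    simpa using Complex.abs_im_le_norm (s - 1)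
  have h0 : 0 < s.re := by linarith
  rw [riemannZeta_eq_inv_sub_mul hs1, riemannZeta₁_eq_fract_integral h0]
  have hs1' : s - 1 ≠ 0 := sub_ne_zero.mpr hs1
  have : (s-1)⁻¹ * (s - s * (s - 1) *
      ∫ t in Ioi (1:ℝ), ((Int.fract t : ℝ) : ℂ) * (t:ℂ) ^ (-(s + 1))) =
      s * ((s-1)⁻¹ - ∫ t in Ioi (1:ℝ), ((Int.fract t : ℝ) : ℂ) * (t:ℂ) ^ (-(s + 1))) := by
    field_simp
  rw [this, norm_mul, mul_comm]
  refine mul_le_mul_of_nonneg_right ?_ (norm_nonneg _)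
  refine (norm_sub_le _ _).trans ?_
  have h1 : ‖(s-1)⁻¹‖ ≤ 1 := by rw [norm_inv]; exact inv_le_one_of_one_le₀ hn
  have h2 := norm_fract_integral_le h0
  have h3 : 1 / s.re ≤ 4 := by
    rw [div_le_iff₀ h0]; linarith
  linarith

/-! ### The factor of the functional equation -/

lemma norm_Gamma_le_Gamma_re {s : ℂ} (hs : 0 < s.re) : ‖Complex.Gamma s‖ ≤ Real.Gamma s.re := by
  rw [Complex.Gamma_eq_integral hs, Real.Gamma_eq_integral hs, Complex.GammaIntegral]
  refine norm_integral_le_of_norm_le (Real.GammaIntegral_convergent hs) ?_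
  filter_upwards [ae_restrict_mem measurableSet_Ioi] with t ht
  rw [norm_mul, Complex.norm_real, Real.norm_of_nonneg (Real.exp_pos _).le,
    Complex.norm_cpow_eq_rpow_re_of_pos ht]
  simp

lemma norm_sq_sin (x y : ℝ) :
    ‖Complex.sin (x + y * I)‖ ^ 2 = (Real.cosh (2 * y) - Real.cos (2 * x)) / 2 := by
  have h : Complex.sin (x + y * I) =
      ((Real.sin x * Real.cosh y : ℝ) : ℂ) + ((Real.cos x * Real.sinh y : ℝ) : ℂ) * I := by
    rw [Complex.sin_add_mul_I]; push_cast; ring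
  rw [h, Complex.sq_norm, Complex.normSq_add_mul_I, Real.cosh_two_mul, Real.cos_two_mul]
  have h1 := Real.sin_sq_add_cos_sq x
  have h2 := Real.cosh_sq_sub_sinh_sq y
  have e1 : Real.sin x ^ 2 = 1 - Real.cos x ^ 2 := by linarith
  have e2 : Real.cosh y ^ 2 = 1 + Real.sinh y ^ 2 := by linarith
  rw [mul_pow, mul_pow, e1, e2]; ring

lemma norm_sq_Gamma_half (t : ℝ) :
    ‖Complex.Gamma (1/2 + t * I)‖ ^ 2 = π / Real.cosh (π * t) := by
  have h := Complex.Gamma_mul_Gamma_one_sub (1/2 + t * I)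
  have e1 : (1 : ℂ) - (1/2 + t * I) = (starRingEnd ℂ) (1/2 + t * I) := by
    apply Complex.ext <;> simp; norm_num
  rw [e1, Complex.Gamma_conj, Complex.mul_conj, Complex.normSq_eq_norm_sq] at h
  have e2 : Complex.sin (π * (1/2 + t * I)) = ((Real.cosh (π * t) : ℝ) : ℂ) := by
    rw [show (π : ℂ) * (1/2 + t * I) = π/2 + (π * t : ℂ) * I by ring, Complex.sin_add_mul_I]
    simp
  rw [e2] at h
  exact_mod_cast h

lemma norm_chi_of_re_eq_neg_half (t : ℝ) :
    ‖chi (-(1/2) + t * I)‖ ^ 2 = (1/4 + t ^ 2) / (4 * π ^ 2) := by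
  have hpi := Real.pi_pos
  have hc := Real.cosh_pos (π * t)
  have hG : Complex.Gamma (1 - (-(1/2) + t * I)) = (1/2 + (-t : ℝ) * I) *
      Complex.Gamma (1/2 + (-t : ℝ) * I) := by
    rw [← Complex.Gamma_add_one _ (by
      intro h; have := congrArg Complex.re h; simp at this)]
    congr 1; push_cast; ring
  have h1 : ‖(2:ℂ) ^ (-(1/2) + t * I : ℂ)‖ ^ 2 = 1/2 := by
    have e0 := Complex.norm_cpow_eq_rpow_re_of_pos two_pos (-(1/2) + t * I)
    rw [Complex.ofReal_ofNat] at e0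
    rw [e0, ← Real.rpow_natCast, ← Real.rpow_mul two_pos.le]
    have : (-(1/2) + t * I : ℂ).re * ((2:ℕ):ℝ) = -1 := by simp
    rw [this, Real.rpow_neg_one]; norm_num
  have h2 : ‖(π:ℂ) ^ (-(1/2) + t * I - 1 : ℂ)‖ ^ 2 = 1 / π ^ 3 := by
    rw [Complex.norm_cpow_eq_rpow_re_of_pos hpi]
    rw [← Real.rpow_natCast, ← Real.rpow_mul hpi.le]
    have : (-(1/2) + t * I - 1 : ℂ).re * ((2:ℕ):ℝ) = -((3:ℕ):ℝ) := by simp; norm_num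
    rw [this, Real.rpow_neg hpi.le, Real.rpow_natCast, one_div]
  have h3 : ‖Complex.sin (π * (-(1/2) + t * I) / 2)‖ ^ 2 = Real.cosh (π * t) / 2 := by
    have : (π * (-(1/2) + t * I) / 2 : ℂ) = ((-(π / 4) : ℝ) : ℂ) + ((π * t / 2 : ℝ) : ℂ) * I := by
      push_cast; ring
    rw [this, norm_sq_sin]
    rw [show 2 * -(π / 4) = -(π / 2) by ring, Real.cos_neg, Real.cos_pi_div_two, sub_zero]
    congr 2; ring
  have h4 : ‖(1/2 + (-t : ℝ) * I : ℂ)‖ ^ 2 = 1/4 + t ^ 2 := by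
    rw [Complex.sq_norm, show (1/2 : ℂ) = ((1/2 : ℝ) : ℂ) by simp, Complex.normSq_add_mul_I]
    ring
  rw [chi, hG, norm_mul, norm_mul, norm_mul, norm_mul]
  simp only [mul_pow]
  rw [h1, h2, h3, h4, norm_sq_Gamma_half]
  have : Real.cosh (π * -t) = Real.cosh (π * t) := by rw [mul_neg, Real.cosh_neg]
  rw [this]
  field_simp
  norm_num

lemma chi_mul_chi_one_sub {s : ℂ} (hs : s.im ≠ 0) : chi s * chi (1 - s) = 1 := by
  have hpi : (π : ℂ) ≠ 0 := by exact_mod_cast Real.pi_ne_zero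
  have hsin : Complex.sin (π * s) ≠ 0 := by
    intro h
    rw [Complex.sin_eq_zero_iff] at h
    obtain ⟨k, hk⟩ := h
    have : s = k := by
      have : (π:ℂ) * s = π * k := by rw [hk]; ring
      exact mul_left_cancel₀ hpi this
    rw [this] at hs; simp at hs
  have hG := Complex.Gamma_mul_Gamma_one_sub s
  have h1 : (2:ℂ) ^ s * 2 ^ (1 - s) = 2 := by
    rw [← Complex.cpow_add _ _ two_ne_zero]; simp
  have h2 : (π:ℂ) ^ (s - 1) * π ^ (1 - s - 1) = (π:ℂ)⁻¹ := by
    rw [← Complex.cpow_add _ _ hpi, ← Complex.cpow_neg_one]; congr 1; ring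
  have h3 : Complex.sin (π * (1 - s) / 2) = Complex.cos (π * s / 2) := by
    rw [← Complex.sin_pi_div_two_sub]; congr 1; ring
  have h4 : Complex.sin (π * s) = 2 * Complex.sin (π * s / 2) * Complex.cos (π * s / 2) := by
    rw [← Complex.sin_two_mul]; congr 1; ring
  rw [chi, chi, h3, sub_sub_cancel]
  calc _ = ((2:ℂ) ^ s * 2 ^ (1 - s)) * ((π:ℂ) ^ (s - 1) * π ^ (1 - s - 1)) *
        (Complex.sin (π * s / 2) * Complex.cos (π * s / 2)) *
        (Complex.Gamma s * Complex.Gamma (1 - s)) := by ring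
    _ = 1 := by
      rw [h1, h2, hG]
      have : 2 * (Complex.sin (π * s / 2) * Complex.cos (π * s / 2)) = Complex.sin (π * s) := by
        rw [h4]; ring
      rw [show (2:ℂ) * (π:ℂ)⁻¹ * (Complex.sin (π * s / 2) * Complex.cos (π * s / 2)) *
        (π / Complex.sin (π * s)) = (2 * (Complex.sin (π * s / 2) * Complex.cos (π * s / 2))) *
        ((π:ℂ)⁻¹ * π) / Complex.sin (π * s) by ring, this, inv_mul_cancel₀ hpi, mul_one,
        div_self hsin]

lemma chi_ne_zero {s : ℂ} (hs : s.im ≠ 0) : chi s ≠ 0 :=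
  left_ne_zero_of_mul_eq_one (chi_mul_chi_one_sub hs)

lemma riemannZeta_eq_chi_mul {s : ℂ} (hs : s.im ≠ 0) :
    riemannZeta s = chi s * riemannZeta (1 - s) := by
  have h := riemannZeta_one_sub (s := 1 - s) (by
    intro n h; apply hs
    have := congrArg Complex.im h; simpa using this) (by
    intro h; apply hs
    have := congrArg Complex.im h; simpa using this)
  rw [sub_sub_cancel] at h
  rw [h, chi]
  have hpi : (π : ℂ) ≠ 0 := by exact_mod_cast Real.pi_ne_zero
  have h1 : (2 * π : ℂ) ^ (-(1 - s)) = 2 ^ (s - 1) * (π:ℂ) ^ (s - 1) := by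
    rw [show -(1 - s) = s - 1 by ring]
    have := Complex.mul_cpow_ofReal_nonneg (a := 2) (b := π) (by norm_num) Real.pi_pos.le (s - 1)
    simpa using this
  have h2 : (2:ℂ) ^ s = 2 * 2 ^ (s - 1) := by
    rw [Complex.cpow_sub _ _ two_ne_zero, Complex.cpow_one]; field_simp
  have h3 : Complex.cos (π * (1 - s) / 2) = Complex.sin (π * s / 2) := by
    rw [← Complex.cos_pi_div_two_sub]; congr 1; ring
  rw [h1, h2, h3]; ring

lemma chi_conj (s : ℂ) : chi ((starRingEnd ℂ) s) = (starRingEnd ℂ) (chi s) := by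
  have h2 : (2:ℂ) ^ ((starRingEnd ℂ) s) = (starRingEnd ℂ) ((2:ℂ) ^ s) := by
    have : Complex.arg 2 ≠ π := by
      rw [show (2:ℂ) = ((2:ℝ):ℂ) by simp, Complex.arg_ofReal_of_nonneg two_pos.le]
      exact Real.pi_pos.ne
    have := Complex.cpow_conj 2 s this
    rwa [Complex.conj_ofNat] at this
  have h3 : (π:ℂ) ^ ((starRingEnd ℂ) s - 1) = (starRingEnd ℂ) ((π:ℂ) ^ (s - 1)) := by
    have : Complex.arg π ≠ π := by
      rw [Complex.arg_ofReal_of_nonneg Real.pi_pos.le]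
      exact Real.pi_pos.ne
    have := Complex.cpow_conj π (s - 1) this
    simpa using this
  have h4 : Complex.sin (π * (starRingEnd ℂ) s / 2) =
      (starRingEnd ℂ) (Complex.sin (π * s / 2)) := by
    rw [← Complex.sin_conj]; congr 1
    simp [Complex.conj_ofNat]
  have h5 : Complex.Gamma (1 - (starRingEnd ℂ) s) =
      (starRingEnd ℂ) (Complex.Gamma (1 - s)) := by
    rw [← Complex.Gamma_conj]; congr 1; simp
  rw [chi, chi, h2, h3, h4, h5]
  simp

lemma norm_chi_mul_norm_chi_reflect {σ t : ℝ} (ht : t ≠ 0) :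
    ‖chi (σ + t * I)‖ * ‖chi ((1 - σ : ℝ) + t * I)‖ = 1 := by
  have h := chi_mul_chi_one_sub (s := σ + t * I) (by simpa using ht)
  have e : (1 : ℂ) - (σ + t * I) = (starRingEnd ℂ) ((1 - σ : ℝ) + t * I) := by
    apply Complex.ext <;> simp
  rw [e, chi_conj] at h
  have := congrArg norm h
  simpa using this

lemma norm_chi_half {t : ℝ} (ht : t ≠ 0) : ‖chi (1/2 + t * I)‖ = 1 := by
  have h := norm_chi_mul_norm_chi_reflect (σ := 1/2) ht
  have e : ((1 - 1/2 : ℝ) : ℂ) = 1/2 := by norm_num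
  have e' : (((1/2 : ℝ)) : ℂ) = 1/2 := by norm_num
  rw [e, e'] at h
  nlinarith [norm_nonneg (chi (1/2 + t * I))]

lemma norm_chi_of_re_eq_three_half {t : ℝ} (ht : t ≠ 0) :
    ‖chi (3/2 + t * I)‖ ^ 2 = (4 * π ^ 2) / (1/4 + t ^ 2) := by
  have h := norm_chi_mul_norm_chi_reflect (σ := 3/2) ht
  have e : ((1 - 3/2 : ℝ) : ℂ) = -(1/2) := by norm_num
  have e' : (((3/2 : ℝ)) : ℂ) = 3/2 := by norm_num
  rw [e, e'] at h
  have h2 := norm_chi_of_re_eq_neg_half t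
  have h3 : (‖chi (3/2 + t * I)‖ * ‖chi (-(1/2) + t * I)‖) ^ 2 = 1 := by rw [h]; norm_num
  rw [mul_pow, h2] at h3
  have : 0 < 1/4 + t ^ 2 := by positivity
  have hpi := Real.pi_pos
  rw [eq_div_iff this.ne']
  rw [mul_div_assoc', div_eq_one_iff_eq (by positivity)] at h3
  exact h3

lemma differentiableAt_chi {s : ℂ} (hs : s.im ≠ 0) : DifferentiableAt ℂ chi s := by
  have hpi : (π : ℂ) ≠ 0 := by exact_mod_cast Real.pi_ne_zero
  have hG : DifferentiableAt ℂ (fun z : ℂ => Complex.Gamma (1 - z)) s := by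
    refine DifferentiableAt.comp s (Complex.differentiableAt_Gamma _ ?_) (by fun_prop)
    intro m h
    have := congrArg Complex.im h
    simp at this
    exact hs this
  have h2 : DifferentiableAt ℂ (fun z : ℂ => (2:ℂ) ^ z) s :=
    (differentiableAt_id).const_cpow (Or.inl two_ne_zero)
  have h3 : DifferentiableAt ℂ (fun z : ℂ => (π:ℂ) ^ (z - 1)) s :=
    (differentiableAt_id.sub_const 1).const_cpow (Or.inl hpi)
  unfold chi
  exact ((h2.mul h3).mul (by fun_prop)).mul hG

/-- An auxiliary function, holomorphic on `Re s < 2`, that equals `χ(s)(1-s)`. -/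
def chiReg (s : ℂ) : ℂ :=
  2 ^ s * (π : ℂ) ^ (s - 1) * Complex.sin (π * s / 2) * Complex.Gamma (2 - s)

lemma chiReg_eq {s : ℂ} (hs : s ≠ 1) : chiReg s = chi s * (1 - s) := by
  have : Complex.Gamma (2 - s) = (1 - s) * Complex.Gamma (1 - s) := by
    rw [← Complex.Gamma_add_one _ (sub_ne_zero.mpr hs.symm)]; congr 1; ring
  rw [chiReg, chi, this]; ring

lemma differentiableAt_chiReg {s : ℂ} (hs : s.re < 2) : DifferentiableAt ℂ chiReg s := by
  have hpi : (π : ℂ) ≠ 0 := by exact_mod_cast Real.pi_ne_zero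
  have hG : DifferentiableAt ℂ (fun z : ℂ => Complex.Gamma (2 - z)) s := by
    refine DifferentiableAt.comp s (Complex.differentiableAt_Gamma _ ?_) (by fun_prop)
    intro m h
    have := congrArg Complex.re h
    simp at this
    have : (0:ℝ) ≤ m := Nat.cast_nonneg m
    linarith
  have h2 : DifferentiableAt ℂ (fun z : ℂ => (2:ℂ) ^ z) s :=
    (differentiableAt_id).const_cpow (Or.inl two_ne_zero)
  have h3 : DifferentiableAt ℂ (fun z : ℂ => (π:ℂ) ^ (z - 1)) s :=
    (differentiableAt_id.sub_const 1).const_cpow (Or.inl hpi)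
  unfold chiReg
  exact ((h2.mul h3).mul (by fun_prop)).mul hG

lemma norm_sin_le_exp (z : ℂ) : ‖Complex.sin z‖ ≤ Real.exp |z.im| := by
  have h1 : ‖Complex.exp (-z * I)‖ ≤ Real.exp |z.im| := by
    rw [Complex.norm_exp]; gcongr; simpa using le_abs_self z.im
  have h2 : ‖Complex.exp (z * I)‖ ≤ Real.exp |z.im| := by
    rw [Complex.norm_exp]; gcongr; simpa using neg_le_abs z.im
  rw [Complex.sin, norm_div, norm_mul, Complex.norm_I, mul_one]
  have := norm_sub_le (Complex.exp (-z * I)) (Complex.exp (z * I))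
  rw [div_le_iff₀ (by simp)]
  have e : ‖(2:ℂ)‖ = 2 := by simp
  rw [e]; linarith

lemma exists_norm_chiReg_le : ∃ C : ℝ, 0 < C ∧ ∀ s : ℂ, -(1/2) ≤ s.re → s.re ≤ 3/2 →
    ‖chiReg s‖ ≤ C * Real.exp (2 * |s.im|) := by
  have hcont : ContinuousOn Real.Gamma (Icc (1/2) (5/2)) := by
    intro x hx
    refine (Real.differentiableAt_Gamma fun m h => ?_).continuousAt.continuousWithinAt
    have : (0:ℝ) ≤ m := Nat.cast_nonneg m
    have := hx.1
    linarith
  obtain ⟨G, hG⟩ := isCompact_Icc.exists_bound_of_continuousOn hcont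
  have hG0 : 0 ≤ G := (norm_nonneg _).trans (hG 1 (by constructor <;> norm_num))
  refine ⟨(2:ℝ) ^ (3/2:ℝ) * π ^ (1/2:ℝ) * G + 1, by positivity, fun s h1 h2 => ?_⟩
  have hpi1 : (1:ℝ) ≤ π := by linarith [Real.pi_gt_three]
  have a1 : ‖(2:ℂ) ^ s‖ ≤ (2:ℝ) ^ (3/2:ℝ) := by
    have e0 := Complex.norm_cpow_eq_rpow_re_of_pos two_pos s
    rw [Complex.ofReal_ofNat] at e0
    rw [e0]
    exact Real.rpow_le_rpow_of_exponent_le (by norm_num) h2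
  have a2 : ‖(π:ℂ) ^ (s - 1)‖ ≤ π ^ (1/2:ℝ) := by
    rw [Complex.norm_cpow_eq_rpow_re_of_pos Real.pi_pos]
    refine Real.rpow_le_rpow_of_exponent_le hpi1 ?_
    simp; linarith
  have a3 : ‖Complex.sin (π * s / 2)‖ ≤ Real.exp (2 * |s.im|) := by
    refine (norm_sin_le_exp _).trans ?_
    gcongr
    have : (π * s / 2 : ℂ) = ((π / 2 : ℝ) : ℂ) * s := by push_cast; ring
    rw [this, Complex.im_ofReal_mul, abs_mul, abs_of_pos (by positivity)]
    gcongr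
    linarith [Real.pi_le_four]
  have a4 : ‖Complex.Gamma (2 - s)‖ ≤ G := by
    refine (norm_Gamma_le_Gamma_re (by simp; linarith)).trans ?_
    refine (le_abs_self _).trans (hG _ ⟨?_, ?_⟩) <;> simp <;> linarith
  rw [chiReg, norm_mul, norm_mul, norm_mul]
  calc _ ≤ (2:ℝ) ^ (3/2:ℝ) * π ^ (1/2:ℝ) * Real.exp (2 * |s.im|) * G := by gcongr
    _ ≤ _ := by
      have := Real.exp_pos (2 * |s.im|)
      nlinarith

lemma add_abs_mul_exp_neg_sq_le (A v : ℝ) (hA : 0 ≤ A) :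
    (A + |v|) * Real.exp (-v ^ 2) ≤ A + 1 := by
  have h := Real.add_one_le_exp (v ^ 2)
  have h0 := Real.exp_pos (v ^ 2)
  rw [Real.exp_neg, ← div_eq_mul_inv, div_le_iff₀ h0]
  have : |v| ≤ v ^ 2 + 1 := by
    rw [← sq_abs v]; nlinarith [sq_nonneg (|v| - 1), abs_nonneg v]
  nlinarith [sq_nonneg v]

lemma norm_exp_sq (z : ℂ) : ‖Complex.exp (z ^ 2)‖ = Real.exp (z.re ^ 2 - z.im ^ 2) := by
  rw [Complex.norm_exp]; congr 1; simp [pow_two]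

lemma chi_interp_left {t₀ : ℝ} (ht₀ : 1 ≤ |t₀|) (z : ℂ) (hz : z.re = -(1/2)) :
    ‖chiReg z / (z + 2)‖ ≤ |t₀| * (2 + |z.im - t₀|) := by
  have hne : z ≠ 1 := by intro h; rw [h] at hz; norm_num at hz
  have e : z = -(1/2) + z.im * I := by apply Complex.ext <;> simp [hz]
  have e1 : ‖1 - z‖ = ‖z + 2‖ := by
    rw [← norm_conj (z + 2)]
    congr 1
    apply Complex.ext <;> simp [hz]; norm_num
  have e2 : ‖z + 2‖ ≠ 0 := by
    rw [norm_ne_zero_iff]; intro h; have := congrArg Complex.re h; simp [hz] at this; norm_num at this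
  rw [chiReg_eq hne, norm_div, norm_mul, e1, mul_div_assoc, div_self e2, mul_one]
  have h := norm_chi_of_re_eq_neg_half z.im
  rw [← e] at h
  have hv : |z.im| ≤ |t₀| + |z.im - t₀| := by
    have := abs_add_le t₀ (z.im - t₀); simpa using this
  have hpi : 1 ≤ π := by linarith [Real.pi_gt_three]
  have h3 : ‖chi z‖ ≤ |t₀| + 1 + |z.im - t₀| := by
    refine abs_le_of_sq_le_sq' ?_ (by positivity) |>.2
    rw [h, div_le_iff₀ (by positivity)]
    have : |z.im| ^ 2 ≤ (|t₀| + |z.im - t₀|) ^ 2 := by gcongr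
    rw [sq_abs] at this
    have h5 : 1 ≤ π ^ 2 := one_le_pow₀ hpi
    nlinarith [abs_nonneg (z.im - t₀), abs_nonneg t₀, sq_nonneg (|t₀| + 1 + |z.im - t₀|)]
  nlinarith [abs_nonneg (z.im - t₀)]

lemma chi_interp_right {t₀ : ℝ} (z : ℂ) (hz : z.re = 3/2) :
    ‖chiReg z / (z + 2)‖ * |t₀| ≤ 32 * (1 + |z.im - t₀|) := by
  have hne : z ≠ 1 := by intro h; rw [h] at hz; norm_num at hz
  have key : ∀ z : ℂ, z.re = 3/2 → z.im ≠ 0 → ‖chiReg z / (z + 2)‖ * |t₀| ≤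
      32 * (1 + |z.im - t₀|) := by
    intro z hz him
    have hne : z ≠ 1 := by intro h; rw [h] at hz; norm_num at hz
    have e : z = 3/2 + z.im * I := by apply Complex.ext <;> simp [hz]
    have e1 : ‖1 - z‖ ≤ ‖z + 2‖ := by
      rw [Complex.norm_def, Complex.norm_def]
      refine Real.sqrt_le_sqrt ?_
      rw [Complex.normSq_apply, Complex.normSq_apply]
      simp [hz]; norm_num
    have e2 : 0 < ‖z + 2‖ := by
      rw [norm_pos_iff]; intro h; have := congrArg Complex.re h; simp [hz] at this; norm_num at this
    rw [chiReg_eq hne, norm_div, norm_mul]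
    have h := norm_chi_of_re_eq_three_half him
    rw [← e] at h
    have h4 : ‖chi z‖ * ‖1 - z‖ / ‖z + 2‖ ≤ ‖chi z‖ := by
      rw [div_le_iff₀ e2]; gcongr
    have hv : |t₀| ≤ |z.im| + |z.im - t₀| := by
      have := abs_sub z.im (z.im - t₀); simpa using this
    have hpi : π ≤ 4 := Real.pi_le_four
    have hpi0 := Real.pi_pos
    have hpos : 0 < 1/4 + z.im ^ 2 := by positivity
    have h3 : (‖chi z‖ * |t₀|) ≤ 32 * (1 + |z.im - t₀|) := by
      refine abs_le_of_sq_le_sq' ?_ (by positivity) |>.2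
      rw [mul_pow, h, div_mul_eq_mul_div, div_le_iff₀ hpos]
      have h5 : |t₀| ^ 2 ≤ (|z.im| + |z.im - t₀|) ^ 2 := by gcongr
      have h6 : π ^ 2 ≤ 16 := by nlinarith
      have h7 : (|z.im| + |z.im - t₀|) ^ 2 ≤ 4 * (1/4 + z.im ^ 2) * (2 * (1 + |z.im - t₀|)) ^ 2 := by
        rw [← sq_abs z.im]
        nlinarith [abs_nonneg z.im, abs_nonneg (z.im - t₀), sq_nonneg (|z.im|),
          sq_nonneg (|z.im - t₀|), mul_nonneg (abs_nonneg z.im) (abs_nonneg (z.im - t₀)),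
          sq_nonneg (|z.im| - |z.im - t₀|), mul_nonneg (sq_nonneg (|z.im|)) (abs_nonneg (z.im - t₀)),
          mul_nonneg (sq_nonneg (|z.im|)) (sq_nonneg (|z.im - t₀|))]
      nlinarith [sq_nonneg |t₀|]
    calc _ ≤ ‖chi z‖ * |t₀| := by gcongr
      _ ≤ _ := h3
  by_cases him : z.im = 0
  · -- by continuity
    have hc : ContinuousAt (fun y : ℝ => ‖chiReg (z + y * I) / ((z + y * I) + 2)‖ * |t₀|) 0 := by
      have h1 : ContinuousAt (fun y : ℝ => chiReg (z + y * I)) 0 := by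
        have h4 : ContinuousAt chiReg ((fun y : ℝ => z + y * I) 0) :=
          (differentiableAt_chiReg (by simp [hz]; norm_num)).continuousAt
        have h5 : ContinuousAt (fun y : ℝ => z + y * I) 0 := by fun_prop
        exact ContinuousAt.comp (g := chiReg) (f := fun y : ℝ => z + y * I) h4 h5
      refine ((h1.div (by fun_prop) ?_).norm).mul_const _
      intro h; have := congrArg Complex.re h; simp [hz] at this; norm_num at this
    have hd : ContinuousAt (fun y : ℝ => 32 * (1 + |(z + y * I).im - t₀|)) 0 := by fun_prop
    have h2 := hc.tendsto.mono_left (nhdsWithin_le_nhds (s := Ioi (0:ℝ)))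
    have h3 := hd.tendsto.mono_left (nhdsWithin_le_nhds (s := Ioi (0:ℝ)))
    have := le_of_tendsto_of_tendsto h2 h3 (by
      filter_upwards [self_mem_nhdsWithin] with y hy
      refine key _ (by simp [hz]) ?_
      simp [him]; exact (ne_of_gt hy))
    simpa using this
  · exact key z hz him

open Asymptotics in
/-- The convexity bound `χ(σ+it) ≪ |t|^(1/2-σ)` in the strip `-1/2 ≤ σ ≤ 3/2`. -/
lemma exists_norm_chi_le : ∃ C : ℝ, 1 ≤ C ∧ ∀ σ t : ℝ, -(1/2) ≤ σ → σ ≤ 3/2 → 1 ≤ |t| →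
    ‖chi (σ + t * I)‖ ≤ C * |t| ^ (1/2 - σ) := by
  obtain ⟨B, hB0, hB⟩ := exists_norm_chiReg_le
  refine ⟨4 * (64 * Real.exp 4), by nlinarith [Real.add_one_le_exp (4:ℝ)], fun σ t h1 h2 ht => ?_⟩
  have ht0 : 0 < |t| := by linarith
  have htc : ((|t| : ℝ) : ℂ) ≠ 0 := by exact_mod_cast ht0.ne'
  set s₀ : ℂ := σ + t * I with hs₀
  set F : ℂ → ℂ := fun z => chiReg z / (z + 2) * ((|t| : ℝ) : ℂ) ^ (z - 1/2) *
    Complex.exp ((z - s₀) ^ 2) with hF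
  have hnorm : ∀ z : ℂ, ‖F z‖ = ‖chiReg z / (z + 2)‖ * |t| ^ (z.re - 1/2) *
      Real.exp ((z.re - σ) ^ 2 - (z.im - t) ^ 2) := by
    intro z
    rw [hF]; simp only
    rw [norm_mul, norm_mul, Complex.norm_cpow_eq_rpow_re_of_pos ht0, norm_exp_sq]
    simp [hs₀]
  have hdiff : ∀ z : ℂ, -(1/2) ≤ z.re → z.re ≤ 3/2 → DifferentiableAt ℂ F z := by
    intro z hz1 hz2
    have h3 : DifferentiableAt ℂ (fun z : ℂ => ((|t| : ℝ) : ℂ) ^ (z - 1/2)) z :=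
      (differentiableAt_id.sub_const _).const_cpow (Or.inl htc)
    refine (((differentiableAt_chiReg (by linarith)).div (by fun_prop) ?_).mul h3).mul (by fun_prop)
    intro h; have := congrArg Complex.re h; simp at this; linarith
  have hexp : ∀ z : ℂ, -(1/2) ≤ z.re → z.re ≤ 3/2 → (z.re - σ) ^ 2 ≤ 4 := by
    intro z hz1 hz2; nlinarith
  have main : ‖F s₀‖ ≤ 64 * Real.exp 4 := by
    refine PhragmenLindelof.vertical_strip (a := -(1/2)) (b := 3/2) ?_ ?_ ?_ ?_ ?_ ?_
    · refine DifferentiableOn.diffContOnCl ?_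
      intro z hz
      have hz' : z ∈ Complex.re ⁻¹' Icc (-(1/2)) (3/2) := by
        have : closure (Complex.re ⁻¹' Ioo (-(1/2) : ℝ) (3/2)) ⊆ Complex.re ⁻¹' Icc (-(1/2)) (3/2) :=
          closure_minimal (preimage_mono Ioo_subset_Icc_self)
            (isClosed_Icc.preimage Complex.continuous_re)
        exact this hz
      exact (hdiff z hz'.1 hz'.2).differentiableWithinAt
    · refine ⟨1, by rw [lt_div_iff₀] <;> linarith [Real.pi_gt_three], 2, ?_⟩
      refine IsBigO.of_bound (B * |t| * Real.exp 4) ?_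
      refine eventually_inf_principal.mpr (Eventually.of_forall fun z hz => ?_)
      rw [hnorm]
      have hz1 : -(1/2) ≤ z.re := hz.1.le
      have hz2 : z.re ≤ 3/2 := hz.2.le
      have a1 : ‖chiReg z / (z + 2)‖ ≤ B * Real.exp (2 * |z.im|) := by
        rw [norm_div]
        refine (div_le_self (norm_nonneg _) ?_).trans (hB z hz1 hz2)
        have := Complex.abs_re_le_norm (z + 2)
        have h5 := le_abs_self (z + 2).re
        simp at this h5; linarith
      have a2 : |t| ^ (z.re - 1/2) ≤ |t| := by
        calc _ ≤ |t| ^ (1:ℝ) := Real.rpow_le_rpow_of_exponent_le ht (by linarith)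
          _ = _ := Real.rpow_one _
      have a3 : Real.exp ((z.re - σ) ^ 2 - (z.im - t) ^ 2) ≤ Real.exp 4 := by
        gcongr; nlinarith [hexp z hz1 hz2, sq_nonneg (z.im - t)]
      have a4 : Real.exp (2 * |z.im|) ≤ ‖Real.exp (2 * Real.exp (1 * |z.im|))‖ := by
        rw [Real.norm_of_nonneg (Real.exp_pos _).le]
        gcongr; rw [one_mul]; linarith [Real.add_one_le_exp |z.im|]
      calc _ ≤ (B * Real.exp (2 * |z.im|)) * |t| * Real.exp 4 := by gcongr
        _ = (B * |t| * Real.exp 4) * Real.exp (2 * |z.im|) := by ring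
        _ ≤ _ := by gcongr
    · intro z hz
      rw [hnorm, hz]
      have a1 := chi_interp_left ht z hz
      have a2 : |t| ^ (-(1/2) - 1/2 : ℝ) = |t|⁻¹ := by
        rw [show (-(1/2) - 1/2 : ℝ) = -1 by norm_num, Real.rpow_neg_one]
      rw [a2]
      have a3 : Real.exp ((-(1/2) - σ) ^ 2 - (z.im - t) ^ 2) ≤
          Real.exp 4 * Real.exp (-(z.im - t) ^ 2) := by
        rw [← Real.exp_add]; gcongr; nlinarith
      have a4 := add_abs_mul_exp_neg_sq_le 2 (z.im - t) (by norm_num)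
      have e4 := Real.exp_pos (4:ℝ)
      calc _ ≤ (|t| * (2 + |z.im - t|)) * |t|⁻¹ * (Real.exp 4 * Real.exp (-(z.im - t) ^ 2)) := by
            gcongr
        _ = ((2 + |z.im - t|) * Real.exp (-(z.im - t) ^ 2)) * Real.exp 4 := by
            field_simp
        _ ≤ (2 + 1) * Real.exp 4 := by gcongr
        _ ≤ _ := by nlinarith
    · intro z hz
      rw [hnorm, hz]
      have a1 := chi_interp_right (t₀ := t) z hz
      have a2 : |t| ^ (3/2 - 1/2 : ℝ) = |t| := by
        rw [show (3/2 - 1/2 : ℝ) = 1 by norm_num, Real.rpow_one]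
      rw [a2]
      have a3 : Real.exp ((3/2 - σ) ^ 2 - (z.im - t) ^ 2) ≤
          Real.exp 4 * Real.exp (-(z.im - t) ^ 2) := by
        rw [← Real.exp_add]; gcongr; nlinarith
      have a4 := add_abs_mul_exp_neg_sq_le 1 (z.im - t) (by norm_num)
      have e4 := Real.exp_pos (4:ℝ)
      calc _ ≤ (32 * (1 + |z.im - t|)) * (Real.exp 4 * Real.exp (-(z.im - t) ^ 2)) := by
            gcongr
        _ = 32 * ((1 + |z.im - t|) * Real.exp (-(z.im - t) ^ 2)) * Real.exp 4 := by ring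
        _ ≤ 32 * (1 + 1) * Real.exp 4 := by gcongr
        _ = _ := by ring
    · simpa [hs₀] using h1
    · simpa [hs₀] using h2
  rw [hnorm] at main
  have hre : s₀.re = σ := by simp [hs₀]
  have him : s₀.im = t := by simp [hs₀]
  rw [hre, him] at main
  simp only [sub_self, ne_eq, OfNat.ofNat_ne_zero, not_false_eq_true, zero_pow, Real.exp_zero,
    mul_one] at main
  have hne : s₀ ≠ 1 := by
    intro h; rw [h] at him; simp at him; rw [← him] at ht; norm_num at ht
  have hn1 : 1 ≤ ‖1 - s₀‖ := by
    refine ht.trans ?_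
    have := Complex.abs_im_le_norm (1 - s₀); rw [Complex.sub_im, him] at this; simpa using this
  have hn2 : ‖s₀ + 2‖ ≤ 4 * ‖1 - s₀‖ := by
    have : s₀ + 2 = 3 - (1 - s₀) := by ring
    rw [this]
    refine (norm_sub_le _ _).trans ?_
    have : ‖(3:ℂ)‖ = 3 := by simp
    rw [this]; linarith
  have hn3 : 0 < ‖s₀ + 2‖ := by
    rw [norm_pos_iff]; intro h; have := congrArg Complex.re h; simp [hre] at this; linarith
  rw [chiReg_eq hne, norm_div, norm_mul] at main
  have h5 : ‖chi s₀‖ ≤ 4 * (‖chi s₀‖ * ‖1 - s₀‖ / ‖s₀ + 2‖) := by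
    rw [mul_div_assoc', le_div_iff₀ hn3]
    nlinarith [norm_nonneg (chi s₀)]
  have hp : 0 < |t| ^ (1/2 - σ) := Real.rpow_pos_of_pos ht0 _
  have e6 : |t| ^ (σ - 1/2) * |t| ^ (1/2 - σ) = 1 := by
    rw [← Real.rpow_add ht0]; simp
  calc ‖chi s₀‖ ≤ 4 * (‖chi s₀‖ * ‖1 - s₀‖ / ‖s₀ + 2‖) := h5
    _ = 4 * ((‖chi s₀‖ * ‖1 - s₀‖ / ‖s₀ + 2‖) * |t| ^ (σ - 1/2)) * |t| ^ (1/2 - σ) := by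
        linear_combination (-4 * (‖chi s₀‖ * ‖1 - s₀‖ / ‖s₀ + 2‖)) * e6
    _ ≤ _ := by gcongr

/-- Polynomial growth of `ζ` in the half-plane `Re s ≥ -1/2`. -/
lemma exists_norm_riemannZeta_le : ∃ C : ℝ, 1 ≤ C ∧ ∀ σ t : ℝ, -(1/2) ≤ σ → σ ≤ 10 → 1 ≤ |t| →
    ‖riemannZeta (σ + t * I)‖ ≤ C * |t| ^ 2 := by
  obtain ⟨C, hC1, hC⟩ := exists_norm_chi_le
  refine ⟨C * 60, by linarith, fun σ t h1 h2 ht => ?_⟩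
  have ht0 : 0 < |t| := by linarith
  have key : ∀ z : ℂ, 1/4 ≤ z.re → z.re ≤ 10 → |z.im| = |t| → ‖riemannZeta z‖ ≤ 60 * |t| := by
    intro z hz1 hz2 hz3
    refine (norm_riemannZeta_le_of_quarter_le hz1 (by rw [hz3]; exact ht)).trans ?_
    have := Complex.norm_le_abs_re_add_abs_im z
    rw [hz3, abs_of_nonneg (by linarith)] at this
    linarith
  by_cases h : 1/4 ≤ σ
  · have := key (σ + t * I) (by simpa using h) (by simpa using h2) (by simp)
    nlinarith
  · push Not at h
    have htne : t ≠ 0 := by intro h; rw [h] at ht; norm_num at ht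
    rw [riemannZeta_eq_chi_mul (by simpa using htne), norm_mul]
    have a1 := hC σ t h1 (by linarith) ht
    have a2 := key (1 - (σ + t * I)) (by simp; linarith) (by simp; linarith) (by simp)
    have a3 : |t| ^ (1/2 - σ) ≤ |t| := by
      calc _ ≤ |t| ^ (1:ℝ) := Real.rpow_le_rpow_of_exponent_le ht (by linarith)
          _ = _ := Real.rpow_one _
    calc _ ≤ (C * |t|) * (60 * |t|) := by
          gcongr; exact a1.trans (by gcongr)
      _ = _ := by ring

/-! ### A Cauchy estimate on rectangles -/

lemma integral_div_sq_add_sq_ge_one {h H t : ℝ} (h0 : 0 < h) (hH : h ≤ H) :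
    1 ≤ ∫ y in (t - H)..(t + H), h / (h ^ 2 + (y - t) ^ 2) := by
  have hd : ∀ y ∈ uIcc (t - H) (t + H),
      HasDerivAt (fun y => Real.arctan ((y - t) / h)) (h / (h ^ 2 + (y - t) ^ 2)) y := by
    intro y _
    have h1 : HasDerivAt (fun y : ℝ => (y - t) / h) (1 / h) y :=
      ((hasDerivAt_id y).sub_const t).div_const h
    convert! h1.arctan using 1
    have : 0 < h ^ 2 + (y - t) ^ 2 := by positivity
    field_simp
  have hc : Continuous (fun y => h / (h ^ 2 + (y - t) ^ 2)) := by
    refine continuous_const.div (by fun_prop) fun y => ?_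
    positivity
  rw [intervalIntegral.integral_eq_sub_of_hasDerivAt hd (hc.intervalIntegrable _ _)]
  have e1 : (t + H - t) / h = H / h := by ring
  have e2 : (t - H - t) / h = -(H / h) := by ring
  rw [e1, e2, Real.arctan_neg]
  have h3 : Real.arctan 1 ≤ Real.arctan (H / h) :=
    Real.arctan_strictMono.monotone ((one_le_div h0).mpr hH)
  rw [Real.arctan_one] at h3
  linarith [Real.pi_gt_three]

lemma norm_le_of_rect_cauchy {F : ℂ → ℂ} {a b σ t H : ℝ} (ha : a < σ) (hb : σ < b)
    (hH : σ - a ≤ H)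
    (hF : ∀ s : ℂ, a ≤ s.re → s.re ≤ b → t - H ≤ s.im → s.im ≤ t + H → DifferentiableAt ℂ F s) :
    ‖F (σ + t * I)‖ ≤
      (∫ y in (t - H)..(t + H), ‖F (a + y * I)‖ / ‖(a + y * I : ℂ) - (σ + t * I)‖) +
      (∫ y in (t - H)..(t + H), ‖F (b + y * I)‖ / ‖(b + y * I : ℂ) - (σ + t * I)‖) +
      (∫ x in a..b, ‖F (x + (t - H : ℝ) * I)‖ / ‖(x + (t - H : ℝ) * I : ℂ) - (σ + t * I)‖) +
      (∫ x in a..b, ‖F (x + (t + H : ℝ) * I)‖ / ‖(x + (t + H : ℝ) * I : ℂ) - (σ + t * I)‖) := by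
  set c : ℂ := σ + t * I with hc
  have hcre : c.re = σ := by simp [hc]
  have hcim : c.im = t := by simp [hc]
  have hH0 : 0 < H := by linarith
  have htH : t - H ≤ t + H := by linarith
  have hab : a ≤ b := by linarith
  -- membership of the boundary
  have dL : ∀ y ∈ uIcc (t - H) (t + H), DifferentiableAt ℂ F (a + y * I) := by
    intro y hy; rw [uIcc_of_le htH] at hy
    exact hF _ (by simp) (by simpa using hab) (by simpa using hy.1) (by simpa using hy.2)
  have dR : ∀ y ∈ uIcc (t - H) (t + H), DifferentiableAt ℂ F (b + y * I) := by
    intro y hy; rw [uIcc_of_le htH] at hy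
    exact hF _ (by simpa using hab) (by simp) (by simpa using hy.1) (by simpa using hy.2)
  have dB : ∀ x ∈ uIcc a b, DifferentiableAt ℂ F (x + (t - H : ℝ) * I) := by
    intro x hx; rw [uIcc_of_le hab] at hx
    refine hF _ (by simpa using hx.1) (by simpa using hx.2) (by simp) ?_
    simp; linarith
  have dT : ∀ x ∈ uIcc a b, DifferentiableAt ℂ F (x + (t + H : ℝ) * I) := by
    intro x hx; rw [uIcc_of_le hab] at hx
    refine hF _ (by simpa using hx.1) (by simpa using hx.2) ?_ (by simp)
    simp; linarith
  have nL : ∀ y : ℝ, (a + y * I : ℂ) - c ≠ 0 := by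
    intro y h; have := congrArg Complex.re h; simp [hcre] at this; linarith
  have nR : ∀ y : ℝ, (b + y * I : ℂ) - c ≠ 0 := by
    intro y h; have := congrArg Complex.re h; simp [hcre] at this; linarith
  have nB : ∀ x : ℝ, (x + (t - H : ℝ) * I : ℂ) - c ≠ 0 := by
    intro y h; have := congrArg Complex.im h; simp [hcim] at this; linarith
  have nT : ∀ x : ℝ, (x + (t + H : ℝ) * I : ℂ) - c ≠ 0 := by
    intro y h; have := congrArg Complex.im h; simp [hcim] at this; linarith
  -- continuity of the boundary integrands
  have side : ∀ (γ : ℝ → ℂ) (p q : ℝ), Continuous γ → (∀ y, γ y - c ≠ 0) →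
      (∀ y ∈ uIcc p q, DifferentiableAt ℂ F (γ y)) →
      IntervalIntegrable (fun y => F (γ y) / (γ y - c)) volume p q ∧
      IntervalIntegrable (fun y => 1 / (γ y - c)) volume p q ∧
      ∫ y in p..q, dslope F c (γ y) =
        (∫ y in p..q, F (γ y) / (γ y - c)) - F c * ∫ y in p..q, 1 / (γ y - c) := by
    intro γ p q hγ hn hd
    have i1 : IntervalIntegrable (fun y => F (γ y) / (γ y - c)) volume p q := by
      refine ContinuousOn.intervalIntegrable fun y hy => ContinuousAt.continuousWithinAt ?_
      refine ContinuousAt.div ?_ (by fun_prop) (hn y)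
      exact ContinuousAt.comp (g := F) (hd y hy).continuousAt hγ.continuousAt
    have i2 : IntervalIntegrable (fun y => 1 / (γ y - c)) volume p q := by
      refine Continuous.intervalIntegrable ?_ _ _
      exact continuous_const.div (by fun_prop) hn
    refine ⟨i1, i2, ?_⟩
    rw [← intervalIntegral.integral_const_mul, ← intervalIntegral.integral_sub i1 (i2.const_mul _)]
    refine intervalIntegral.integral_congr fun y _ => ?_
    have : γ y ≠ c := fun h => hn y (by rw [h, sub_self])
    rw [dslope_of_ne _ this, slope_def_field]
    ring
  obtain ⟨iL1, iL2, eL⟩ := side (fun y : ℝ => a + y * I) _ _ (by fun_prop) nL dL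
  obtain ⟨iR1, iR2, eR⟩ := side (fun y : ℝ => b + y * I) _ _ (by fun_prop) nR dR
  obtain ⟨iB1, iB2, eB⟩ := side (fun x : ℝ => x + (t - H : ℝ) * I) _ _ (by fun_prop) nB dB
  obtain ⟨iT1, iT2, eT⟩ := side (fun x : ℝ => x + (t + H : ℝ) * I) _ _ (by fun_prop) nT dT
  have hdc : DifferentiableAt ℂ F c :=
    hF c (by rw [hcre]; exact ha.le) (by rw [hcre]; exact hb.le) (by rw [hcim]; linarith)
      (by rw [hcim]; linarith)
  have hrect := Complex.integral_boundary_rect_eq_zero_of_differentiable_on_off_countable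
    (dslope F c) (a + (t - H : ℝ) * I) (b + (t + H : ℝ) * I) {c} (countable_singleton c) (by
      intro s hs
      rw [mem_reProdIm] at hs
      simp only [add_re, ofReal_re, mul_re, I_re, mul_zero, ofReal_im, I_im, mul_one, sub_self,
        add_zero, add_im, mul_im, zero_add] at hs
      rw [uIcc_of_le hab, uIcc_of_le htH] at hs
      have hds := hF s hs.1.1 hs.1.2 hs.2.1 hs.2.2
      refine ContinuousAt.continuousWithinAt ?_
      by_cases h : s = c
      · rw [h]; exact continuousAt_dslope_same.mpr hdc
      · exact (continuousAt_dslope_of_ne h).mpr hds.continuousAt) (by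
      intro s hs
      have hs1 := hs.1
      rw [mem_reProdIm] at hs1
      simp only [add_re, ofReal_re, mul_re, I_re, mul_zero, ofReal_im, I_im, mul_one, sub_self,
        add_zero, add_im, mul_im, zero_add, min_eq_left hab, max_eq_right hab, min_eq_left htH,
        max_eq_right htH] at hs1
      have hds := hF s hs1.1.1.le hs1.1.2.le hs1.2.1.le hs1.2.2.le
      exact (differentiableAt_dslope_of_ne hs.2).mpr hds)
  simp only [add_re, ofReal_re, mul_re, I_re, mul_zero, ofReal_im, I_im, mul_one, sub_self,
        add_zero, add_im, mul_im, zero_add] at hrect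
  rw [eL, eR, eB, eT] at hrect
  set jL := ∫ y in (t - H)..(t + H), 1 / ((a + y * I : ℂ) - c) with hjL
  set jR := ∫ y in (t - H)..(t + H), 1 / ((b + y * I : ℂ) - c) with hjR
  set jB := ∫ x in a..b, 1 / ((x + (t - H : ℝ) * I : ℂ) - c) with hjB
  set jT := ∫ x in a..b, 1 / ((x + (t + H : ℝ) * I : ℂ) - c) with hjT
  set kL := ∫ y in (t - H)..(t + H), F (a + y * I) / ((a + y * I : ℂ) - c) with hkL
  set kR := ∫ y in (t - H)..(t + H), F (b + y * I) / ((b + y * I : ℂ) - c) with hkR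
  set kB := ∫ x in a..b, F (x + (t - H : ℝ) * I) / ((x + (t - H : ℝ) * I : ℂ) - c) with hkB
  set kT := ∫ x in a..b, F (x + (t + H : ℝ) * I) / ((x + (t + H : ℝ) * I : ℂ) - c) with hkT
  have hre : ∀ (γ : ℝ → ℂ) (p q : ℝ), IntervalIntegrable (fun y => 1 / (γ y - c)) volume p q →
      (∫ y in p..q, 1 / (γ y - c)).re = ∫ y in p..q, (1 / (γ y - c)).re := fun γ p q h =>
    (Complex.reCLM.intervalIntegral_comp_comm h).symm
  have him : ∀ (γ : ℝ → ℂ) (p q : ℝ), IntervalIntegrable (fun y => 1 / (γ y - c)) volume p q →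
      (∫ y in p..q, 1 / (γ y - c)).im = ∫ y in p..q, (1 / (γ y - c)).im := fun γ p q h =>
    (Complex.imCLM.intervalIntegral_comp_comm h).symm
  have hL : 1 ≤ -jL.re := by
    rw [hjL, hre (fun y : ℝ => a + y * I) _ _ iL2, ← intervalIntegral.integral_neg]
    refine (integral_div_sq_add_sq_ge_one (t := t) (sub_pos.mpr ha) hH).trans_eq ?_
    refine intervalIntegral.integral_congr fun y _ => ?_
    simp only [one_div, Complex.inv_re, Complex.normSq_apply, sub_re, add_re, ofReal_re, mul_re,
      I_re, mul_zero, ofReal_im, I_im, mul_one, sub_self, add_zero, sub_im, add_im, mul_im,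
      zero_add, hcre, hcim]
    rw [← neg_div]; congr 1 <;> ring
  have hR : 0 ≤ jR.re := by
    rw [hjR, hre (fun y : ℝ => b + y * I) _ _ iR2]
    refine intervalIntegral.integral_nonneg htH fun y _ => ?_
    rw [one_div, Complex.inv_re]
    refine div_nonneg ?_ (Complex.normSq_nonneg _)
    simp [hcre]; exact hb.le
  have hB : 0 ≤ jB.im := by
    rw [hjB, him (fun x : ℝ => x + (t - H : ℝ) * I) _ _ iB2]
    refine intervalIntegral.integral_nonneg hab fun y _ => ?_
    rw [one_div, Complex.inv_im]
    refine div_nonneg ?_ (Complex.normSq_nonneg _)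
    simp [hcim]; exact hH0.le
  have hT : 0 ≤ -jT.im := by
    rw [hjT, him (fun x : ℝ => x + (t + H : ℝ) * I) _ _ iT2, ← intervalIntegral.integral_neg]
    refine intervalIntegral.integral_nonneg hab fun y _ => ?_
    rw [one_div, Complex.inv_im, ← neg_div]
    refine div_nonneg ?_ (Complex.normSq_nonneg _)
    simp [hcim]; exact hH0.le
  have hJ : 1 ≤ ‖jB - jT + I * jR - I * jL‖ := by
    refine le_trans ?_ ((le_abs_self _).trans (Complex.abs_im_le_norm _))
    simp only [sub_im, add_im, mul_im, I_re, I_im, zero_mul, one_mul, zero_add]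
    linarith
  have hK : F c * (jB - jT + I * jR - I * jL) = kB - kT + I * kR - I * kL := by
    simp only [smul_eq_mul] at hrect
    linear_combination -hrect
  have hbound : ‖F c‖ ≤ ‖kB‖ + ‖kT‖ + ‖kR‖ + ‖kL‖ := by
    calc ‖F c‖ ≤ ‖F c‖ * ‖jB - jT + I * jR - I * jL‖ := le_mul_of_one_le_right (norm_nonneg _) hJ
      _ = ‖kB - kT + I * kR - I * kL‖ := by rw [← norm_mul, hK]
      _ ≤ _ := by
        refine (norm_sub_le _ _).trans ?_
        refine add_le_add ((norm_add_le _ _).trans ?_) (by simp)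
        exact add_le_add (norm_sub_le _ _) (by simp)
  have lL : ‖kL‖ ≤ ∫ y in (t - H)..(t + H), ‖F (a + y * I)‖ / ‖(a + y * I : ℂ) - c‖ := by
    refine (intervalIntegral.norm_integral_le_integral_norm htH).trans_eq ?_
    simp only [norm_div]
  have lR : ‖kR‖ ≤ ∫ y in (t - H)..(t + H), ‖F (b + y * I)‖ / ‖(b + y * I : ℂ) - c‖ := by
    refine (intervalIntegral.norm_integral_le_integral_norm htH).trans_eq ?_
    simp only [norm_div]
  have lB : ‖kB‖ ≤ ∫ x in a..b, ‖F (x + (t - H : ℝ) * I)‖ / ‖(x + (t - H : ℝ) * I : ℂ) - c‖ := by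
    refine (intervalIntegral.norm_integral_le_integral_norm hab).trans_eq ?_
    simp only [norm_div]
  have lT : ‖kT‖ ≤ ∫ x in a..b, ‖F (x + (t + H : ℝ) * I)‖ / ‖(x + (t + H : ℝ) * I : ℂ) - c‖ := by
    refine (intervalIntegral.norm_integral_le_integral_norm hab).trans_eq ?_
    simp only [norm_div]
  linarith

lemma rpow_le_rpow_add_rpow {Y x p q : ℝ} (hY : 0 < Y) (hp : p ≤ x) (hq : x ≤ q) :
    Y ^ x ≤ Y ^ p + Y ^ q := by
  have h1 := Real.rpow_pos_of_pos hY p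
  have h2 := Real.rpow_pos_of_pos hY q
  rcases le_total 1 Y with h | h
  · linarith [Real.rpow_le_rpow_of_exponent_le h hq]
  · linarith [Real.rpow_le_rpow_of_exponent_ge hY h hp]

/-- The Cauchy estimate on a rectangle, with a Gaussian weight and an exponential factor. -/
lemma norm_le_of_gaussian_cauchy {G : ℂ → ℂ} {a b σ t H Y M : ℝ} (hY : 0 < Y)
    (ha : a < σ) (hb : σ < b) (hab : b - a ≤ 5/2) (hH : 5/2 ≤ H)
    (hG : ∀ s : ℂ, a ≤ s.re → s.re ≤ b → t - H ≤ s.im → s.im ≤ t + H → DifferentiableAt ℂ G s)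
    (hM1 : ∀ x : ℝ, a ≤ x → x ≤ b → ‖G (x + (t - H : ℝ) * I)‖ ≤ M)
    (hM2 : ∀ x : ℝ, a ≤ x → x ≤ b → ‖G (x + (t + H : ℝ) * I)‖ ≤ M) :
    ‖G (σ + t * I)‖ ≤ Real.exp 7 * (
      Y ^ (a - σ) * (∫ y in (t - H)..(t + H),
        ‖G (a + y * I)‖ * Real.exp (-(y - t) ^ 2) / ‖(a + y * I : ℂ) - (σ + t * I)‖) +
      Y ^ (b - σ) / (b - σ) * (∫ y in (t - H)..(t + H),
        ‖G (b + y * I)‖ * Real.exp (-(y - t) ^ 2)) +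
      5 * M * (Y ^ (a - σ) + Y ^ (b - σ)) * Real.exp (-H ^ 2)) := by
  have hYc : (Y : ℂ) ≠ 0 := by exact_mod_cast hY.ne'
  have htH : t - H ≤ t + H := by linarith
  have hab' : a ≤ b := by linarith
  have hM0 : 0 ≤ M := (norm_nonneg _).trans (hM1 a le_rfl hab')
  set c : ℂ := σ + t * I with hc
  set F : ℂ → ℂ := fun z => G z * ((Y : ℂ) ^ (z - c) * Complex.exp ((z - c) ^ 2)) with hF
  have hw : ∀ z : ℂ, ‖(Y : ℂ) ^ (z - c) * Complex.exp ((z - c) ^ 2)‖ =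
      Y ^ (z.re - σ) * Real.exp ((z.re - σ) ^ 2 - (z.im - t) ^ 2) := by
    intro z
    rw [norm_mul, Complex.norm_cpow_eq_rpow_re_of_pos hY, norm_exp_sq]
    simp [hc]
  have hdw : Differentiable ℂ (fun z : ℂ => (Y : ℂ) ^ (z - c) * Complex.exp ((z - c) ^ 2)) := by
    intro z
    exact (((differentiableAt_id.sub_const c).const_cpow (Or.inl hYc))).mul (by fun_prop)
  have hdF : ∀ s : ℂ, a ≤ s.re → s.re ≤ b → t - H ≤ s.im → s.im ≤ t + H →
      DifferentiableAt ℂ F s := fun s h1 h2 h3 h4 => (hG s h1 h2 h3 h4).mul (hdw s)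
  have main := norm_le_of_rect_cauchy (F := F) (t := t) (H := H) ha hb (by linarith) hdF
  have hFc : F c = G c := by simp [hF]
  rw [← hc, hFc] at main
  have hexp : ∀ x, a ≤ x → x ≤ b → (x - σ) ^ 2 ≤ 7 := by
    intro x h1 h2; nlinarith
  have key : ∀ x y : ℝ, a ≤ x → x ≤ b → ‖F (x + y * I)‖ ≤ ‖G (x + y * I)‖ *
      (Y ^ (x - σ) * (Real.exp 7 * Real.exp (-(y - t) ^ 2))) := by
    intro x y h1 h2
    rw [hF]; simp only
    rw [norm_mul, hw]
    simp only [add_re, ofReal_re, mul_re, I_re, mul_zero, ofReal_im, I_im, mul_one, sub_self,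
        add_zero, add_im, mul_im, zero_add]
    rw [← Real.exp_add]
    have := hexp x h1 h2
    have hp := Real.rpow_pos_of_pos hY (x - σ)
    gcongr
    linarith
  have nL : ∀ y : ℝ, (a + y * I : ℂ) - c ≠ 0 := by
    intro y h; have := congrArg Complex.re h; simp [hc] at this; linarith
  have nR : ∀ y : ℝ, (b + y * I : ℂ) - c ≠ 0 := by
    intro y h; have := congrArg Complex.re h; simp [hc] at this; linarith
  have cont : ∀ (K : ℂ → ℂ) (x : ℝ), a ≤ x → x ≤ b →
      (∀ s : ℂ, a ≤ s.re → s.re ≤ b → t - H ≤ s.im → s.im ≤ t + H → DifferentiableAt ℂ K s) →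
      ContinuousOn (fun y : ℝ => ‖K (x + y * I)‖) (uIcc (t - H) (t + H)) := by
    intro K x h1 h2 hK y hy
    rw [uIcc_of_le htH] at hy
    have := hK (x + y * I) (by simpa using h1) (by simpa using h2) (by simpa using hy.1)
      (by simpa using hy.2)
    refine ContinuousAt.continuousWithinAt (ContinuousAt.norm ?_)
    exact ContinuousAt.comp (g := K) (f := fun y : ℝ => (x + y * I : ℂ)) this.continuousAt
      (by fun_prop)
  have contExp : Continuous (fun y : ℝ => Real.exp (-(y - t) ^ 2)) := by fun_prop
  have cnL : Continuous (fun y : ℝ => ‖(a + y * I : ℂ) - c‖) := by fun_prop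
  have cnR : Continuous (fun y : ℝ => ‖(b + y * I : ℂ) - c‖) := by fun_prop
  have bL : (∫ y in (t - H)..(t + H), ‖F (a + y * I)‖ / ‖(a + y * I : ℂ) - c‖) ≤
      Real.exp 7 * (Y ^ (a - σ) * ∫ y in (t - H)..(t + H),
        ‖G (a + y * I)‖ * Real.exp (-(y - t) ^ 2) / ‖(a + y * I : ℂ) - c‖) := by
    rw [← mul_assoc, ← intervalIntegral.integral_const_mul]
    refine intervalIntegral.integral_mono_on htH ?_ ?_ fun y hy => ?_
    · exact ((cont F a le_rfl hab' hdF).div cnL.continuousOn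
        fun y _ => norm_ne_zero_iff.mpr (nL y)).intervalIntegrable
    · exact (ContinuousOn.mul continuousOn_const (((cont G a le_rfl hab' hG).mul
        contExp.continuousOn).div cnL.continuousOn
        fun y _ => norm_ne_zero_iff.mpr (nL y))).intervalIntegrable
    · rw [mul_div_assoc']
      gcongr
      refine (key a y le_rfl hab').trans_eq ?_
      ring
  have bR : (∫ y in (t - H)..(t + H), ‖F (b + y * I)‖ / ‖(b + y * I : ℂ) - c‖) ≤
      Real.exp 7 * (Y ^ (b - σ) / (b - σ) * ∫ y in (t - H)..(t + H),
        ‖G (b + y * I)‖ * Real.exp (-(y - t) ^ 2)) := by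
    rw [← mul_assoc, ← intervalIntegral.integral_const_mul]
    refine intervalIntegral.integral_mono_on htH ?_ ?_ fun y hy => ?_
    · exact ((cont F b hab' le_rfl hdF).div cnR.continuousOn
        fun y _ => norm_ne_zero_iff.mpr (nR y)).intervalIntegrable
    · exact (ContinuousOn.mul continuousOn_const ((cont G b hab' le_rfl hG).mul
        contExp.continuousOn)).intervalIntegrable
    · have h1 : b - σ ≤ ‖(b + y * I : ℂ) - c‖ := by
        have := Complex.abs_re_le_norm ((b + y * I : ℂ) - c)
        have h5 := le_abs_self ((b + y * I : ℂ) - c).re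
        simp [hc] at this h5 ⊢; linarith
      have h2 : 0 < b - σ := sub_pos.mpr hb
      calc _ ≤ ‖F (b + y * I)‖ / (b - σ) := by gcongr
        _ ≤ (‖G (b + y * I)‖ * (Y ^ (b - σ) * (Real.exp 7 * Real.exp (-(y - t) ^ 2)))) / (b - σ) := by
          gcongr; exact key b y hab' le_rfl
        _ = _ := by ring
  have bH : ∀ y : ℝ, |y - t| = H → (∀ x : ℝ, a ≤ x → x ≤ b → ‖G (x + y * I)‖ ≤ M) →
      (∫ x in a..b, ‖F (x + y * I)‖ / ‖(x + y * I : ℂ) - c‖) ≤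
      Real.exp 7 * (5/2 * M * (Y ^ (a - σ) + Y ^ (b - σ)) * Real.exp (-H ^ 2)) := by
    intro y hy hMy
    have h1 : ∀ x ∈ uIoc a b, ‖‖F (x + y * I)‖ / ‖(x + y * I : ℂ) - c‖‖ ≤
        Real.exp 7 * (M * (Y ^ (a - σ) + Y ^ (b - σ)) * Real.exp (-H ^ 2)) := by
      intro x hx
      rw [uIoc_of_le hab'] at hx
      have hn : 1 ≤ ‖(x + y * I : ℂ) - c‖ := by
        have := Complex.abs_im_le_norm ((x + y * I : ℂ) - c)
        simp [hc] at this
        rw [hy] at this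
        exact le_trans (by linarith) this
      rw [norm_div, norm_norm, norm_norm]
      refine (div_le_self (norm_nonneg _) hn).trans ((key x y hx.1.le hx.2).trans ?_)
      have e1 : (y - t) ^ 2 = H ^ 2 := by rw [← sq_abs, hy]
      rw [e1]
      have e2 := rpow_le_rpow_add_rpow hY (sub_le_sub_right hx.1.le σ) (sub_le_sub_right hx.2 σ)
      calc _ ≤ M * ((Y ^ (a - σ) + Y ^ (b - σ)) * (Real.exp 7 * Real.exp (-H ^ 2))) := by
            gcongr
            exact hMy x hx.1.le hx.2
        _ = _ := by ring
    have h2 := intervalIntegral.norm_integral_le_of_norm_le_const h1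
    refine (le_abs_self _).trans (h2.trans ?_)
    rw [abs_of_nonneg (by linarith)]
    have h3 : 0 ≤ Real.exp 7 * (M * (Y ^ (a - σ) + Y ^ (b - σ)) * Real.exp (-H ^ 2)) := by
      positivity
    nlinarith
  have bB := bH (t - H) (by rw [show t - H - t = -H by ring, abs_neg, abs_of_pos (by linarith)]) hM1
  have bT := bH (t + H) (by rw [show t + H - t = H by ring, abs_of_pos (by linarith)]) hM2
  linarith

lemma sum_inv_abs_sub_le (s : Finset ℕ) (m : ℕ) :
    ∑ n ∈ s, (if n ≠ m ∧ n ≤ 2 * m ∧ n ≠ 0 then 1 / |(m : ℝ) - n| else 0) ≤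
      2 * (1 + Real.log m) := by
  have hh : ∑ k ∈ Finset.Icc 1 m, (1 / (k : ℝ)) ≤ 1 + Real.log m := by
    have := harmonic_le_one_add_log m
    rw [harmonic_eq_sum_Icc] at this
    push_cast at this
    simpa using this
  rw [← Finset.sum_filter]
  have key : ∀ (u : Finset ℕ) (f : ℕ → ℕ), (∀ n ∈ u, f n ∈ Finset.Icc 1 m) →
      (∀ x ∈ u, ∀ y ∈ u, f x = f y → x = y) → (∀ n ∈ u, |(m : ℝ) - n| = f n) →
      ∑ n ∈ u, 1 / |(m : ℝ) - n| ≤ 1 + Real.log m := by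
    intro u f h1 h2 h3
    refine le_trans ?_ hh
    rw [Finset.sum_congr rfl (fun n hn => by rw [h3 n hn])]
    rw [← Finset.sum_image (s := u) (g := f) (f := fun k : ℕ => 1 / (k : ℝ))
      (fun x hx y hy => h2 x hx y hy)]
    refine Finset.sum_le_sum_of_subset_of_nonneg ?_ (fun _ _ _ => by positivity)
    intro k hk
    obtain ⟨n, hn, rfl⟩ := Finset.mem_image.mp hk
    exact h1 n hn
  set u := s.filter (fun n => n ≠ m ∧ n ≤ 2 * m ∧ n ≠ 0)
  rw [← Finset.sum_filter_add_sum_filter_not u (fun n => n < m)]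
  have a1 := key (u.filter (fun n => n < m)) (fun n => m - n)
    (by intro n hn; simp [u] at hn ⊢; omega)
    (by intro x hx y hy; simp [u] at hx hy ⊢; omega)
    (by
      intro n hn; simp [u] at hn ⊢
      rw [Nat.cast_sub hn.2.le, abs_of_pos]
      have : (n : ℝ) < m := by exact_mod_cast hn.2
      linarith)
  have a2 := key (u.filter (fun n => ¬ n < m)) (fun n => n - m)
    (by intro n hn; simp [u] at hn ⊢; omega)
    (by intro x hx y hy; simp [u] at hx hy ⊢; omega)
    (by
      intro n hn; simp [u] at hn ⊢
      rw [Nat.cast_sub hn.2, abs_of_nonpos]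
      · ring
      have : (m : ℝ) ≤ n := by exact_mod_cast hn.2
      linarith)
  linarith

lemma one_div_abs_log_sub_log_le {m n : ℕ} (hm : 0 < m) (hmn : m < n) :
    1 / |Real.log n - Real.log m| ≤ 2 + (if n ≤ 2 * m then Real.sqrt (m * n) / |(m : ℝ) - n| else 0) := by
  have hm' : (0 : ℝ) < m := by exact_mod_cast hm
  have hmn' : (m : ℝ) < n := by exact_mod_cast hmn
  have hn' : (0 : ℝ) < n := hm'.trans hmn'
  have h1 : ((n : ℝ) - m) / n ≤ Real.log n - Real.log m := by
    have := Real.one_sub_inv_le_log_of_pos (div_pos hn' hm')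
    rw [Real.log_div hn'.ne' hm'.ne'] at this
    refine le_trans (le_of_eq ?_) this
    field_simp
  have h0 : 0 < ((n : ℝ) - m) / n := div_pos (by linarith) hn'
  rw [abs_of_pos (h0.trans_le h1)]
  have h2 : 1 / (Real.log n - Real.log m) ≤ n / (n - m) := by
    calc _ ≤ 1 / (((n : ℝ) - m) / n) := one_div_le_one_div_of_le h0 h1
      _ = _ := by rw [one_div_div]
  refine h2.trans ?_
  have h3 : (n : ℝ) / (n - m) = 1 + m / (n - m) := by
    have : (n : ℝ) - m ≠ 0 := by linarith
    field_simp; ring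
  rw [h3]
  split_ifs with h
  · rw [abs_of_neg (by linarith : (m : ℝ) - n < 0), neg_sub]
    have : (m : ℝ) ≤ Real.sqrt (m * n) := Real.le_sqrt_of_sq_le (by nlinarith)
    have h5 : (m : ℝ) / (n - m) ≤ Real.sqrt (m * n) / (n - m) :=
      div_le_div_of_nonneg_right this (by linarith)
    linarith
  · push Not at h
    have h' : (2 : ℝ) * m < n := by exact_mod_cast h
    have : (m : ℝ) / (n - m) ≤ 1 := by
      rw [div_le_one (by linarith)]; linarith
    linarith

lemma norm_integral_exp_le (A B c : ℝ) (hc : c ≠ 0) :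
    ‖∫ t in A..B, Complex.exp (t * c * I)‖ ≤ 2 * (1 / |c|) := by
  have h : ∀ t : ℝ, Complex.exp (t * c * I) = Complex.exp ((c * I) * t) := fun t => by ring_nf
  simp_rw [h]
  rw [integral_exp_mul_complex (by simp [hc])]
  rw [norm_div]
  have e1 : ∀ t : ℝ, ‖Complex.exp (c * I * t)‖ = 1 := fun t => by
    rw [Complex.norm_exp]; simp
  have : ‖(c * I : ℂ)‖ = |c| := by simp
  rw [this, mul_one_div]
  gcongr
  refine (norm_sub_le _ _).trans ?_
  rw [e1, e1]; norm_num

/-- A mean value theorem for Dirichlet polynomials. -/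
lemma integral_norm_sq_sum_le (s : Finset ℕ) (hs : 0 ∉ s) (b : ℕ → ℂ) {A B : ℝ} (hAB : A ≤ B) :
    ∫ t in A..B, ‖∑ n ∈ s, b n * Complex.exp (-(t * Real.log n * I))‖ ^ 2 ≤
      (B - A) * ∑ n ∈ s, ‖b n‖ ^ 2 + 4 * (∑ n ∈ s, ‖b n‖) ^ 2 +
        4 * ∑ n ∈ s, n * (1 + Real.log n) * ‖b n‖ ^ 2 := by
  set P : ℝ → ℂ := fun t => ∑ n ∈ s, b n * Complex.exp (-(t * Real.log n * I)) with hP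
  have hPP : ∀ t : ℝ, ((‖P t‖ ^ 2 : ℝ) : ℂ) = ∑ m ∈ s, ∑ n ∈ s,
      (b m * (starRingEnd ℂ) (b n)) * Complex.exp (t * ((Real.log n - Real.log m : ℝ)) * I) := by
    intro t
    have : ((‖P t‖ ^ 2 : ℝ) : ℂ) = P t * (starRingEnd ℂ) (P t) := by
      rw [Complex.mul_conj, Complex.normSq_eq_norm_sq]
    rw [this, hP]
    simp only [map_sum, map_mul]
    rw [Finset.sum_mul_sum]
    refine Finset.sum_congr rfl fun m _ => Finset.sum_congr rfl fun n _ => ?_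
    rw [← Complex.exp_conj]
    simp only [map_neg, map_mul, conj_ofReal, conj_I]
    rw [mul_mul_mul_comm, ← Complex.exp_add]
    congr 2
    push_cast; ring
  have h_integrable : ∀ c : ℝ, ∀ z : ℂ, IntervalIntegrable (fun t : ℝ => z * Complex.exp (t * c * I)) volume A B :=
    fun c z => Continuous.intervalIntegrable (by fun_prop) _ _
  have h1 : ((∫ t in A..B, ‖P t‖ ^ 2 : ℝ) : ℂ) = ∑ m ∈ s, ∑ n ∈ s,
      (b m * (starRingEnd ℂ) (b n)) *
        ∫ t in A..B, Complex.exp (t * ((Real.log n - Real.log m : ℝ)) * I) := by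
    rw [← intervalIntegral.integral_ofReal]
    simp_rw [hPP]
    rw [intervalIntegral.integral_finsetSum
      (fun m _ => by
        have := IntervalIntegrable.sum (μ := volume) (a := A) (b := B) s (f := fun n (t : ℝ) => (b m * (starRingEnd ℂ) (b n)) * Complex.exp (t * ((Real.log n - Real.log m : ℝ)) * I)) (fun n _ => h_integrable _ _)
        simpa [Finset.sum_fn] using this)]
    refine Finset.sum_congr rfl fun m _ => ?_
    rw [intervalIntegral.integral_finsetSum (fun n _ => h_integrable _ _)]
    refine Finset.sum_congr rfl fun n _ => ?_
    rw [intervalIntegral.integral_const_mul]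
  set w : ℕ → ℕ → ℝ := fun m n => if n ≠ m ∧ n ≤ 2 * m ∧ n ≠ 0 then 1 / |(m : ℝ) - n| else 0 with hw
  have hterm : ∀ m ∈ s, ∀ n ∈ s, ‖(b m * (starRingEnd ℂ) (b n)) *
      ∫ t in A..B, Complex.exp (t * ((Real.log n - Real.log m : ℝ)) * I)‖ ≤
      (if m = n then (B - A) * ‖b m‖ ^ 2 else 0) + 4 * (‖b m‖ * ‖b n‖) +
        (m * ‖b m‖ ^ 2 * w m n + n * ‖b n‖ ^ 2 * w n m) := by
    intro m hm n hn
    have hm0 : 0 < m := Nat.pos_of_ne_zero (fun h => hs (h ▸ hm))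
    have hn0 : 0 < n := Nat.pos_of_ne_zero (fun h => hs (h ▸ hn))
    rw [norm_mul, norm_mul, RCLike.norm_conj]
    by_cases hmn : m = n
    · subst hmn
      have : ∫ t in A..B, Complex.exp (t * ((Real.log m - Real.log m : ℝ)) * I) = (B - A : ℝ) := by
        simp
      rw [this, Complex.norm_real, Real.norm_of_nonneg (by linarith)]
      simp [hw]
      nlinarith [norm_nonneg (b m)]
    · have hlog : Real.log n - Real.log m ≠ 0 := by
        intro h
        have : Real.log n = Real.log m := by linarith
        have := Real.log_injOn_pos (by simpa using hn0) (by simpa using hm0) this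
        exact hmn (by exact_mod_cast this.symm)
      have h2 := norm_integral_exp_le A B _ hlog
      have h3 : 1 / |Real.log n - Real.log m| ≤ 2 +
          (if n ≤ 2 * m ∧ m ≤ 2 * n then Real.sqrt (m * n) / |(m : ℝ) - n| else 0) := by
        rcases lt_or_gt_of_ne hmn with h | h
        · have := one_div_abs_log_sub_log_le hm0 h
          have e : (n ≤ 2 * m ∧ m ≤ 2 * n) ↔ n ≤ 2 * m := ⟨fun h => h.1, fun h => ⟨h, by omega⟩⟩
          simpa only [e] using this
        · have := one_div_abs_log_sub_log_le hn0 h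
          have e : (n ≤ 2 * m ∧ m ≤ 2 * n) ↔ m ≤ 2 * n := ⟨fun h => h.2, fun h => ⟨by omega, h⟩⟩
          rw [abs_sub_comm, abs_sub_comm (n : ℝ), mul_comm (n : ℝ)] at this
          simpa only [e] using this
      rw [if_neg hmn, zero_add]
      have h4 : ‖∫ t in A..B, Complex.exp (t * ((Real.log n - Real.log m : ℝ)) * I)‖ ≤ 4 + 
          2 * (if n ≤ 2 * m ∧ m ≤ 2 * n then Real.sqrt (m * n) / |(m : ℝ) - n| else 0) := by
        linarith
      have hb0 : 0 ≤ ‖b m‖ * ‖b n‖ := by positivity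
      refine (mul_le_mul_of_nonneg_left h4 hb0).trans ?_
      have wn : ∀ i j, 0 ≤ w i j := fun i j => by simp only [hw]; split_ifs <;> positivity
      split_ifs with h
      · have w1 : w m n = 1 / |(m : ℝ) - n| := by
          simp only [hw]; rw [if_pos ⟨fun e => hmn e.symm, h.1, hn0.ne'⟩]
        have w2 : w n m = 1 / |(m : ℝ) - n| := by
          simp only [hw]; rw [if_pos ⟨hmn, h.2, hm0.ne'⟩, abs_sub_comm]
        rw [w1, w2]
        have hm1 : (0 : ℝ) ≤ m := by positivity
        have hn1 : (0 : ℝ) ≤ n := by positivity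
        rw [Real.sqrt_mul hm1]
        have e1 := Real.sq_sqrt hm1
        have e2 := Real.sq_sqrt hn1
        have : 2 * (Real.sqrt m * Real.sqrt n * (‖b m‖ * ‖b n‖)) ≤ m * ‖b m‖ ^ 2 + n * ‖b n‖ ^ 2 := by
          nlinarith [sq_nonneg (Real.sqrt m * ‖b m‖ - Real.sqrt n * ‖b n‖)]
        have h6 : 0 ≤ 1 / |(m : ℝ) - n| := by positivity
        have := mul_le_mul_of_nonneg_right this h6
        calc _ = 4 * (‖b m‖ * ‖b n‖) + 2 * (Real.sqrt m * Real.sqrt n * (‖b m‖ * ‖b n‖)) * (1 / |(m : ℝ) - n|) := by ring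
          _ ≤ _ := by linarith
      · have a1 : 0 ≤ (m : ℝ) * ‖b m‖ ^ 2 * w m n := mul_nonneg (by positivity) (wn _ _)
        have a2 : 0 ≤ (n : ℝ) * ‖b n‖ ^ 2 * w n m := mul_nonneg (by positivity) (wn _ _)
        linarith
  have h5 : (∫ t in A..B, ‖P t‖ ^ 2) ≤ ∑ m ∈ s, ∑ n ∈ s, ((if m = n then (B - A) * ‖b m‖ ^ 2 else 0) + 4 * (‖b m‖ * ‖b n‖) +
        (m * ‖b m‖ ^ 2 * w m n + n * ‖b n‖ ^ 2 * w n m)) := by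
    calc (∫ t in A..B, ‖P t‖ ^ 2) ≤ |(∫ t in A..B, ‖P t‖ ^ 2)| := le_abs_self _
      _ = ‖((∫ t in A..B, ‖P t‖ ^ 2 : ℝ) : ℂ)‖ := by rw [Complex.norm_real, Real.norm_eq_abs]
      _ ≤ _ := by
        rw [h1]
        refine (norm_sum_le _ _).trans (Finset.sum_le_sum fun m hm => ?_)
        exact (norm_sum_le _ _).trans (Finset.sum_le_sum fun n hn => hterm m hm n hn)
  refine h5.trans ?_
  simp only [Finset.sum_add_distrib]
  have e1 : ∑ m ∈ s, ∑ n ∈ s, (if m = n then (B - A) * ‖b m‖ ^ 2 else 0) = (B - A) * ∑ n ∈ s, ‖b n‖ ^ 2 := by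
    rw [Finset.mul_sum]
    refine Finset.sum_congr rfl fun m hm => ?_
    simp [hm]
  have e2 : ∑ m ∈ s, ∑ n ∈ s, 4 * (‖b m‖ * ‖b n‖) = 4 * (∑ n ∈ s, ‖b n‖) ^ 2 := by
    rw [sq, Finset.sum_mul_sum]; simp only [Finset.mul_sum]
  have e3 : ∑ m ∈ s, ∑ n ∈ s, (m : ℝ) * ‖b m‖ ^ 2 * w m n ≤ 2 * ∑ n ∈ s, n * (1 + Real.log n) * ‖b n‖ ^ 2 := by
    rw [Finset.mul_sum]
    refine Finset.sum_le_sum fun m hm => ?_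
    rw [← Finset.mul_sum]
    have := mul_le_mul_of_nonneg_left (sum_inv_abs_sub_le s m) (by positivity : 0 ≤ (m : ℝ) * ‖b m‖ ^ 2)
    refine this.trans (le_of_eq (by ring))
  have e4 : ∑ m ∈ s, ∑ n ∈ s, (n : ℝ) * ‖b n‖ ^ 2 * w n m = ∑ m ∈ s, ∑ n ∈ s, (m : ℝ) * ‖b m‖ ^ 2 * w m n :=
    Finset.sum_comm
  rw [e1, e2, e4]
  linarith

/-- The mean value theorem for absolutely convergent Dirichlet series. -/
lemma integral_norm_sq_tsum_le (b : ℕ → ℂ) (hb0 : b 0 = 0) {A B S₁ S₂ S₃ : ℝ} (hAB : A ≤ B)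
    (h₁ : ∀ s : Finset ℕ, ∑ n ∈ s, ‖b n‖ ≤ S₁)
    (h₂ : ∀ s : Finset ℕ, ∑ n ∈ s, ‖b n‖ ^ 2 ≤ S₂)
    (h₃ : ∀ s : Finset ℕ, ∑ n ∈ s, n * (1 + Real.log n) * ‖b n‖ ^ 2 ≤ S₃) :
    ∫ t in A..B, ‖∑' n, b n * Complex.exp (-(t * Real.log n * I))‖ ^ 2 ≤
      (B - A) * S₂ + 4 * S₁ ^ 2 + 4 * S₃ := by
  have hsum : Summable (fun n => ‖b n‖) := summable_of_sum_le (fun _ => norm_nonneg _) h₁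
  have he : ∀ (t : ℝ) (n : ℕ), ‖b n * Complex.exp (-(t * Real.log n * I))‖ = ‖b n‖ := by
    intro t n
    rw [norm_mul, show -((t : ℂ) * Real.log n * I) = ((-(t * Real.log n) : ℝ) : ℂ) * I by push_cast; ring,
      Complex.norm_exp_ofReal_mul_I, mul_one]
  have hsm : ∀ t : ℝ, Summable (fun n => b n * Complex.exp (-(t * Real.log n * I))) := by
    intro t
    refine Summable.of_norm ?_
    simpa only [he] using hsum
  have hlim : Tendsto (fun s : Finset ℕ => ∫ t in A..B, ‖∑ n ∈ s, b n * Complex.exp (-(t * Real.log n * I))‖ ^ 2)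
      atTop (nhds (∫ t in A..B, ‖∑' n, b n * Complex.exp (-(t * Real.log n * I))‖ ^ 2)) := by
    refine intervalIntegral.tendsto_integral_filter_of_dominated_convergence (fun _ => S₁ ^ 2) ?_ ?_ ?_ ?_
    · refine Eventually.of_forall fun s => Continuous.aestronglyMeasurable (by fun_prop)
    · refine Eventually.of_forall fun s => ae_of_all _ fun t _ => ?_
      rw [norm_pow, norm_norm]
      gcongr
      refine (norm_sum_le _ _).trans ?_
      simp only [he]; exact h₁ s
    · exact intervalIntegrable_const
    · refine ae_of_all _ fun t _ => ?_
      exact ((hsm t).hasSum.norm).pow 2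
  refine le_of_tendsto hlim (Eventually.of_forall fun s => ?_)
  have e0 : ∀ t : ℝ, ∑ n ∈ s, b n * Complex.exp (-(t * Real.log n * I)) =
      ∑ n ∈ s.erase 0, b n * Complex.exp (-(t * Real.log n * I)) := by
    intro t
    rw [Finset.sum_erase]; simp [hb0]
  simp_rw [e0]
  refine (integral_norm_sq_sum_le (s.erase 0) (by simp) b hAB).trans ?_
  have := h₁ (s.erase 0)
  have := h₂ (s.erase 0)
  have := h₃ (s.erase 0)
  have hn : 0 ≤ ∑ n ∈ s.erase 0, ‖b n‖ := Finset.sum_nonneg fun _ _ => norm_nonneg _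
  have : 0 ≤ B - A := by linarith
  gcongr

lemma integral_conv_le_of_continuous {h k : ℝ → ℝ} {A B H K : ℝ} (hAB : A ≤ B) (hH : 0 ≤ H)
    (hh : Continuous h) (hh0 : ∀ y, 0 ≤ h y) (hk : Continuous k) (hk0 : ∀ v, 0 ≤ k v)
    (hK : ∫ v in (-H)..H, k v ≤ K) :
    Continuous (fun t => ∫ y in (t - H)..(t + H), h y * k (y - t)) ∧
    ∫ t in A..B, ∫ y in (t - H)..(t + H), h y * k (y - t) ≤ K * ∫ y in (A - H)..(B + H), h y := by
  have e : ∀ t : ℝ, ∫ y in (t - H)..(t + H), h y * k (y - t) = ∫ v in (-H)..H, h (t + v) * k v := by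
    intro t
    have := intervalIntegral.integral_comp_add_left (f := fun y => h y * k (y - t)) (a := -H) (b := H) t
    simp only [add_sub_cancel_left] at this
    rw [this]; rfl
  simp_rw [e]
  have hc : Continuous (Function.uncurry fun t v : ℝ => h (t + v) * k v) := by
    unfold Function.uncurry; fun_prop
  refine ⟨intervalIntegral.continuous_parametric_intervalIntegral_of_continuous' hc _ _, ?_⟩
  rw [intervalIntegral_intervalIntegral_swap]
  · have h_integrable : ∀ a b : ℝ, IntervalIntegrable h volume a b := fun a b => hh.intervalIntegrable _ _
    have h0 : 0 ≤ ∫ y in (A - H)..(B + H), h y :=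
      intervalIntegral.integral_nonneg (by linarith) fun y _ => hh0 y
    calc ∫ v in (-H)..H, ∫ t in A..B, h (t + v) * k v
        ≤ ∫ v in (-H)..H, (∫ y in (A - H)..(B + H), h y) * k v := by
          refine intervalIntegral.integral_mono_on (by linarith) ?_ ?_ fun v hv => ?_
          · refine Continuous.intervalIntegrable ?_ _ _
            refine intervalIntegral.continuous_parametric_intervalIntegral_of_continuous' ?_ _ _
            unfold Function.uncurry; fun_prop
          · exact (hk.const_mul _).intervalIntegrable _ _
          · rw [intervalIntegral.integral_mul_const]
            refine mul_le_mul_of_nonneg_right ?_ (hk0 v)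
            rw [intervalIntegral.integral_comp_add_right]
            exact intervalIntegral.integral_mono_interval (by linarith [hv.1]) (by linarith)
              (by linarith [hv.2]) (ae_of_all _ hh0) (h_integrable _ _)
      _ = (∫ y in (A - H)..(B + H), h y) * ∫ v in (-H)..H, k v := by
          rw [intervalIntegral.integral_const_mul]
      _ ≤ _ := by rw [mul_comm]; gcongr
  · refine (hc.continuousOn.integrableOn_compact ((isCompact_uIcc (a := A) (b := B)).prod (isCompact_uIcc (a := -H) (b := H)))).mono_set ?_
    exact prod_mono uIoc_subset_uIcc uIoc_subset_uIcc

lemma integral_conv_le {h k : ℝ → ℝ} {A B H K : ℝ} (hAB : A ≤ B) (hH : 0 ≤ H)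
    (hh : ContinuousOn h (Icc (A - H) (B + H))) (hh0 : ∀ y, 0 ≤ h y) (hk : Continuous k)
    (hk0 : ∀ v, 0 ≤ k v) (hK : ∫ v in (-H)..H, k v ≤ K) :
    ContinuousOn (fun t => ∫ y in (t - H)..(t + H), h y * k (y - t)) (Icc A B) ∧
    ∫ t in A..B, ∫ y in (t - H)..(t + H), h y * k (y - t) ≤ K * ∫ y in (A - H)..(B + H), h y := by
  have hle : A - H ≤ B + H := by linarith
  set h' : ℝ → ℝ := IccExtend hle ((Icc (A - H) (B + H)).domRestrict h) with hh'
  have hc : Continuous h' := (continuousOn_iff_continuous_domRestrict.mp hh).Icc_extend'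
  have heq : ∀ y ∈ Icc (A - H) (B + H), h' y = h y := fun y hy => by
    rw [hh', IccExtend_of_mem _ _ hy]; rfl
  have hn : ∀ y, 0 ≤ h' y := fun y => hh0 _
  have main := integral_conv_le_of_continuous (h := h') hAB hH hc hn hk hk0 hK
  have e1 : ∀ t ∈ Icc A B, ∫ y in (t - H)..(t + H), h y * k (y - t) =
      ∫ y in (t - H)..(t + H), h' y * k (y - t) := by
    intro t ht
    refine intervalIntegral.integral_congr fun y hy => ?_
    rw [uIcc_of_le (by linarith)] at hy
    rw [heq y ⟨by linarith [hy.1, ht.1], by linarith [hy.2, ht.2]⟩]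
  refine ⟨main.1.continuousOn.congr e1, ?_⟩
  rw [intervalIntegral.integral_congr (g := fun t => ∫ y in (t - H)..(t + H), h' y * k (y - t))
    (fun t ht => e1 t (by rwa [uIcc_of_le hAB] at ht))]
  rw [intervalIntegral.integral_congr (f := h) (g := h')
    (fun t ht => (heq t (by rwa [uIcc_of_le hle] at ht)).symm)]
  exact main.2

lemma intervalIntegral_exp_neg_sq_le (H : ℝ) (hH : 0 ≤ H) : ∫ v in (-H)..H, Real.exp (-v ^ 2) ≤ 2 := by
  rw [intervalIntegral.integral_of_le (by linarith)]
  have h1 : Integrable (fun v : ℝ => Real.exp (-v ^ 2)) := by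
    simpa using integrable_exp_neg_mul_sq (b := 1) one_pos
  have h2 : ∫ v : ℝ, Real.exp (-v ^ 2) = Real.sqrt π := by
    simpa using integral_gaussian 1
  refine (setIntegral_le_integral h1 (ae_of_all _ fun v => (Real.exp_pos _).le)).trans ?_
  rw [h2, Real.sqrt_le_left (by norm_num)]
  linarith [Real.pi_lt_four]

lemma sum_rpow_neg_le {κ : ℝ} (hκ : 0 < κ) (hκ1 : κ ≤ 1) (N : ℕ) :
    ∑ n ∈ Finset.Icc 1 N, (n : ℝ) ^ (-1 - κ) ≤ 1 + 1 / κ := by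
  suffices h : ∀ N : ℕ, ∑ n ∈ Finset.Icc 1 (N + 1), (n : ℝ) ^ (-1 - κ) ≤
      1 + 1 / κ - (1 / κ) * ((N + 1 : ℕ) : ℝ) ^ (-κ) by
    rcases N with _ | N
    · simp; positivity
    · refine (h N).trans ?_
      have : 0 ≤ (1 / κ) * ((N + 1 : ℕ) : ℝ) ^ (-κ) := by positivity
      linarith
  intro N
  induction N with
  | zero => simp
  | succ N ih =>
    rw [Finset.sum_Icc_succ_top (by omega)]
    refine (add_le_add_left ih _).trans ?_
    set x : ℝ := ((N + 1 : ℕ) : ℝ) with hx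
    have hx1 : 1 ≤ x := by rw [hx]; exact_mod_cast Nat.le_add_left 1 N
    have hy : ((N + 1 + 1 : ℕ) : ℝ) = x + 1 := by rw [hx]; push_cast; ring
    rw [hy]
    have h1 := rpow_one_add_le_one_add_mul_self (s := -(1 / (x + 1)))
      (by rw [neg_le_neg_iff, div_le_one (by linarith)]; linarith) hκ.le hκ1
    have h2 : 1 + -(1 / (x + 1)) = x / (x + 1) := by field_simp; ring
    rw [h2, Real.div_rpow (by linarith) (by linarith)] at h1
    have p1 : 0 < x ^ κ := by positivity
    have p2 : 0 < (x + 1) ^ κ := by positivity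
    have h3 : (x + 1) ^ (-1 - κ) = 1 / (x + 1) * (x + 1) ^ (-κ) := by
      rw [show -1 - κ = -1 + -κ by ring, Real.rpow_add (by linarith), Real.rpow_neg_one, one_div]
    rw [h3]
    have h4 : (x + 1) ^ (-κ) * (1 + κ * (1 / (x + 1))) ≤ x ^ (-κ) := by
      rw [Real.rpow_neg (by linarith), Real.rpow_neg (by linarith)]
      set q := 1 / (x + 1)
      have hq0 : 0 < q := by positivity
      have hr : x ^ κ * (1 + κ * q) ≤ (x + 1) ^ κ := by
        rw [div_le_iff₀ p2] at h1
        have : 0 < 1 + κ * q := by positivity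
        nlinarith [mul_le_mul_of_nonneg_right h1 this.le, mul_pos hκ hq0, mul_pos p2 (mul_pos (mul_pos hκ hq0) (mul_pos hκ hq0))]
      rw [inv_mul_le_iff₀ p2, ← div_eq_mul_inv, le_div_iff₀ p1]
      linarith
    have h5 : 1 / κ * ((x + 1) ^ (-κ) * (1 + κ * (1 / (x + 1)))) ≤ 1 / κ * x ^ (-κ) := by gcongr
    have h6 : 1 / κ * ((x + 1) ^ (-κ) * (1 + κ * (1 / (x + 1)))) = 1 / κ * (x + 1) ^ (-κ) + 1 / (x + 1) * (x + 1) ^ (-κ) := by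
      field_simp
    linarith

lemma sum_divisorsAntidiagonal_le (g : ℕ → ℝ) (hg : ∀ n, 0 ≤ g n) (N : ℕ) :
    ∑ n ∈ Finset.Icc 1 N, ∑ p ∈ n.divisorsAntidiagonal, g p.1 * g p.2 ≤ (∑ n ∈ Finset.Icc 1 N, g n) ^ 2 := by
  rw [sq, Finset.sum_mul_sum, Finset.sum_sigma', ← Finset.sum_product']
  have hinj : Set.InjOn (fun x : (_ : ℕ) × ℕ × ℕ => x.2)
      ((Finset.Icc 1 N).sigma fun n => n.divisorsAntidiagonal) := by
    rintro ⟨n, p⟩ hx ⟨m, q⟩ hy h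
    simp only [Finset.coe_sigma, Set.mem_sigma_iff, Finset.mem_coe, Nat.mem_divisorsAntidiagonal] at hx hy h
    subst h
    have : n = m := hx.2.1.symm.trans hy.2.1
    subst this; rfl
  rw [← Finset.sum_image (f := fun p : ℕ × ℕ => g p.1 * g p.2) hinj]
  refine Finset.sum_le_sum_of_subset_of_nonneg ?_ fun p _ _ => mul_nonneg (hg _) (hg _)
  intro p hp
  simp only [Finset.mem_image, Finset.mem_sigma, Finset.mem_Icc, Nat.mem_divisorsAntidiagonal] at hp
  obtain ⟨⟨n, q⟩, ⟨⟨h1, h2⟩, h3, h4⟩, rfl⟩ := hp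
  simp only [Finset.mem_product, Finset.mem_Icc] at h1 h2 h3 ⊢
  have p1 : 0 < q.1 := Nat.pos_of_ne_zero (by rintro h; simp [h] at h3; omega)
  have p2 : 0 < q.2 := Nat.pos_of_ne_zero (by rintro h; simp [h] at h3; omega)
  exact ⟨⟨p1, by nlinarith⟩, ⟨p2, by nlinarith⟩⟩

lemma card_divisors_mul_le (m n : ℕ) :
    (m * n).divisors.card ≤ m.divisors.card * n.divisors.card := by
  rw [Nat.divisors_mul]
  exact Finset.card_mul_le

lemma sum_card_divisors_rpow_le {κ : ℝ} (hκ : 0 < κ) (hκ1 : κ ≤ 1) (N : ℕ) :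
    ∑ n ∈ Finset.Icc 1 N, (n.divisors.card : ℝ) * (n : ℝ) ^ (-1 - κ) ≤ (1 + 1 / κ) ^ 2 := by
  have h := sum_divisorsAntidiagonal_le (fun n => (n : ℝ) ^ (-1 - κ)) (fun n => by positivity) N
  have h2 := sum_rpow_neg_le hκ hκ1 N
  have h0 : 0 ≤ ∑ n ∈ Finset.Icc 1 N, (n : ℝ) ^ (-1 - κ) := Finset.sum_nonneg fun _ _ => by positivity
  refine le_trans (le_of_eq ?_) (h.trans (by gcongr))
  refine Finset.sum_congr rfl fun n _ => ?_
  rw [Nat.sum_divisorsAntidiagonal (fun i j => (i : ℝ) ^ (-1 - κ) * (j : ℝ) ^ (-1 - κ)),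
    ← nsmul_eq_mul, ← Finset.sum_const]
  refine Finset.sum_congr rfl fun d hd => ?_
  rw [← Real.mul_rpow (by positivity) (by positivity), ← Nat.cast_mul, Nat.mul_div_cancel' (Nat.dvd_of_mem_divisors hd)]

lemma sum_card_divisors_sq_rpow_le {κ : ℝ} (hκ : 0 < κ) (hκ1 : κ ≤ 1) (N : ℕ) :
    ∑ n ∈ Finset.Icc 1 N, (n.divisors.card : ℝ) ^ 2 * (n : ℝ) ^ (-1 - κ) ≤ (1 + 1 / κ) ^ 4 := by
  have h := sum_divisorsAntidiagonal_le (fun n => (n.divisors.card : ℝ) * (n : ℝ) ^ (-1 - κ)) (fun n => by positivity) N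
  have h2 := sum_card_divisors_rpow_le hκ hκ1 N
  have h0 : 0 ≤ ∑ n ∈ Finset.Icc 1 N, (n.divisors.card : ℝ) * (n : ℝ) ^ (-1 - κ) := Finset.sum_nonneg fun _ _ => by positivity
  refine le_trans ?_ (h.trans (by rw [show (4 : ℕ) = 2 * 2 by rfl, pow_mul]; gcongr))
  refine Finset.sum_le_sum fun n _ => ?_
  rw [Nat.sum_divisorsAntidiagonal (fun i j => (i.divisors.card : ℝ) * (i : ℝ) ^ (-1 - κ) *
    ((j.divisors.card : ℝ) * (j : ℝ) ^ (-1 - κ))), sq, mul_assoc, ← nsmul_eq_mul, ← Finset.sum_const]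
  refine Finset.sum_le_sum fun d hd => ?_
  have hdn := Nat.mul_div_cancel' (Nat.dvd_of_mem_divisors hd)
  have h1 : (n.divisors.card : ℝ) ≤ d.divisors.card * (n / d).divisors.card := by
    exact_mod_cast hdn ▸ card_divisors_mul_le d (n / d)
  calc _ ≤ (d.divisors.card * (n / d).divisors.card : ℝ) * (n : ℝ) ^ (-1 - κ) := by gcongr
    _ = (d.divisors.card * (n / d).divisors.card : ℝ) * ((d : ℝ) ^ (-1 - κ) * ((n / d : ℕ) : ℝ) ^ (-1 - κ)) := by
      rw [← Real.mul_rpow (by positivity) (by positivity), ← Nat.cast_mul d, hdn]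
    _ = _ := by ring

/-- The Dirichlet polynomial `∑_{n ≤ N} a n * n ^ (-z)`. -/
def dirPoly (a : ℕ → ℝ) (N : ℕ) (z : ℂ) : ℂ := ∑ n ∈ Finset.Icc 1 N, (a n : ℂ) * (n : ℂ) ^ (-z)

lemma nat_cpow_neg_eq {n : ℕ} (hn : n ≠ 0) (x t : ℝ) :
    (n : ℂ) ^ (-(x + t * I : ℂ)) = (((n : ℝ) ^ (-x) : ℝ) : ℂ) * Complex.exp (-(t * Real.log n * I)) := by
  have hn' : (n : ℂ) ≠ 0 := by exact_mod_cast hn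
  have hn0 : (0 : ℝ) < n := by exact_mod_cast Nat.pos_of_ne_zero hn
  rw [Complex.cpow_def_of_ne_zero hn', Real.rpow_def_of_pos hn0, Complex.ofReal_exp, ← Complex.exp_add,
    ← Complex.natCast_log]
  congr 1
  push_cast; ring

lemma norm_nat_cpow_neg {n : ℕ} (hn : n ≠ 0) (z : ℂ) : ‖(n : ℂ) ^ (-z)‖ = (n : ℝ) ^ (-z.re) := by
  rw [Complex.norm_natCast_cpow_of_pos (Nat.pos_of_ne_zero hn)]; simp

lemma dirPoly_eq (a : ℕ → ℝ) (N : ℕ) (x t : ℝ) : dirPoly a N (x + t * I) =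
    ∑ n ∈ Finset.Icc 1 N, ((a n * (n : ℝ) ^ (-x) : ℝ) : ℂ) * Complex.exp (-(t * Real.log n * I)) := by
  refine Finset.sum_congr rfl fun n hn => ?_
  rw [nat_cpow_neg_eq (by have := (Finset.mem_Icc.mp hn).1; omega)]
  push_cast; ring

lemma differentiable_dirPoly (a : ℕ → ℝ) (N : ℕ) : Differentiable ℂ (dirPoly a N) := by
  unfold dirPoly
  refine Differentiable.fun_sum fun n hn => ?_
  have : (n : ℂ) ≠ 0 := by have := (Finset.mem_Icc.mp hn).1; exact_mod_cast (by omega : n ≠ 0)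
  intro z
  exact (differentiableAt_id.neg.const_cpow (Or.inl this)).const_mul _

lemma norm_dirPoly_conj (a : ℕ → ℝ) (N : ℕ) (z : ℂ) :
    ‖dirPoly a N ((starRingEnd ℂ) z)‖ = ‖dirPoly a N z‖ := by
  have : dirPoly a N ((starRingEnd ℂ) z) = (starRingEnd ℂ) (dirPoly a N z) := by
    unfold dirPoly
    rw [map_sum]
    refine Finset.sum_congr rfl fun n _ => ?_
    rw [map_mul, Complex.conj_ofReal, ← map_neg]
    rw [Complex.cpow_conj _ _ (by
      rw [← Complex.ofReal_natCast, Complex.arg_ofReal_of_nonneg (by positivity)]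
      exact Real.pi_ne_zero.symm)]
    simp
  rw [this, RCLike.norm_conj]

lemma integral_norm_sq_dirPoly_le (a : ℕ → ℝ) (N : ℕ) (x : ℝ) {A B : ℝ} (hAB : A ≤ B) :
    ∫ t in A..B, ‖dirPoly a N (x + t * I)‖ ^ 2 ≤
      (B - A + 8 * N * (1 + Real.log N)) * ∑ n ∈ Finset.Icc 1 N, a n ^ 2 * (n : ℝ) ^ (-(2 * x)) := by
  simp_rw [dirPoly_eq]
  refine (integral_norm_sq_sum_le (Finset.Icc 1 N) (by simp) _ hAB).trans ?_
  have e : ∀ n ∈ Finset.Icc 1 N, ‖((a n * (n : ℝ) ^ (-x) : ℝ) : ℂ)‖ ^ 2 = a n ^ 2 * (n : ℝ) ^ (-(2 * x)) := by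
    intro n hn
    rw [Complex.norm_real, Real.norm_eq_abs, sq_abs, mul_pow, ← Real.rpow_natCast ((n : ℝ) ^ (-x)),
      ← Real.rpow_mul (by positivity)]
    congr 2; push_cast; ring
  rw [Finset.sum_congr rfl e]
  set W := ∑ n ∈ Finset.Icc 1 N, a n ^ 2 * (n : ℝ) ^ (-(2 * x)) with hS
  have hS0 : 0 ≤ W := Finset.sum_nonneg fun _ _ => by positivity
  have h1 : (∑ n ∈ Finset.Icc 1 N, ‖((a n * (n : ℝ) ^ (-x) : ℝ) : ℂ)‖) ^ 2 ≤ N * W := by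
    have := sq_sum_le_card_mul_sum_sq (s := Finset.Icc 1 N) (f := fun n => ‖((a n * (n : ℝ) ^ (-x) : ℝ) : ℂ)‖)
    rw [Finset.sum_congr rfl e] at this
    simpa using this
  have h2 : ∑ n ∈ Finset.Icc 1 N, n * (1 + Real.log n) * ‖((a n * (n : ℝ) ^ (-x) : ℝ) : ℂ)‖ ^ 2 ≤
      N * (1 + Real.log N) * W := by
    rw [hS, Finset.mul_sum]
    refine Finset.sum_le_sum fun n hn => ?_
    rw [e n hn]
    have hn1 := (Finset.mem_Icc.mp hn).1
    have hn2 : (n : ℝ) ≤ N := by exact_mod_cast (Finset.mem_Icc.mp hn).2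
    have hn3 : (0 : ℝ) < n := by exact_mod_cast hn1
    have := Real.log_natCast_nonneg n
    gcongr
  have h3 : (0 : ℝ) ≤ N * Real.log N * W := by
    have := Real.log_natCast_nonneg N
    positivity
  nlinarith

lemma sum_sq_rpow_le {a : ℕ → ℝ} {κ V E x : ℝ} {N : ℕ}
    (hV : ∑ n ∈ Finset.Icc 1 N, a n ^ 2 * (n : ℝ) ^ (-1 - κ) ≤ V) (hE : 0 ≤ E)
    (h : ∀ n ∈ Finset.Icc 1 N, (n : ℝ) ^ (1 + κ - 2 * x) ≤ E) :
    ∑ n ∈ Finset.Icc 1 N, a n ^ 2 * (n : ℝ) ^ (-(2 * x)) ≤ E * V := by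
  refine le_trans ?_ (mul_le_mul_of_nonneg_left hV hE)
  rw [Finset.mul_sum]
  refine Finset.sum_le_sum fun n hn => ?_
  have hn1 : (0 : ℝ) < n := by exact_mod_cast (Finset.mem_Icc.mp hn).1
  have : (n : ℝ) ^ (-(2 * x)) = (n : ℝ) ^ (1 + κ - 2 * x) * (n : ℝ) ^ (-1 - κ) := by
    rw [← Real.rpow_add hn1]; congr 1; ring
  rw [this]
  have := h n hn
  have h2 : 0 ≤ a n ^ 2 * (n : ℝ) ^ (-1 - κ) := by positivity
  nlinarith

lemma integral_norm_sq_tail_le {a : ℕ → ℝ} {k : ℕ} (ha0 : a 0 = 0) (ha : ∀ n, 0 ≤ a n)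
    (ha2 : ∀ n, a n ≤ a n ^ 2)
    (hser : ∀ z : ℂ, 1 < z.re → HasSum (fun n : ℕ => (a n : ℂ) * (n : ℂ) ^ (-z)) (riemannZeta z ^ k))
    {κ V E Y A B : ℝ} (hκ : 0 < κ) (hκ1 : κ ≤ 1 / 4) (hY : 1 ≤ Y) (hE : Y ^ κ ≤ E)
    (hV : ∀ N, ∑ n ∈ Finset.Icc 1 N, a n ^ 2 * (n : ℝ) ^ (-1 - κ) ≤ V) (hAB : A ≤ B) :
    Y ^ 2 * ∫ t in A..B, ‖riemannZeta ((3 / 2 : ℝ) + t * I) ^ k - dirPoly a ⌊Y⌋₊ ((3 / 2 : ℝ) + t * I)‖ ^ 2 ≤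
      (B - A) * E * V + 4 * E ^ 2 * Y * V ^ 2 + 8 / κ * E ^ 2 * Y * V := by
  have hY0 : 0 < Y := by linarith
  have hE0 : 0 < E := lt_of_lt_of_le (by positivity) hE
  have hV0 : 0 ≤ V := le_trans (Finset.sum_nonneg fun _ _ => by positivity) (hV 0)
  set N := ⌊Y⌋₊ with hN
  set b : ℕ → ℂ := fun n => if N < n then ((a n * (n : ℝ) ^ (-(3 / 2) : ℝ) : ℝ) : ℂ) else 0 with hb
  have hVs : ∀ s : Finset ℕ, ∑ n ∈ s, a n ^ 2 * (n : ℝ) ^ (-1 - κ) ≤ V := by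
    intro s
    refine le_trans ?_ (hV (s.sup id))
    rw [← Finset.sum_erase (s := s) (a := 0) (by simp [ha0])]
    refine Finset.sum_le_sum_of_subset_of_nonneg ?_ fun _ _ _ => by positivity
    intro n hn
    rw [Finset.mem_erase] at hn
    rw [Finset.mem_Icc]
    exact ⟨by omega, Finset.le_sup (f := id) hn.2⟩
  have gen : ∀ (f : ℕ → ℝ) (c : ℝ), (∀ n, N < n → f n ≤ c * (a n ^ 2 * (n : ℝ) ^ (-1 - κ))) →
      (∀ n, ¬ N < n → f n = 0) → 0 ≤ c → ∀ s : Finset ℕ, ∑ n ∈ s, f n ≤ c * V := by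
    intro f c h1 h2 hc s
    refine le_trans (Finset.sum_le_sum fun n _ => ?_)
      ((Finset.mul_sum s (fun n => a n ^ 2 * (n : ℝ) ^ (-1 - κ)) c).symm.le.trans
        (mul_le_mul_of_nonneg_left (hVs s) hc))
    by_cases h : N < n
    · exact h1 n h
    · rw [h2 n h]; positivity
  have hbn : ∀ n, N < n → ‖b n‖ = a n * (n : ℝ) ^ (-(3 / 2) : ℝ) := by
    intro n hn
    simp only [hb, if_pos hn]
    rw [Complex.norm_real, Real.norm_of_nonneg]
    have := ha n; positivity
  have hbz : ∀ n, ¬ N < n → ‖b n‖ = 0 := by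
    intro n hn; simp only [hb, if_neg hn, norm_zero]
  have hpos : ∀ n, N < n → (0 : ℝ) < n := fun n hn => by exact_mod_cast (by omega : 0 < n)
  have hYn : ∀ n, N < n → Y ≤ n := fun n hn => (Nat.lt_of_floor_lt hn).le
  have hsq : ∀ n, N < n → ‖b n‖ ^ 2 = a n ^ 2 * (n : ℝ) ^ (-3 : ℝ) := by
    intro n hn
    rw [hbn n hn, mul_pow, ← Real.rpow_natCast ((n : ℝ) ^ (-(3 / 2) : ℝ)), ← Real.rpow_mul (hpos n hn).le]
    norm_num
  have hYκ : 0 < Y ^ κ := by positivity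
  have b1 := gen (fun n => ‖b n‖) (E * Y ^ (-(1 / 2) : ℝ)) (by
    intro n hn
    rw [hbn n hn]
    have hn0 := hpos n hn
    have e1 : (n : ℝ) ^ (-(3 / 2) : ℝ) = (n : ℝ) ^ (-(1 / 2) + κ) * (n : ℝ) ^ (-1 - κ) := by
      rw [← Real.rpow_add hn0]; norm_num
    have e2 : (n : ℝ) ^ (-(1 / 2) + κ) ≤ E * Y ^ (-(1 / 2) : ℝ) := by
      refine (Real.rpow_le_rpow_of_nonpos hY0 (hYn n hn) (by linarith)).trans ?_
      rw [Real.rpow_add hY0, mul_comm]; gcongr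
    rw [e1]
    have := ha n; have := ha2 n
    calc a n * ((n : ℝ) ^ (-(1 / 2) + κ) * (n : ℝ) ^ (-1 - κ))
        ≤ a n ^ 2 * (E * Y ^ (-(1 / 2) : ℝ) * (n : ℝ) ^ (-1 - κ)) := by gcongr
      _ = _ := by ring) (fun n hn => hbz n hn) (by positivity)
  have b2 := gen (fun n => ‖b n‖ ^ 2) (E * Y ^ (-2 : ℝ)) (by
    intro n hn
    rw [hsq n hn]
    have hn0 := hpos n hn
    have e1 : (n : ℝ) ^ (-3 : ℝ) = (n : ℝ) ^ (-2 + κ) * (n : ℝ) ^ (-1 - κ) := by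
      rw [← Real.rpow_add hn0]; congr 1; ring
    have e2 : (n : ℝ) ^ (-2 + κ) ≤ E * Y ^ (-2 : ℝ) := by
      refine (Real.rpow_le_rpow_of_nonpos hY0 (hYn n hn) (by linarith)).trans ?_
      rw [Real.rpow_add hY0, mul_comm]; gcongr
    rw [e1]
    calc a n ^ 2 * ((n : ℝ) ^ (-2 + κ) * (n : ℝ) ^ (-1 - κ))
        ≤ a n ^ 2 * (E * Y ^ (-2 : ℝ) * (n : ℝ) ^ (-1 - κ)) := by gcongr
      _ = _ := by ring) (fun n hn => by simp only [hbz n hn]; norm_num) (by positivity)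
  have b3 := gen (fun n => n * (1 + Real.log n) * ‖b n‖ ^ 2) (2 / κ * E ^ 2 * Y ^ (-1 : ℝ)) (by
    intro n hn
    rw [hsq n hn]
    have hn0 := hpos n hn
    have hn1 : (1 : ℝ) ≤ n := by exact_mod_cast (by omega : 1 ≤ n)
    have e0 : 1 + Real.log n ≤ 2 / κ * (n : ℝ) ^ κ := by
      have h1 := Real.log_le_rpow_div hn0.le hκ
      have h2 : (1 : ℝ) ≤ (n : ℝ) ^ κ := Real.one_le_rpow hn1 hκ.le
      have h3 : (n : ℝ) ^ κ ≤ (n : ℝ) ^ κ / κ := by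
        rw [le_div_iff₀ hκ]; nlinarith
      calc _ ≤ (n : ℝ) ^ κ / κ + (n : ℝ) ^ κ / κ := by linarith
        _ = _ := by ring
    have e1 : (n : ℝ) ^ κ * (n * (n : ℝ) ^ (-3 : ℝ)) = (n : ℝ) ^ (-1 + κ + κ) * (n : ℝ) ^ (-1 - κ) := by
      nth_rewrite 2 [← Real.rpow_one (n : ℝ)]
      rw [← Real.rpow_add hn0, ← Real.rpow_add hn0, ← Real.rpow_add hn0]; congr 1; ring
    have e2 : (n : ℝ) ^ (-1 + κ + κ) ≤ E ^ 2 * Y ^ (-1 : ℝ) := by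
      refine (Real.rpow_le_rpow_of_nonpos hY0 (hYn n hn) (by linarith)).trans ?_
      rw [Real.rpow_add hY0, Real.rpow_add hY0]
      calc _ = Y ^ κ * Y ^ κ * Y ^ (-1 : ℝ) := by ring
        _ ≤ E * E * Y ^ (-1 : ℝ) := by gcongr
        _ = _ := by ring
    calc (n : ℝ) * (1 + Real.log n) * (a n ^ 2 * (n : ℝ) ^ (-3 : ℝ))
        ≤ n * (2 / κ * (n : ℝ) ^ κ) * (a n ^ 2 * (n : ℝ) ^ (-3 : ℝ)) := by gcongr
      _ = 2 / κ * a n ^ 2 * ((n : ℝ) ^ κ * (n * (n : ℝ) ^ (-3 : ℝ))) := by ring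
      _ ≤ 2 / κ * a n ^ 2 * (E ^ 2 * Y ^ (-1 : ℝ) * (n : ℝ) ^ (-1 - κ)) := by rw [e1]; gcongr
      _ = _ := by ring) (fun n hn => by simp only [hbz n hn]; norm_num) (by positivity)
  have hb0 : b 0 = 0 := by simp [hb]
  have main := integral_norm_sq_tsum_le b hb0 hAB b1 b2 b3
  have heq : ∀ t : ℝ, riemannZeta ((3 / 2 : ℝ) + t * I) ^ k - dirPoly a N ((3 / 2 : ℝ) + t * I) =
      ∑' n, b n * Complex.exp (-(t * Real.log n * I)) := by
    intro t
    set z : ℂ := (3 / 2 : ℝ) + t * I with hz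
    have h1 := hser z (by simp [hz]; norm_num)
    have h2 : HasSum (fun n : ℕ => if n ∈ Finset.Icc 1 N then (a n : ℂ) * (n : ℂ) ^ (-z) else 0)
        (dirPoly a N z) := by
      have := hasSum_sum_of_ne_finset_zero (L := SummationFilter.unconditional ℕ) (s := Finset.Icc 1 N)
        (f := fun n : ℕ => if n ∈ Finset.Icc 1 N then (a n : ℂ) * (n : ℂ) ^ (-z) else 0)
        (fun n hn => by simp only [if_neg hn])
      rwa [Finset.sum_congr rfl (fun n hn => if_pos hn)] at this
    have h3 := h1.sub h2
    rw [← h3.tsum_eq]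
    refine tsum_congr fun n => ?_
    by_cases hn : N < n
    · rw [if_neg (by simp; omega), sub_zero]
      simp only [hb, if_pos hn]
      rw [hz, nat_cpow_neg_eq (by omega)]
      push_cast; ring
    · simp only [hb, if_neg hn]
      rcases Nat.eq_zero_or_pos n with h0 | h0
      · simp [h0, ha0]
      · rw [if_pos (by simp; omega)]; simp
  simp_rw [heq]
  refine (mul_le_mul_of_nonneg_left main (by positivity)).trans (le_of_eq ?_)
  have r1 : Y ^ (-2 : ℝ) = (Y ^ 2)⁻¹ := by rw [Real.rpow_neg hY0.le]; norm_num
  have r2 : Y ^ (-1 : ℝ) = Y⁻¹ := Real.rpow_neg_one Y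
  have r3 : (E * Y ^ (-(1 / 2) : ℝ) * V) ^ 2 = E ^ 2 * V ^ 2 * Y⁻¹ := by
    have : (Y ^ (-(1 / 2) : ℝ)) ^ 2 = Y⁻¹ := by
      rw [← Real.rpow_natCast, ← Real.rpow_mul hY0.le, ← r2]; norm_num
    rw [mul_pow, mul_pow, this]; ring
  rw [r1, r2, r3]
  field_simp
  ring

lemma norm_dirPoly_le {a : ℕ → ℝ} (ha : ∀ n, 0 ≤ a n) (han : ∀ n, a n ≤ n) (N : ℕ) {z : ℂ}
    (hz : -(1/2) ≤ z.re) : ‖dirPoly a N z‖ ≤ (N : ℝ) ^ 3 := by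
  unfold dirPoly
  refine (norm_sum_le _ _).trans ?_
  have : ∀ n ∈ Finset.Icc 1 N, ‖(a n : ℂ) * (n : ℂ) ^ (-z)‖ ≤ (N : ℝ) ^ 2 := by
    intro n hn
    have hn1 := (Finset.mem_Icc.mp hn).1
    have hn2 : (n : ℝ) ≤ N := by exact_mod_cast (Finset.mem_Icc.mp hn).2
    have hn3 : (1 : ℝ) ≤ n := by exact_mod_cast hn1
    rw [norm_mul, norm_nat_cpow_neg (by omega), Complex.norm_real, Real.norm_of_nonneg (ha n)]
    have h1 : (n : ℝ) ^ (-z.re) ≤ (n : ℝ) ^ (1 : ℝ) :=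
      Real.rpow_le_rpow_of_exponent_le hn3 (by linarith)
    rw [Real.rpow_one] at h1
    have := han n
    calc a n * (n : ℝ) ^ (-z.re) ≤ N * N := by
          have := ha n
          gcongr <;> linarith
      _ = _ := by ring
  refine (Finset.sum_le_card_nsmul _ _ _ this).trans (le_of_eq ?_)
  simp; ring

lemma exp_neg_sq_div_four_le {U : ℝ} (hU : 0 < U) :
    U ^ 12 * Real.exp (-(U / 2) ^ 2) ≤ 2949120 := by
  have h := Real.pow_div_factorial_le_exp ((U / 2) ^ 2) (by positivity) 6
  rw [Real.exp_neg]
  have hp := Real.exp_pos ((U / 2) ^ 2)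
  rw [mul_inv_le_iff₀ hp]
  have : ((U / 2) ^ 2) ^ 6 / (Nat.factorial 6 : ℝ) = U ^ 12 / 2949120 := by
    norm_num [Nat.factorial]; ring
  rw [this] at h
  linarith

lemma sq_norm_add_le (x y : ℂ) : ‖x + y‖ ^ 2 ≤ 2 * ‖x‖ ^ 2 + 2 * ‖y‖ ^ 2 := by
  have := norm_add_le x y
  nlinarith [sq_nonneg (‖x‖ - ‖y‖), norm_nonneg (x + y), norm_nonneg x, norm_nonneg y]

lemma norm_zeta_pow_sub_dirPoly_conj (a : ℕ → ℝ) (N k : ℕ) (x y : ℝ) :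
    ‖riemannZeta (x - y * I) ^ k - dirPoly a N (x - y * I)‖ =
      ‖riemannZeta (x + y * I) ^ k - dirPoly a N (x + y * I)‖ := by
  have e : (x - y * I : ℂ) = (starRingEnd ℂ) (x + y * I) := by simp; ring
  have : dirPoly a N ((starRingEnd ℂ) (x + y * I)) = (starRingEnd ℂ) (dirPoly a N (x + y * I)) := by
    unfold dirPoly
    rw [map_sum]
    refine Finset.sum_congr rfl fun n _ => ?_
    rw [map_mul, Complex.conj_ofReal, ← map_neg]
    rw [Complex.cpow_conj _ _ (by
      rw [← Complex.ofReal_natCast, Complex.arg_ofReal_of_nonneg (by positivity)]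
      exact Real.pi_ne_zero.symm)]
    simp
  rw [e, riemannZeta_conj, this, ← map_pow, ← map_sub, RCLike.norm_conj]

lemma pow_le_pow_four {x : ℝ} (hx : 1 ≤ x) {k : ℕ} (hk : k ≤ 2) : (x ^ k) ^ 2 ≤ x ^ 4 := by
  rw [← pow_mul]; exact pow_le_pow_right₀ hx (by omega)

lemma integral_norm_sq_le_of_lines {G : ℂ → ℂ} {U Y σ M E : ℝ} (hU : 9 ≤ U) (hY : 1 ≤ Y)
    (hE : 0 ≤ E) (hY1 : (Y ^ 2) ^ (-(1/2) - σ) ≤ E * Y⁻¹ ^ 2) (hY2 : (Y ^ 2) ^ (3/2 - σ) ≤ E * Y ^ 2)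
    (hσ1 : 1/4 ≤ σ) (hσ2 : σ ≤ 3/4) (hGd : ∀ z : ℂ, z.im ≠ 0 → DifferentiableAt ℂ G z)
    (hM : ∀ x y : ℝ, -(1/2) ≤ x → x ≤ 3/2 → U / 2 ≤ y → y ≤ 9 * U → ‖G (x + y * I)‖ ^ 2 ≤ M) :
    ∫ t in U..(8 * U), ‖G (σ + t * I)‖ ^ 2 ≤ Real.exp 7 * (
      4 * E * (Y⁻¹ ^ 2 * ∫ y in (U - U / 2)..(8 * U + U / 2), ‖G ((-(1/2) : ℝ) + y * I)‖ ^ 2) +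
      4 * E * (Y ^ 2 * ∫ y in (U - U / 2)..(8 * U + U / 2), ‖G ((3/2 : ℝ) + y * I)‖ ^ 2) +
      7 * U * (5 * M * (E * Y⁻¹ ^ 2 + E * Y ^ 2) * Real.exp (-(U / 2) ^ 2))) := by
  have hY0 : 0 < Y := by linarith
  have hM0 : 0 ≤ M := (sq_nonneg _).trans (hM 0 U (by norm_num) (by norm_num) (by linarith) (by linarith))
  have hA : 0 < U - U / 2 := by linarith
  have hcont : ∀ (x : ℝ) (A B : ℝ), 0 < A →
      ContinuousOn (fun y : ℝ => ‖G (x + y * I)‖ ^ 2) (Icc A B) := by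
    intro x A B hA y hy
    refine ContinuousAt.continuousWithinAt (ContinuousAt.pow (ContinuousAt.norm ?_) 2)
    exact ContinuousAt.comp (g := G) (f := fun y : ℝ => (x + y * I : ℂ))
      (hGd _ (by simp; linarith [hy.1])).continuousAt (by fun_prop)
  set k : ℝ → ℝ := fun v => Real.exp (-v ^ 2) with hk
  have hkc : Continuous k := Real.continuous_exp.comp ((continuous_id.pow 2).neg)
  have hk0 : ∀ v, 0 ≤ k v := fun v => (Real.exp_pos _).le
  have hkH := intervalIntegral_exp_neg_sq_le (U / 2) (by linarith)
  have h8 : U ≤ 8 * U := by linarith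
  have cl := integral_conv_le (h := fun y : ℝ => ‖G ((-(1/2) : ℝ) + y * I)‖ ^ 2) h8
    (by linarith : 0 ≤ U / 2) (hcont _ _ _ hA) (fun y => sq_nonneg _) hkc hk0 hkH
  have cr := integral_conv_le (h := fun y : ℝ => ‖G ((3/2 : ℝ) + y * I)‖ ^ 2) h8
    (by linarith : 0 ≤ U / 2) (hcont _ _ _ hA) (fun y => sq_nonneg _) hkc hk0 hkH
  set fl : ℝ → ℝ := fun t => ∫ y in (t - U / 2)..(t + U / 2), ‖G ((-(1/2) : ℝ) + y * I)‖ ^ 2 * k (y - t) with hfl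
  set fr : ℝ → ℝ := fun t => ∫ y in (t - U / 2)..(t + U / 2), ‖G ((3/2 : ℝ) + y * I)‖ ^ 2 * k (y - t) with hfr
  set s := 5 * M * (E * Y⁻¹ ^ 2 + E * Y ^ 2) * Real.exp (-(U / 2) ^ 2) with hs
  have hpt : ∀ t ∈ Icc U (8 * U), ‖G (σ + t * I)‖ ^ 2 ≤
      Real.exp 7 * (2 * E * Y⁻¹ ^ 2 * fl t + 2 * E * Y ^ 2 * fr t + s) := by
    intro t ht
    have htU : t - U / 2 ≤ t + U / 2 := by linarith
    have hy0 : ∀ y ∈ Icc (t - U / 2) (t + U / 2), 0 < y := fun y hy => by linarith [hy.1, ht.1]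
    have key := norm_le_of_gaussian_cauchy (G := fun z => G z ^ 2) (a := -(1/2)) (b := 3/2) (σ := σ)
      (t := t) (H := U / 2) (Y := Y ^ 2) (M := M) (by positivity) (by linarith) (by linarith)
      (by norm_num) (by linarith)
      (fun z _ _ h3 _ => (hGd z (by linarith [ht.1])).pow 2)
      (fun x h1 h2 => by
        rw [norm_pow]; exact hM x _ h1 h2 (by linarith [ht.1]) (by linarith [ht.2]))
      (fun x h1 h2 => by
        rw [norm_pow]; exact hM x _ h1 h2 (by linarith [ht.1]) (by linarith [ht.2]))
    simp only [norm_pow] at key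
    refine key.trans ?_
    have hek : Continuous fun y : ℝ => Real.exp (-(y - t) ^ 2) :=
      Real.continuous_exp.comp (((continuous_id.sub continuous_const).pow 2).neg)
    have hcl : ∀ x : ℝ, ContinuousOn (fun y : ℝ => ‖G (x + y * I)‖ ^ 2 * Real.exp (-(y - t) ^ 2))
        (Icc (t - U / 2) (t + U / 2)) := fun x =>
      (hcont x _ _ (by linarith [ht.1])).mul hek.continuousOn
    have h1 : (∫ y in (t - U / 2)..(t + U / 2), ‖G ((-(1/2) : ℝ) + y * I)‖ ^ 2 * Real.exp (-(y - t) ^ 2) /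
        ‖(((-(1/2) : ℝ) : ℂ) + y * I) - (σ + t * I)‖) ≤ 2 * fl t := by
      rw [hfl, ← intervalIntegral.integral_const_mul]
      have hnn : ∀ y : ℝ, 1 / 2 ≤ ‖(((-(1/2) : ℝ) : ℂ) + y * I) - (σ + t * I)‖ := by
        intro y
        have := Complex.abs_re_le_norm ((((-(1/2) : ℝ) : ℂ) + y * I) - (σ + t * I))
        refine le_trans ?_ this
        simp only [sub_re, add_re, ofReal_re, mul_re, I_re, mul_zero, ofReal_im, I_im, mul_one, sub_self, add_zero]
        rw [abs_of_nonpos (by linarith)]; linarith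
      refine intervalIntegral.integral_mono_on htU ?_ ?_ fun y hy => ?_
      · refine ContinuousOn.intervalIntegrable ?_
        rw [uIcc_of_le htU]
        have hnc : Continuous fun y : ℝ => ‖(((-(1/2) : ℝ) : ℂ) + y * I) - (σ + t * I)‖ :=
          ((continuous_const.add (continuous_ofReal.mul continuous_const)).sub continuous_const).norm
        refine (hcl _).div hnc.continuousOn fun y _ => ?_
        have := hnn y; linarith
      · refine ContinuousOn.intervalIntegrable ?_
        rw [uIcc_of_le htU]
        exact (hcl _).const_mul 2
      · have h3 := hnn y
        rw [div_le_iff₀ (by linarith)]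
        have : 0 ≤ ‖G ((-(1/2) : ℝ) + y * I)‖ ^ 2 * Real.exp (-(y - t) ^ 2) := by positivity
        simp only [hk]
        have := mul_le_mul_of_nonneg_left h3 this
        linarith
    have h2 : (Y ^ 2) ^ (3/2 - σ) / (3/2 - σ) ≤ 2 * E * Y ^ 2 := by
      rw [div_le_iff₀ (by linarith)]
      have : 0 ≤ E * Y ^ 2 := by positivity
      have := mul_le_mul_of_nonneg_left (by linarith : 3 / 4 ≤ 3 / 2 - σ) this
      linarith
    have hfl0 : 0 ≤ fl t := intervalIntegral.integral_nonneg htU fun y _ => by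
      simp only [hk]; positivity
    have hfr0 : 0 ≤ fr t := intervalIntegral.integral_nonneg htU fun y _ => by
      simp only [hk]; positivity
    refine mul_le_mul_of_nonneg_left (add_le_add (add_le_add ?_ ?_) ?_) (Real.exp_pos 7).le
    · calc _ ≤ E * Y⁻¹ ^ 2 * (2 * fl t) := by
            refine mul_le_mul hY1 h1 ?_ (by positivity)
            exact intervalIntegral.integral_nonneg htU fun y _ => by positivity
        _ = _ := by ring
    · refine mul_le_mul h2 le_rfl hfr0 (by positivity)
    · rw [hs]; gcongr
  have iG : IntervalIntegrable (fun t : ℝ => ‖G (σ + t * I)‖ ^ 2) volume U (8 * U) := by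
    refine ContinuousOn.intervalIntegrable ?_
    rw [uIcc_of_le h8]; exact hcont _ _ _ (by linarith)
  have il : IntervalIntegrable fl volume U (8 * U) := by
    refine ContinuousOn.intervalIntegrable ?_
    rw [uIcc_of_le h8]; exact cl.1
  have ir : IntervalIntegrable fr volume U (8 * U) := by
    refine ContinuousOn.intervalIntegrable ?_
    rw [uIcc_of_le h8]; exact cr.1
  have i1 := il.const_mul (2 * E * Y⁻¹ ^ 2)
  have i2 := ir.const_mul (2 * E * Y ^ 2)
  have := intervalIntegral.integral_mono_on h8 iG (((i1.add i2).add
    (intervalIntegrable_const (c := s))).const_mul (Real.exp 7)) hpt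
  rw [intervalIntegral.integral_const_mul, intervalIntegral.integral_add (i1.add i2) intervalIntegrable_const,
    intervalIntegral.integral_add i1 i2, intervalIntegral.integral_const_mul, intervalIntegral.integral_const_mul,
    intervalIntegral.integral_const, smul_eq_mul] at this
  refine this.trans ?_
  have c1 := mul_le_mul_of_nonneg_left cl.2 (by positivity : 0 ≤ 2 * E * Y⁻¹ ^ 2)
  have c2 := mul_le_mul_of_nonneg_left cr.2 (by positivity : 0 ≤ 2 * E * Y ^ 2)
  refine mul_le_mul_of_nonneg_left (add_le_add (add_le_add ?_ ?_) ?_) (Real.exp_pos 7).le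
  · exact c1.trans_eq (by ring)
  · exact c2.trans_eq (by ring)
  · linarith

set_option maxHeartbeats 1000000 in
lemma exists_moment_le {a : ℕ → ℝ} {k : ℕ} (hk2 : k ≤ 2) (ha0 : a 0 = 0)
    (ha : ∀ n, 0 ≤ a n) (ha2 : ∀ n, a n ≤ a n ^ 2) (han : ∀ n, a n ≤ n)
    (hser : ∀ z : ℂ, 1 < z.re → HasSum (fun n : ℕ => (a n : ℂ) * (n : ℂ) ^ (-z)) (riemannZeta z ^ k)) :
    ∃ C : ℝ, 0 < C ∧ ∀ U V σ : ℝ, Real.exp 8 ≤ U →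
      (∀ N, ∑ n ∈ Finset.Icc 1 N, a n ^ 2 * (n : ℝ) ^ (-1 - 1 / Real.log U) ≤ V) → 1 ≤ V →
      |σ - 1 / 2| ≤ 2 / Real.log U →
      ∫ t in U..(8 * U), ‖riemannZeta (σ + t * I)‖ ^ (2 * k) ≤
        C * (U * V + Real.sqrt (U ^ k) * Real.log U * V ^ 2) := by
  obtain ⟨Cx, hCx1, hCx⟩ := exists_norm_chi_le
  obtain ⟨Cz, hCz1, hCz⟩ := exists_norm_riemannZeta_le
  set e := Real.exp 1 with he
  have he1 : 1 ≤ e := Real.one_le_exp (by norm_num)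
  -- constants
  set c₁ : ℝ := (9 * Cx) ^ 4 with hc₁
  set C₀ : ℝ := 2 * (c₁ * (40 * e ^ 2) + 16 * e) with hC₀
  set C₁ : ℝ := ((81 * Cz) ^ 2 + 1 + (9 * Cx) ^ 2) with hC₁
  set C₂ : ℝ := 5 * C₁ ^ 2 * (2 * e ^ 4) * 2949120 with hC₂
  set C₃ : ℝ := Real.exp 7 * (8 * e ^ 4 * C₀ + 7 * C₂) with hC₃
  set C₄ : ℝ := 3 * (C₃ + 16 * e ^ 5 + (Cx * e ^ 4) ^ 4 * (16 * e ^ 5)) with hC₄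
  have he0 : 0 < e := by linarith
  have hc₁0 : 0 < c₁ := by positivity
  have hC₀0 : 0 < C₀ := by positivity
  have hC₁0 : 0 < C₁ := by positivity
  have hC₂0 : 0 < C₂ := by positivity
  have hC₃0 : 0 < C₃ := by positivity
  refine ⟨C₄, by positivity, ?_⟩
  clear_value C₄ C₃ C₂ C₁ C₀ c₁ e
  intro U V σ hU hV hV1 hσ
  have hU0 : 0 < U := lt_of_lt_of_le (Real.exp_pos _) hU
  set L := Real.log U with hL
  have hL8 : 8 ≤ L := by rw [hL, Real.le_log_iff_exp_le hU0]; exact hU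
  have hU8 : 9 ≤ U := by linarith [Real.add_one_le_exp (8 : ℝ)]
  have hL0 : 0 < L := by linarith
  set κ := 1 / L with hκd
  have hκ : 0 < κ := by positivity
  have hκ8 : κ ≤ 1 / 8 := by rw [hκd]; exact one_div_le_one_div_of_le (by norm_num) hL8
  have hσ' : |σ - 1 / 2| ≤ 2 * κ := by rw [hκd]; rwa [mul_one_div]
  obtain ⟨hσ1, hσ2⟩ := abs_le.mp hσ'
  have hUe : ∀ m : ℕ, U ^ (m * κ) = e ^ m := by
    intro m
    rw [Real.rpow_def_of_pos hU0, ← hL, he, ← Real.exp_nat_mul]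
    congr 1; rw [hκd]; field_simp
  set Y := Real.sqrt (U ^ k) with hYd
  have hUk : 1 ≤ U ^ k := one_le_pow₀ (by linarith)
  have hY1 : 1 ≤ Y := by rw [hYd]; exact Real.one_le_sqrt.mpr hUk
  have hY0 : 0 < Y := by linarith
  have hYU : Y ≤ U := by
    rw [hYd, Real.sqrt_le_left hU0.le]
    exact pow_le_pow_right₀ (by linarith) hk2
  have hY2 : Y ^ 2 = U ^ k := by rw [hYd, Real.sq_sqrt (by positivity)]
  have hYκ : Y ^ κ ≤ e := by
    have := hUe 1
    simp only [Nat.cast_one, one_mul, pow_one] at this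
    rw [← this]; exact Real.rpow_le_rpow hY0.le hYU hκ.le
  set N := ⌊Y⌋₊ with hN
  have hNY : (N : ℝ) ≤ Y := Nat.floor_le hY0.le
  have hN1 : 1 ≤ N := Nat.le_floor (by simpa using hY1)
  have hN1' : (1 : ℝ) ≤ N := by exact_mod_cast hN1
  have hlogN : Real.log N ≤ L := by
    rw [hL]; exact Real.log_le_log (by linarith) (by linarith)
  set Q := U * V + Y * L * V ^ 2 with hQ
  have hYL0 : 0 < Y * L := by positivity
  have hQ0 : 0 < Q := by positivity
  have hQ1 : U * V ≤ Q := le_add_of_nonneg_right (by positivity)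
  have hQ2 : Y * L * V ^ 2 ≤ Q := le_add_of_nonneg_left (by positivity)
  have hQU : U ≤ Q := (le_mul_of_one_le_right hU0.le hV1).trans hQ1
  have hV12 : V ≤ V ^ 2 := le_self_pow₀ hV1 two_ne_zero
  have hQ3 : (U + Y * L) * V ≤ Q := by
    rw [hQ, add_mul]
    have := mul_le_mul_of_nonneg_left hV12 hYL0.le
    linarith
  have hQ4 : Y * V ^ 2 ≤ Q := by
    refine le_trans ?_ hQ2
    exact mul_le_mul_of_nonneg_right (le_mul_of_one_le_right hY0.le (by linarith)) (by positivity)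
  clear_value Q
  clear_value Y
  clear_value κ
  clear_value L
  set D := dirPoly a N with hD
  -- mean values of `D`
  have hDint : ∀ (x E A B : ℝ), 0 ≤ E → A ≤ B → B - A ≤ 8 * U →
      (∀ n ∈ Finset.Icc 1 N, (n : ℝ) ^ (1 + κ - 2 * x) ≤ E) →
      ∫ t in A..B, ‖D (x + t * I)‖ ^ 2 ≤ 16 * E * Q := by
    intro x E A B hE hAB hBA hn
    refine (integral_norm_sq_dirPoly_le a N x hAB).trans ?_
    have h1 := sum_sq_rpow_le (hV N) hE hn
    have h2 : B - A + 8 * N * (1 + Real.log N) ≤ 16 * (U + Y * L) := by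
      have h3 : N * (1 + Real.log N) ≤ Y * (2 * L) := by
        have := Real.log_natCast_nonneg N
        gcongr; linarith
      rw [mul_assoc]
      linarith
    have h4 : 0 ≤ ∑ n ∈ Finset.Icc 1 N, a n ^ 2 * (n : ℝ) ^ (-(2 * x)) :=
      Finset.sum_nonneg fun _ _ => by positivity
    calc _ ≤ 16 * (U + Y * L) * (E * V) := by gcongr
      _ = 16 * E * ((U + Y * L) * V) := by ring
      _ ≤ _ := by gcongr
  have hnN : ∀ n ∈ Finset.Icc 1 N, (1 : ℝ) ≤ n ∧ (n : ℝ) ≤ Y := by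
    intro n hn
    rw [Finset.mem_Icc] at hn
    exact ⟨by exact_mod_cast hn.1, le_trans (by exact_mod_cast hn.2) hNY⟩
  have hDσ : ∀ x A B : ℝ, 1 / 2 - 2 * κ ≤ x → A ≤ B → B - A ≤ 8 * U →
      ∫ t in A..B, ‖D (x + t * I)‖ ^ 2 ≤ 16 * e ^ 5 * Q := by
    intro x A B hx h1 h2
    refine hDint x (e ^ 5) A B (by positivity) h1 h2 fun n hn => ?_
    obtain ⟨hn1, hn2⟩ := hnN n hn
    rw [← hUe 5]
    calc (n : ℝ) ^ (1 + κ - 2 * x) ≤ (n : ℝ) ^ (((5 : ℕ) : ℝ) * κ) :=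
          Real.rpow_le_rpow_of_exponent_le hn1 (by push_cast; linarith)
      _ ≤ U ^ (((5 : ℕ) : ℝ) * κ) := Real.rpow_le_rpow (by linarith) (by linarith) (by positivity)
  have hDh : ∀ A B : ℝ, A ≤ B → B - A ≤ 8 * U →
      ∫ t in A..B, ‖D ((-(1/2) : ℝ) + t * I)‖ ^ 2 ≤ 16 * (e * Y ^ 2) * Q := by
    intro A B h1 h2
    refine hDint _ (e * Y ^ 2) A B (by positivity) h1 h2 fun n hn => ?_
    obtain ⟨hn1, hn2⟩ := hnN n hn
    calc (n : ℝ) ^ (1 + κ - 2 * (-(1/2) : ℝ)) ≤ Y ^ (κ + 2) := by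
          rw [show 1 + κ - 2 * (-(1/2) : ℝ) = κ + 2 by ring]
          exact Real.rpow_le_rpow (by linarith) hn2 (by positivity)
      _ = Y ^ κ * Y ^ 2 := by rw [Real.rpow_add hY0]; norm_num
      _ ≤ _ := by gcongr
  -- the tail
  set Rf : ℝ → ℝ := fun t => ‖riemannZeta ((3 / 2 : ℝ) + t * I) ^ k - D ((3 / 2 : ℝ) + t * I)‖ ^ 2
    with hRf
  have hR : ∀ A B : ℝ, A ≤ B → B - A ≤ 8 * U → Y ^ 2 * ∫ t in A..B, Rf t ≤ 40 * e ^ 2 * Q := by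
    intro A B h1 h2
    refine (integral_norm_sq_tail_le ha0 ha ha2 hser hκ (by linarith) hY1 hYκ hV h1).trans ?_
    have e8 : 8 / κ = 8 * L := by rw [hκd]; field_simp
    rw [e8]
    have i1 : (B - A) * e * V ≤ 8 * e ^ 2 * Q := by
      calc (B - A) * e * V ≤ (8 * U) * e ^ 2 * V := by
            have : e ≤ e ^ 2 := le_self_pow₀ he1 two_ne_zero
            gcongr
        _ = 8 * e ^ 2 * (U * V) := by ring
        _ ≤ _ := by gcongr
    have i2 : 4 * e ^ 2 * Y * V ^ 2 ≤ 4 * e ^ 2 * Q := by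
      calc _ = 4 * e ^ 2 * (Y * V ^ 2) := by ring
        _ ≤ _ := by gcongr
    have i3 : 8 * L * e ^ 2 * Y * V ≤ 8 * e ^ 2 * Q := by
      calc _ = 8 * e ^ 2 * (Y * L * V) := by ring
        _ ≤ 8 * e ^ 2 * (Y * L * V ^ 2) := by gcongr
        _ ≤ _ := by gcongr
    have : 0 ≤ e ^ 2 * Q := by positivity
    linarith
  set G : ℂ → ℂ := fun z => riemannZeta z ^ k - D z - chi z ^ k * D (1 - z) with hG
  have hGd : ∀ z : ℂ, z.im ≠ 0 → DifferentiableAt ℂ G z := by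
    intro z hz
    have h1 : DifferentiableAt ℂ riemannZeta z := differentiableAt_riemannZeta (by
      rintro rfl; simp at hz)
    have h2 := differentiableAt_chi hz
    have h3 : Differentiable ℂ D := differentiable_dirPoly a N
    have h4 : DifferentiableAt ℂ (fun z => D (1 - z)) z :=
      (h3 (1 - z)).comp z (by fun_prop : DifferentiableAt ℂ (fun z : ℂ => 1 - z) z)
    exact ((h1.pow k).sub (h3 z)).sub ((h2.pow k).mul h4)
  have hcont : ∀ (F : ℂ → ℂ), (∀ z : ℂ, z.im ≠ 0 → DifferentiableAt ℂ F z) → ∀ (x : ℝ) (A B : ℝ), 0 < A →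
      ContinuousOn (fun y : ℝ => ‖F (x + y * I)‖ ^ 2) (Icc A B) := by
    intro F hF x A B hA y hy
    refine ContinuousAt.continuousWithinAt (ContinuousAt.pow (ContinuousAt.norm ?_) 2)
    exact ContinuousAt.comp (g := F) (f := fun y : ℝ => (x + y * I : ℂ))
      (hF _ (by simp; linarith [hy.1])).continuousAt (by fun_prop)
  have hUk2 : (U ^ k) ^ 2 = Y ^ 4 := by rw [← hY2]; ring
  have hcontD : ∀ x A B : ℝ, IntervalIntegrable (fun y : ℝ => ‖D (x + y * I)‖ ^ 2) volume A B := by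
    intro x A B
    have h3 : Continuous D := (differentiable_dirPoly a N).continuous
    exact ((h3.comp (continuous_const.add (continuous_ofReal.mul continuous_const))).norm.pow
      2).intervalIntegrable _ _
  have hA : 0 < U - U / 2 := by linarith
  have hAB : U - U / 2 ≤ 8 * U + U / 2 := by linarith
  have hBA : 8 * U + U / 2 - (U - U / 2) ≤ 8 * U := by linarith
  have hRint : IntervalIntegrable Rf volume (U - U / 2) (8 * U + U / 2) := by
    refine ContinuousOn.intervalIntegrable ?_
    rw [uIcc_of_le hAB]
    refine hcont (fun z => riemannZeta z ^ k - D z) (fun z hz => ?_) (3 / 2) _ _ hA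
    exact ((differentiableAt_riemannZeta (by rintro rfl; simp at hz)).pow k).sub
      (differentiable_dirPoly a N z)
  have hDconj : ∀ x y : ℝ, ‖D (x - y * I)‖ = ‖D (x + y * I)‖ := by
    intro x y
    rw [← norm_dirPoly_conj a N (x + y * I)]; congr 2; simp; ring
  have hGint : ∀ x : ℝ, IntervalIntegrable (fun y : ℝ => ‖G (x + y * I)‖ ^ 2) volume (U - U / 2) (8 * U + U / 2) := by
    intro x
    refine ContinuousOn.intervalIntegrable ?_
    rw [uIcc_of_le hAB]
    exact hcont G hGd x _ _ hA
  -- the left line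
  have hleft : Y⁻¹ ^ 2 * ∫ y in (U - U / 2)..(8 * U + U / 2), ‖G ((-(1/2) : ℝ) + y * I)‖ ^ 2 ≤ C₀ * Q := by
    have hpt : ∀ y ∈ Icc (U - U / 2) (8 * U + U / 2), ‖G ((-(1/2) : ℝ) + y * I)‖ ^ 2 ≤
        2 * c₁ * Y ^ 4 * Rf y + 2 * ‖D ((-(1/2) : ℝ) + y * I)‖ ^ 2 := by
      intro y hy
      have hy0 : 0 < y := lt_of_lt_of_le hA hy.1
      set z : ℂ := (-(1/2) : ℝ) + y * I with hz
      have hzim : z.im ≠ 0 := by simp [hz]; exact hy0.ne'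
      have e1 : 1 - z = (3 / 2 : ℝ) - y * I := by rw [hz]; push_cast; ring
      have e2 : G z = chi z ^ k * (riemannZeta (1 - z) ^ k - D (1 - z)) + -D z := by
        simp only [hG]; rw [riemannZeta_eq_chi_mul hzim]; ring
      rw [e2]
      refine (sq_norm_add_le _ _).trans ?_
      rw [norm_neg, norm_mul, norm_pow, e1, hD, norm_zeta_pow_sub_dirPoly_conj, ← hD, mul_pow]
      have hch : ‖chi z‖ ≤ 9 * Cx * U := by
        refine (hCx (-(1/2)) y (by norm_num) (by norm_num) (by rw [abs_of_pos hy0]; linarith [hy.1])).trans ?_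
        rw [abs_of_pos hy0]
        norm_num
        have : y ≤ 9 * U := by linarith [hy.2]
        calc Cx * y ≤ Cx * (9 * U) := by gcongr
          _ = _ := by ring
      have hch2 : (‖chi z‖ ^ k) ^ 2 ≤ c₁ * Y ^ 4 := by
        calc (‖chi z‖ ^ k) ^ 2 ≤ ((9 * Cx * U) ^ k) ^ 2 := by gcongr
          _ = ((9 * Cx) ^ k) ^ 2 * (U ^ k) ^ 2 := by rw [mul_pow, mul_pow]
          _ ≤ _ := by rw [hUk2, hc₁]; gcongr; exact pow_le_pow_four (by linarith) hk2
      have hR0 : 0 ≤ Rf y := by simp only [hRf]; positivity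
      have := mul_le_mul_of_nonneg_right hch2 hR0
      simp only [hRf] at this ⊢
      linarith
    have h1 := intervalIntegral.integral_mono_on hAB (hGint (-(1/2))) 
      ((hRint.const_mul (2 * c₁ * Y ^ 4)).add ((hcontD (-(1/2)) _ _).const_mul 2)) hpt
    rw [intervalIntegral.integral_add (hRint.const_mul _) ((hcontD _ _ _).const_mul 2),
      intervalIntegral.integral_const_mul, intervalIntegral.integral_const_mul] at h1
    have h2 := hDh _ _ hAB hBA
    have h3 := hR _ _ hAB hBA
    have hY00 : 0 < Y⁻¹ ^ 2 := by positivity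
    have hc0 : 0 < c₁ := by positivity
    calc _ ≤ Y⁻¹ ^ 2 * (2 * c₁ * Y ^ 4 * (∫ t in (U - U / 2)..(8 * U + U / 2), Rf t) + 2 * (16 * (e * Y ^ 2) * Q)) := by
          gcongr; linarith
      _ = 2 * c₁ * (Y ^ 2 * (∫ t in (U - U / 2)..(8 * U + U / 2), Rf t)) + 2 * (16 * e * Q) := by
          field_simp
      _ ≤ 2 * c₁ * (40 * e ^ 2 * Q) + 2 * (16 * e * Q) := by gcongr
      _ = _ := by rw [hC₀]; ring
  have hright : Y ^ 2 * ∫ y in (U - U / 2)..(8 * U + U / 2), ‖G ((3/2 : ℝ) + y * I)‖ ^ 2 ≤ (2 * (40 * e ^ 2 + c₁ * (16 * e))) * Q := by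
    have hpt : ∀ y ∈ Icc (U - U / 2) (8 * U + U / 2), ‖G ((3/2 : ℝ) + y * I)‖ ^ 2 ≤
        2 * Rf y + 2 * c₁ * Y⁻¹ ^ 4 * ‖D ((-(1/2) : ℝ) + y * I)‖ ^ 2 := by
      intro y hy
      have hy0 : 0 < y := lt_of_lt_of_le hA hy.1
      set z : ℂ := (3/2 : ℝ) + y * I with hz
      have e1 : 1 - z = (-(1 / 2) : ℝ) - y * I := by rw [hz]; push_cast; ring
      have e2 : G z = (riemannZeta z ^ k - D z) + -(chi z ^ k * D (1 - z)) := by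
        simp only [hG]; ring
      rw [e2]
      refine (sq_norm_add_le _ _).trans ?_
      rw [norm_neg, norm_mul, norm_pow, e1, hDconj, mul_pow]
      have hch : ‖chi z‖ ≤ 9 * Cx * U⁻¹ := by
        refine (hCx (3/2) y (by norm_num) (by norm_num) (by rw [abs_of_pos hy0]; linarith [hy.1])).trans ?_
        rw [abs_of_pos hy0, show (1 / 2 - 3 / 2 : ℝ) = -1 by norm_num, Real.rpow_neg_one]
        have : y⁻¹ ≤ 9 * U⁻¹ := by
          rw [inv_le_comm₀ hy0 (by positivity), mul_inv, inv_inv]; linarith [hy.1]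
        calc Cx * y⁻¹ ≤ Cx * (9 * U⁻¹) := by gcongr
          _ = _ := by ring
      have hch2 : (‖chi z‖ ^ k) ^ 2 ≤ c₁ * Y⁻¹ ^ 4 := by
        calc (‖chi z‖ ^ k) ^ 2 ≤ ((9 * Cx * U⁻¹) ^ k) ^ 2 := by gcongr
          _ = ((9 * Cx) ^ k) ^ 2 * ((U ^ k) ^ 2)⁻¹ := by rw [mul_pow, mul_pow, inv_pow, inv_pow]
          _ ≤ _ := by rw [hUk2, hc₁, inv_pow]; gcongr; exact pow_le_pow_four (by linarith) hk2
      have := mul_le_mul_of_nonneg_right hch2 (by positivity : 0 ≤ ‖D ((-(1/2) : ℝ) + y * I)‖ ^ 2)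
      simp only [hRf] at this ⊢
      linarith
    have h1 := intervalIntegral.integral_mono_on hAB (hGint (3/2)) 
      ((hRint.const_mul 2).add ((hcontD (-(1/2)) _ _).const_mul (2 * c₁ * Y⁻¹ ^ 4))) hpt
    rw [intervalIntegral.integral_add (hRint.const_mul _) ((hcontD _ _ _).const_mul _),
      intervalIntegral.integral_const_mul, intervalIntegral.integral_const_mul] at h1
    have h2 := hDh _ _ hAB hBA
    have h3 := hR _ _ hAB hBA
    have hc0 : 0 < c₁ := by positivity
    calc _ ≤ Y ^ 2 * (2 * (∫ t in (U - U / 2)..(8 * U + U / 2), Rf t) + 2 * c₁ * Y⁻¹ ^ 4 * (16 * (e * Y ^ 2) * Q)) := by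
          gcongr
          refine h1.trans ?_
          gcongr
      _ = 2 * (Y ^ 2 * (∫ t in (U - U / 2)..(8 * U + U / 2), Rf t)) + 2 * c₁ * (16 * e * Q) := by
          field_simp
      _ ≤ 2 * (40 * e ^ 2 * Q) + 2 * c₁ * (16 * e * Q) := by gcongr
      _ = _ := by ring
  have hσ14 : 1 / 4 ≤ σ := by linarith
  have hσ34 : σ ≤ 3 / 4 := by linarith
  have hYx : ∀ x : ℝ, |x| ≤ 2 * κ → (Y ^ 2) ^ x ≤ e ^ 4 := by
    intro x hx
    have hY21 : 1 ≤ Y ^ 2 := one_le_pow₀ hY1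
    calc (Y ^ 2) ^ x ≤ (Y ^ 2) ^ (2 * κ) :=
          Real.rpow_le_rpow_of_exponent_le hY21 ((le_abs_self x).trans hx)
      _ = Y ^ (((4 : ℕ) : ℝ) * κ) := by
          rw [← Real.rpow_natCast Y 2, ← Real.rpow_mul hY0.le]; congr 1; push_cast; ring
      _ ≤ U ^ (((4 : ℕ) : ℝ) * κ) := Real.rpow_le_rpow hY0.le hYU (by positivity)
      _ = e ^ 4 := hUe 4
  have hY1' : (Y ^ 2) ^ (-(1/2) - σ) ≤ e ^ 4 * Y⁻¹ ^ 2 := by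
    rw [show -(1/2) - σ = (1/2 - σ) + -1 by ring, Real.rpow_add (by positivity), Real.rpow_neg_one,
      inv_pow]
    gcongr
    exact hYx _ (by rwa [abs_sub_comm])
  have hY2' : (Y ^ 2) ^ (3/2 - σ) ≤ e ^ 4 * Y ^ 2 := by
    rw [show 3/2 - σ = (1/2 - σ) + 1 by ring, Real.rpow_add (by positivity), Real.rpow_one]
    gcongr
    exact hYx _ (by rwa [abs_sub_comm])
  have hNU : (N : ℝ) ≤ U := hNY.trans hYU
  have hU1 : 1 ≤ U := by linarith
  have hM : ∀ x y : ℝ, -(1/2) ≤ x → x ≤ 3/2 → U / 2 ≤ y → y ≤ 9 * U →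
      ‖G (x + y * I)‖ ^ 2 ≤ C₁ ^ 2 * U ^ 10 := by
    intro x y hx1 hx2 hy1 hy2
    have hy0 : 1 ≤ y := by linarith
    have habs : |y| = y := abs_of_pos (by linarith)
    have b1 : ‖riemannZeta (x + y * I)‖ ≤ 81 * Cz * U ^ 2 := by
      refine (hCz x y hx1 (by linarith) (by rwa [habs])).trans ?_
      rw [habs]
      calc Cz * y ^ 2 ≤ Cz * (9 * U) ^ 2 := by gcongr
        _ = _ := by ring
    have b2 : ‖chi (x + y * I)‖ ≤ 9 * Cx * U := by
      refine (hCx x y hx1 hx2 (by rwa [habs])).trans ?_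
      rw [habs]
      calc Cx * y ^ (1/2 - x) ≤ Cx * y ^ (1 : ℝ) := by
            gcongr
            linarith
        _ ≤ Cx * (9 * U) := by rw [Real.rpow_one]; gcongr
        _ = _ := by ring
    have b3 : ‖D (x + y * I)‖ ≤ U ^ 3 :=
      (norm_dirPoly_le ha han N (by simpa using hx1)).trans (by gcongr)
    have b4 : ‖D (1 - (x + y * I))‖ ≤ U ^ 3 :=
      (norm_dirPoly_le ha han N (by simp; linarith)).trans (by gcongr)
    have o1 : 1 ≤ 81 * Cz * U ^ 2 := by
      have : 1 ≤ U ^ 2 := one_le_pow₀ hU1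
      calc (1 : ℝ) ≤ 81 * 1 * 1 := by norm_num
        _ ≤ _ := by gcongr
    have o2 : 1 ≤ 9 * Cx * U := by
      calc (1 : ℝ) ≤ 9 * 1 * 1 := by norm_num
        _ ≤ _ := by gcongr
    have p1 : ‖riemannZeta (x + y * I)‖ ^ k ≤ (81 * Cz * U ^ 2) ^ 2 :=
      (pow_le_pow_left₀ (norm_nonneg _) b1 k).trans (pow_le_pow_right₀ o1 hk2)
    have p2 : ‖chi (x + y * I)‖ ^ k ≤ (9 * Cx * U) ^ 2 :=
      (pow_le_pow_left₀ (norm_nonneg _) b2 k).trans (pow_le_pow_right₀ o2 hk2)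
    have b5 : ‖G (x + y * I)‖ ≤ C₁ * U ^ 5 := by
      simp only [hG]
      refine (norm_sub_le _ _).trans ((add_le_add_left (norm_sub_le _ _) _).trans ?_)
      rw [norm_mul, norm_pow, norm_pow]
      have q1 : U ^ 4 ≤ U ^ 5 := pow_le_pow_right₀ hU1 (by norm_num)
      have q2 : U ^ 3 ≤ U ^ 5 := pow_le_pow_right₀ hU1 (by norm_num)
      calc _ ≤ (81 * Cz * U ^ 2) ^ 2 + U ^ 3 + (9 * Cx * U) ^ 2 * U ^ 3 := by gcongr
        _ = (81 * Cz) ^ 2 * U ^ 4 + U ^ 3 + (9 * Cx) ^ 2 * U ^ 5 := by ring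
        _ ≤ (81 * Cz) ^ 2 * U ^ 5 + U ^ 5 + (9 * Cx) ^ 2 * U ^ 5 := by gcongr
        _ = _ := by rw [hC₁]; ring
    calc ‖G (x + y * I)‖ ^ 2 ≤ (C₁ * U ^ 5) ^ 2 := by gcongr
      _ = _ := by ring
  have hGσ := integral_norm_sq_le_of_lines hU8 hY1 (by positivity) hY1' hY2' hσ14 hσ34 hGd hM
  have hsmall : 5 * (C₁ ^ 2 * U ^ 10) * (e ^ 4 * Y⁻¹ ^ 2 + e ^ 4 * Y ^ 2) * Real.exp (-(U / 2) ^ 2) ≤ C₂ := by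
    have q1 : Y⁻¹ ^ 2 ≤ U ^ 2 := by
      have : Y⁻¹ ≤ 1 := inv_le_one_of_one_le₀ hY1
      gcongr; linarith
    have q2 : Y ^ 2 ≤ U ^ 2 := by gcongr
    calc _ ≤ 5 * (C₁ ^ 2 * U ^ 10) * (e ^ 4 * U ^ 2 + e ^ 4 * U ^ 2) * Real.exp (-(U / 2) ^ 2) := by gcongr
      _ = 5 * C₁ ^ 2 * (2 * e ^ 4) * (U ^ 12 * Real.exp (-(U / 2) ^ 2)) := by ring
      _ ≤ _ := by rw [hC₂]; gcongr; exact exp_neg_sq_div_four_le hU0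
  have hrC : 2 * (40 * e ^ 2 + c₁ * (16 * e)) ≤ C₀ := by
    have hc1 : 1 ≤ c₁ := by rw [hc₁]; exact one_le_pow₀ (by linarith)
    have h1 : e ≤ e ^ 2 := le_self_pow₀ he1 two_ne_zero
    have h2 : 0 ≤ (c₁ - 1) * (40 * e ^ 2 - 16 * e) :=
      mul_nonneg (by linarith) (by linarith)
    rw [hC₀]
    linarith
  have hG3 : ∫ t in U..(8 * U), ‖G (σ + t * I)‖ ^ 2 ≤ C₃ * Q := by
    refine hGσ.trans ?_
    rw [hC₃, mul_assoc (Real.exp 7)]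
    refine mul_le_mul_of_nonneg_left ?_ (Real.exp_pos 7).le
    have r1 := mul_le_mul_of_nonneg_left hleft (by positivity : 0 ≤ 4 * e ^ 4)
    have r2 := mul_le_mul_of_nonneg_left (hright.trans (mul_le_mul_of_nonneg_right hrC hQ0.le))
      (by positivity : 0 ≤ 4 * e ^ 4)
    have r3 := mul_le_mul_of_nonneg_left hsmall (by positivity : 0 ≤ 7 * U)
    have r4 := mul_le_mul_of_nonneg_right hQU hC₂0.le
    linarith
  -- conclusion
  have h8 : U ≤ 8 * U := by linarith
  have hc4 : 1 ≤ Cx * e ^ 4 := by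
    have : 1 ≤ e ^ 4 := one_le_pow₀ he1
    calc (1 : ℝ) = 1 * 1 := by norm_num
      _ ≤ _ := by gcongr
  have hfin : ∀ t ∈ Icc U (8 * U), ‖riemannZeta (σ + t * I)‖ ^ (2 * k) ≤
      3 * ‖G (σ + t * I)‖ ^ 2 + 3 * ‖D (σ + t * I)‖ ^ 2 +
        3 * (Cx * e ^ 4) ^ 4 * ‖D ((1 - σ : ℝ) + t * I)‖ ^ 2 := by
    intro t ht
    have ht0 : 1 ≤ t := by linarith [ht.1]
    set z : ℂ := σ + t * I with hz
    have e1 : riemannZeta z ^ k = G z + D z + chi z ^ k * D (1 - z) := by simp only [hG]; ring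
    have e2 : 1 - z = (1 - σ : ℝ) - t * I := by rw [hz]; push_cast; ring
    have hch : ‖chi z‖ ≤ Cx * e ^ 4 := by
      refine (hCx σ t (by linarith) (by linarith) (by rw [abs_of_pos (by linarith)]; exact ht0)).trans ?_
      rw [abs_of_pos (by linarith)]
      gcongr
      have htU : t ≤ U ^ 2 := by
        calc t ≤ 8 * U := ht.2
          _ ≤ U * U := by gcongr; linarith
          _ = _ := by ring
      calc t ^ (1/2 - σ) ≤ t ^ (2 * κ) := Real.rpow_le_rpow_of_exponent_le ht0 (by linarith)
        _ ≤ (U ^ 2) ^ (2 * κ) := Real.rpow_le_rpow (by linarith) htU (by positivity)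
        _ = U ^ (((4 : ℕ) : ℝ) * κ) := by
          rw [← Real.rpow_natCast U 2, ← Real.rpow_mul hU0.le]; congr 1; push_cast; ring
        _ = e ^ 4 := hUe 4
    have hch2 : (‖chi z‖ ^ k) ^ 2 ≤ (Cx * e ^ 4) ^ 4 := by
      calc (‖chi z‖ ^ k) ^ 2 ≤ ((Cx * e ^ 4) ^ k) ^ 2 := by gcongr
        _ ≤ _ := pow_le_pow_four hc4 hk2
    rw [mul_comm 2 k, pow_mul, ← norm_pow, e1]
    have h1 := norm_add₃_le (a := G z) (b := D z) (c := chi z ^ k * D (1 - z))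
    have h2 : ‖G z + D z + chi z ^ k * D (1 - z)‖ ^ 2 ≤
        3 * ‖G z‖ ^ 2 + 3 * ‖D z‖ ^ 2 + 3 * ‖chi z ^ k * D (1 - z)‖ ^ 2 := by
      refine (pow_le_pow_left₀ (norm_nonneg _) h1 2).trans ?_
      linarith [sq_nonneg (‖G z‖ - ‖D z‖), sq_nonneg (‖G z‖ - ‖chi z ^ k * D (1 - z)‖),
        sq_nonneg (‖D z‖ - ‖chi z ^ k * D (1 - z)‖)]
    refine h2.trans ?_
    rw [norm_mul, norm_pow, e2, hDconj, mul_pow]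
    have := mul_le_mul_of_nonneg_right hch2 (sq_nonneg ‖D ((1 - σ : ℝ) + t * I)‖)
    linarith
  have iζ : IntervalIntegrable (fun t : ℝ => ‖riemannZeta (σ + t * I)‖ ^ (2 * k)) volume U (8 * U) := by
    refine ContinuousOn.intervalIntegrable ?_
    rw [uIcc_of_le h8]
    have := hcont (fun z => riemannZeta z ^ k)
      (fun z hz => (differentiableAt_riemannZeta (by rintro rfl; simp at hz)).pow k) σ U (8 * U) hU0
    refine this.congr fun t _ => ?_
    simp only [norm_pow]
    rw [mul_comm 2 k, pow_mul]
  have iG : IntervalIntegrable (fun t : ℝ => ‖G (σ + t * I)‖ ^ 2) volume U (8 * U) := by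
    refine ContinuousOn.intervalIntegrable ?_
    rw [uIcc_of_le h8]; exact hcont G hGd _ _ _ hU0
  have j1 := iG.const_mul 3
  have j2 := (hcontD σ U (8 * U)).const_mul 3
  have j3 := (hcontD (1 - σ) U (8 * U)).const_mul (3 * (Cx * e ^ 4) ^ 4)
  have hI := intervalIntegral.integral_mono_on h8 iζ ((j1.add j2).add j3) hfin
  rw [intervalIntegral.integral_add (j1.add j2) j3, intervalIntegral.integral_add j1 j2,
    intervalIntegral.integral_const_mul, intervalIntegral.integral_const_mul,
    intervalIntegral.integral_const_mul] at hI
  have d1 := hDσ σ U (8 * U) (by linarith) h8 (by linarith)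
  have d2 := hDσ (1 - σ) U (8 * U) (by linarith) h8 (by linarith)
  have d3 := mul_le_mul_of_nonneg_left d2 (by positivity : 0 ≤ 3 * (Cx * e ^ 4) ^ 4)
  refine hI.trans ?_
  rw [hC₄]
  linarith

lemma hasSum_riemannZeta {z : ℂ} (hz : 1 < z.re) :
    HasSum (fun n : ℕ => ((if n = 0 then 0 else 1 : ℝ) : ℂ) * (n : ℂ) ^ (-z)) (riemannZeta z ^ 1) := by
  have h := (LSeriesHasSum_one hz)
  rw [pow_one]
  unfold LSeriesHasSum at h
  convert h using 2 with n
  rcases eq_or_ne n 0 with rfl | hn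
  · simp
  · simp [LSeries.term, hn, Complex.cpow_neg]

lemma hasSum_riemannZeta_sq {z : ℂ} (hz : 1 < z.re) :
    HasSum (fun n : ℕ => ((n.divisors.card : ℝ) : ℂ) * (n : ℂ) ^ (-z)) (riemannZeta z ^ 2) := by
  have h := (LSeriesHasSum_one hz)
  have hc := h.convolution h
  rw [← pow_two] at hc
  unfold LSeriesHasSum at hc
  convert hc using 2 with n
  rcases eq_or_ne n 0 with rfl | hn
  · simp
  · rw [LSeries.term_of_ne_zero hn, LSeries.convolution_def, Complex.cpow_neg, div_eq_mul_inv]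
    congr 1
    simp only [Pi.one_apply, mul_one, Finset.sum_const, nsmul_eq_mul]
    rw [← Nat.map_div_right_divisors, Finset.card_map]
    simp

lemma log_half_bounds {U : ℝ} (hU : Real.exp 9 ≤ U) :
    Real.exp 8 ≤ U / 2 ∧ 8 ≤ Real.log (U / 2) ∧ Real.log (U / 2) ≤ Real.log U := by
  have h1 : Real.exp 9 = Real.exp 1 * Real.exp 8 := by rw [← Real.exp_add]; norm_num
  have h2 := Real.add_one_le_exp 1
  have h3 := Real.exp_pos 8
  have h4 : Real.exp 8 ≤ U / 2 := by
    have := mul_le_mul_of_nonneg_right h2 h3.le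
    linarith
  have hU0 : 0 < U / 2 := by linarith
  refine ⟨h4, ?_, Real.log_le_log hU0 (by linarith)⟩
  rwa [Real.le_log_iff_exp_le hU0]

lemma exists_second_moment_le : ∃ C : ℝ, 0 < C ∧ ∀ U σ : ℝ, Real.exp 9 ≤ U →
    |σ - 1 / 2| ≤ 2 / Real.log U →
    ∫ t in (U / 2)..(4 * U), ‖riemannZeta (σ + t * I)‖ ^ 2 ≤ C * (U * Real.log U) := by
  obtain ⟨C, hC, h⟩ := exists_moment_le (a := fun n => if n = 0 then 0 else 1) (k := 1) (by norm_num)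
    (by simp) (fun n => by split_ifs <;> norm_num) (fun n => by split_ifs <;> norm_num)
    (fun n => by
      split_ifs with hn
      · simp
      · exact_mod_cast Nat.one_le_iff_ne_zero.mpr hn) (fun z hz => hasSum_riemannZeta hz)
  refine ⟨C * 65, by positivity, fun U σ hU hσ => ?_⟩
  obtain ⟨h1, h2, h3⟩ := log_half_bounds hU
  set L := Real.log (U / 2) with hL
  have hU0 : 0 < U / 2 := lt_of_lt_of_le (Real.exp_pos _) h1
  have := h (U / 2) (2 * L) σ h1 (fun N => by
    refine (Finset.sum_le_sum (fun n _ => ?_)).trans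
      ((sum_rpow_neg_le (κ := 1 / L) (by positivity) (by rw [div_le_one (by linarith)]; linarith) N).trans ?_)
    · refine mul_le_of_le_one_left (by positivity) ?_
      split_ifs <;> norm_num
    · rw [one_div_one_div]; linarith) (by linarith)
      (hσ.trans (div_le_div_of_nonneg_left (by norm_num) (by linarith) h3))
  rw [show 8 * (U / 2) = 4 * U by ring] at this
  rw [mul_one, pow_one] at this
  refine this.trans ?_
  have hs : Real.sqrt (U / 2) * L ^ 2 ≤ 16 * (U / 2) := by
    have hs0 := Real.sqrt_nonneg (U / 2)
    have h4 : L ≤ 4 * Real.sqrt (Real.sqrt (U / 2)) := by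
      have := Real.log_le_rpow_div hU0.le (by norm_num : (0 : ℝ) < 1 / 4)
      rw [Real.sqrt_eq_rpow, Real.sqrt_eq_rpow, ← Real.rpow_mul hU0.le]
      norm_num at this ⊢
      linarith
    calc Real.sqrt (U / 2) * L ^ 2 ≤ Real.sqrt (U / 2) * (4 * Real.sqrt (Real.sqrt (U / 2))) ^ 2 := by gcongr
      _ = 16 * (Real.sqrt (U / 2) * Real.sqrt (U / 2)) := by
        rw [mul_pow, Real.sq_sqrt hs0]; ring
      _ = _ := by rw [Real.mul_self_sqrt hU0.le]
  rw [mul_assoc C 65]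
  refine mul_le_mul_of_nonneg_left ?_ hC.le
  calc U / 2 * (2 * L) + Real.sqrt (U / 2) * L * (2 * L) ^ 2
      = U * L + 4 * L * (Real.sqrt (U / 2) * L ^ 2) := by ring
    _ ≤ U * L + 4 * L * (16 * (U / 2)) := by gcongr
    _ ≤ 65 * (U * L) := by
      have : 0 ≤ U * L := mul_nonneg (by linarith) (by linarith)
      linarith
    _ ≤ 65 * (U * Real.log U) := by gcongr; linarith

lemma exists_fourth_moment_le : ∃ C : ℝ, 0 < C ∧ ∀ U σ : ℝ, Real.exp 9 ≤ U →
    |σ - 1 / 2| ≤ 2 / Real.log U →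
    ∫ t in (U / 2)..(4 * U), ‖riemannZeta (σ + t * I)‖ ^ 4 ≤ C * (U * Real.log U ^ 9) := by
  obtain ⟨C, hC, h⟩ := exists_moment_le (a := fun n => (n.divisors.card : ℝ)) (k := 2) (by norm_num)
    (by simp) (fun n => by positivity) (fun n => by exact_mod_cast Nat.le_self_pow two_ne_zero _)
    (fun n => by exact_mod_cast Nat.card_divisors_le_self n) (fun z hz => hasSum_riemannZeta_sq hz)
  refine ⟨C * 257, by positivity, fun U σ hU hσ => ?_⟩
  obtain ⟨h1, h2, h3⟩ := log_half_bounds hU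
  set L := Real.log (U / 2) with hL
  have hU0 : 0 < U / 2 := lt_of_lt_of_le (Real.exp_pos _) h1
  have hL1 : 1 ≤ L := by linarith
  have := h (U / 2) ((2 * L) ^ 4) σ h1 (fun N => by
    refine (sum_card_divisors_sq_rpow_le (κ := 1 / L) (by positivity)
      (by rw [div_le_one (by linarith)]; linarith) N).trans ?_
    rw [one_div_one_div]; gcongr; linarith) (one_le_pow₀ (by linarith))
      (hσ.trans (div_le_div_of_nonneg_left (by norm_num) (by linarith) h3))
  rw [show 8 * (U / 2) = 4 * U by ring] at this
  refine this.trans ?_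
  rw [Real.sqrt_sq hU0.le, mul_assoc C 257]
  refine mul_le_mul_of_nonneg_left ?_ hC.le
  have hp : L ^ 4 ≤ L ^ 9 := pow_le_pow_right₀ hL1 (by norm_num)
  calc U / 2 * (2 * L) ^ 4 + U / 2 * L * ((2 * L) ^ 4) ^ 2
      = U / 2 * (16 * L ^ 4) + U / 2 * (256 * L ^ 9) := by ring
    _ ≤ U / 2 * (16 * L ^ 9) + U / 2 * (256 * L ^ 9) := by gcongr
    _ ≤ 257 * (U * L ^ 9) := by
      have : 0 ≤ U * L ^ 9 := mul_nonneg (by linarith) (pow_nonneg (by linarith) 9)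
      linarith
    _ ≤ 257 * (U * Real.log U ^ 9) := by gcongr; linarith

/-- The order of vanishing of `ζ` at `ρ`. -/
def zetaOrder (ρ : ℂ) : ℕ := analyticOrderNatAt riemannZeta ρ

lemma analyticAt_riemannZeta {s : ℂ} (hs : s ≠ 1) : AnalyticAt ℂ riemannZeta s :=
  analyticOn_riemannZeta s hs

lemma analyticOrderAt_riemannZeta_ne_top (s : ℂ) : analyticOrderAt riemannZeta s ≠ ⊤ := by
  intro h
  rw [analyticOrderAt_eq_top] at h
  obtain ⟨r, hr, hb⟩ := Metric.eventually_nhds_iff_ball.mp h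
  have hf := (isCompact_closedBall s (r / 2)).inter_riemannZetaZeros_finite
  have hsub : Metric.ball s (r / 2) ⊆ Metric.closedBall s (r / 2) ∩ riemannZetaZeros := fun z hz =>
    ⟨Metric.ball_subset_closedBall hz, hb z (Metric.ball_subset_ball (by linarith) hz)⟩
  have hinf : (Metric.ball s (r / 2)).Infinite :=
    infinite_of_mem_nhds s (Metric.ball_mem_nhds s (by linarith))
  exact hinf (hf.subset hsub)

lemma exists_factorization {U : Set ℂ} (hU : IsOpen U) {f : ℂ → ℂ} (hf : DifferentiableOn ℂ f U)
    (hfin : ∀ z ∈ U, analyticOrderAt f z ≠ ⊤) (P : Finset ℂ) (hP : ↑P ⊆ U) :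
    ∃ g : ℂ → ℂ, DifferentiableOn ℂ g U ∧
      (∀ z ∈ U, f z = (∏ ρ ∈ P, (z - ρ) ^ analyticOrderNatAt f ρ) * g z) ∧ ∀ ρ ∈ P, g ρ ≠ 0 := by
  induction P using Finset.induction_on with
  | empty => exact ⟨f, hf, fun z _ => by simp, by simp⟩
  | insert ρ P hρ ih =>
    rw [Finset.coe_insert, Set.insert_subset_iff] at hP
    obtain ⟨g, hg, hfg, hg0⟩ := ih hP.2
    have hρU : U ∈ nhds ρ := hU.mem_nhds hP.1
    set n := analyticOrderNatAt f ρ with hn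
    have hfa : AnalyticAt ℂ f ρ := hf.analyticAt hρU
    obtain ⟨h, hha, hh0, hfh⟩ := (hfa.analyticOrderNatAt_eq_iff (hfin ρ hP.1)).mp hn.symm
    have hQ : ∀ z, z ∉ P → (∏ σ ∈ P, (z - σ) ^ analyticOrderNatAt f σ) ≠ 0 := fun z hz =>
      Finset.prod_ne_zero_iff.mpr fun σ hσ => pow_ne_zero _ (sub_ne_zero.mpr (by rintro rfl; exact hz hσ))
    set Q : ℂ → ℂ := fun z => ∏ σ ∈ P, (z - σ) ^ analyticOrderNatAt f σ with hQd
    have hQc : Differentiable ℂ Q := by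
      simp only [hQd]; fun_prop
    set k : ℂ → ℂ := fun z => h z / Q z with hk
    have hkd : ∀ᶠ z in nhds ρ, DifferentiableAt ℂ k z := by
      have h1 : ∀ᶠ z in nhds ρ, Q z ≠ 0 := hQc.continuous.continuousAt.eventually_ne (hQ ρ hρ)
      filter_upwards [h1, hha.eventually_analyticAt] with z hz hz'
      exact hz'.differentiableAt.div (hQc z) hz
    set g' : ℂ → ℂ := fun z => if z = ρ then k ρ else g z / (z - ρ) ^ n with hg'
    have hev : ∀ᶠ z in nhds ρ, g' z = k z := by
      have h1 : ∀ᶠ z in nhds ρ, Q z ≠ 0 := hQc.continuous.continuousAt.eventually_ne (hQ ρ hρ)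
      filter_upwards [h1, hfh, hρU] with z hz hz' hzU
      simp only [hg']
      split_ifs with h3
      · rw [h3]
      · have h4 : z - ρ ≠ 0 := sub_ne_zero.mpr h3
        have := hfg z hzU
        rw [hz', smul_eq_mul] at this
        simp only [hk]
        rw [div_eq_div_iff (pow_ne_zero _ h4) hz]
        linear_combination -this
    refine ⟨g', ?_, ?_, ?_⟩
    · intro z hz
      rcases eq_or_ne z ρ with rfl | hzρ
      · exact (hkd.self_of_nhds.congr_of_eventuallyEq hev).differentiableWithinAt
      · have h1 : ∀ᶠ w in nhds z, w ≠ ρ := isOpen_ne.mem_nhds hzρ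
        have h2 : g' =ᶠ[nhds z] fun w => g w / (w - ρ) ^ n := by
          filter_upwards [h1] with w hw
          simp only [hg', if_neg hw]
        refine DifferentiableAt.differentiableWithinAt ?_
        refine DifferentiableAt.congr_of_eventuallyEq ?_ h2
        exact (hg.differentiableAt (hU.mem_nhds hz)).div (by fun_prop)
          (pow_ne_zero _ (sub_ne_zero.mpr hzρ))
    · intro z hz
      rw [Finset.prod_insert hρ]
      rcases eq_or_ne z ρ with rfl | hzρ
      · have h1 := hfh.self_of_nhds
        simp only [hg', if_true, hk]
        rw [h1, smul_eq_mul]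
        have := hQ z hρ
        simp only [hQd] at this ⊢
        field_simp
        rw [← hn]
      · simp only [hg', if_neg hzρ]
        rw [hfg z hz, ← hn]
        have : (z - ρ) ^ n ≠ 0 := pow_ne_zero _ (sub_ne_zero.mpr hzρ)
        field_simp
    · intro σ hσ
      rw [Finset.mem_insert] at hσ
      rcases eq_or_ne σ ρ with rfl | hσρ
      · simp only [hg', if_true, hk]
        exact div_ne_zero hh0 (hQ σ hρ)
      · simp only [hg', if_neg hσρ]
        exact div_ne_zero (hg0 σ (hσ.resolve_left hσρ)) (pow_ne_zero _ (sub_ne_zero.mpr hσρ))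

lemma exists_zeta_factorization (P : Finset ℂ) (hP : ∀ ρ ∈ P, ρ ≠ 1) :
    ∃ g : ℂ → ℂ, DifferentiableOn ℂ g {1}ᶜ ∧
      (∀ z, z ≠ 1 → riemannZeta z = (∏ ρ ∈ P, (z - ρ) ^ zetaOrder ρ) * g z) ∧ ∀ ρ ∈ P, g ρ ≠ 0 :=
  exists_factorization isOpen_compl_singleton
    (fun _ hz => (differentiableAt_riemannZeta hz).differentiableWithinAt)
    (fun z _ => analyticOrderAt_riemannZeta_ne_top z) P hP

lemma norm_riemannZeta_sub_one_le {z : ℂ} (hz : 2 ≤ z.re) : ‖riemannZeta z - 1‖ ≤ 13 / 20 := by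
  have h := hasSum_riemannZeta (z := z) (by linarith)
  rw [pow_one] at h
  have h1 := (hasSum_nat_add_iff' 2).mpr h
  simp [Finset.sum_range_succ] at h1
  have h2 := (hasSum_nat_add_iff' 2).mpr hasSum_zeta_two
  simp [Finset.sum_range_succ] at h2
  have h3 := tsum_of_norm_bounded (f := fun n : ℕ => (if n + 2 = 0 then (0:ℂ) else 1) * ((n : ℂ) + 2) ^ (-z)) h2 ?_
  · rw [← h1.tsum_eq]
    refine le_trans ?_ (h3.trans ?_)
    · simp
    · nlinarith [Real.pi_lt_d4, Real.pi_pos]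
  · intro n
    have : ((n : ℂ) + 2) = ((n + 2 : ℕ) : ℂ) := by push_cast; ring
    rw [if_neg (by omega), one_mul, this, norm_nat_cpow_neg (by omega)]
    push_cast
    rw [← Real.rpow_natCast, ← Real.rpow_neg (by positivity)]
    refine Real.rpow_le_rpow_of_exponent_le (by linarith [(Nat.cast_nonneg n : (0 : ℝ) ≤ n)]) ?_
    push_cast; linarith

lemma exists_sum_zetaOrder_le : ∃ C : ℝ, 1 ≤ C ∧ ∀ t : ℝ, 4 ≤ t → ∀ P : Finset ℂ,
    (∀ ρ ∈ P, riemannZeta ρ = 0 ∧ 1 / 2 ≤ ρ.re ∧ t ≤ ρ.im ∧ ρ.im ≤ t + 1) →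
    ∑ ρ ∈ P, (zetaOrder ρ : ℝ) ≤ C * Real.log t := by
  obtain ⟨Cz, hCz1, hCz⟩ := exists_norm_riemannZeta_le
  have hlr : 0 < Real.log (2.4 / 1.6) := Real.log_pos (by norm_num)
  refine ⟨max 1 ((Real.log (12 * Cz) + 2) / Real.log (2.4 / 1.6)), le_max_left _ _, fun t ht P hP => ?_⟩
  set c : ℂ := 2 + ((t + 1 / 2 : ℝ) : ℂ) * I with hc
  have hcre : c.re = 2 := by simp [hc]
  have hcim : c.im = t + 1 / 2 := by simp [hc]
  have hball : ∀ z ∈ Metric.closedBall c |2.4|, -(1/2) ≤ z.re ∧ z.re ≤ 10 ∧ 1 ≤ z.im ∧ z.im ≤ 2 * t := by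
    intro z hz
    rw [Metric.mem_closedBall, dist_eq_norm, abs_of_pos (by norm_num)] at hz
    have h1 := abs_le.mp ((Complex.abs_re_le_norm _).trans hz)
    have h2 := abs_le.mp ((Complex.abs_im_le_norm _).trans hz)
    rw [sub_re, hcre] at h1
    rw [sub_im, hcim] at h2
    exact ⟨by linarith [h1.1], by linarith [h1.2], by linarith [h2.1], by linarith [h2.2]⟩
  have han : AnalyticOnNhd ℂ riemannZeta (Metric.closedBall c |2.4|) := fun z hz =>
    analyticAt_riemannZeta (by rintro rfl; have := (hball 1 hz).2.2.1; norm_num at this)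
  have hc1 : 1 / 3 ≤ ‖riemannZeta c‖ := by
    have h1 := norm_riemannZeta_sub_one_le (z := c) (by rw [hcre])
    have h2 := norm_sub_norm_le 1 (1 - riemannZeta c)
    rw [norm_one, sub_sub_cancel, norm_sub_rev] at h2
    linarith
  have hM : 1 ≤ Cz * (2 * t) ^ 2 := by
    have : 1 ≤ (2 * t) ^ 2 := one_le_pow₀ (by linarith)
    calc (1 : ℝ) = 1 * 1 := by norm_num
      _ ≤ _ := by gcongr
  have key := AnalyticOnNhd.sum_divisor_le (c := c) (r := 1.6) (R := 2.4) (M := Cz * (2 * t) ^ 2)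
    (f := riemannZeta) (by norm_num) (by norm_num [abs_of_pos]) hM han
    (norm_pos_iff.mp (by linarith)) (fun z hz => by
      have hz' := hball z (Metric.sphere_subset_closedBall hz)
      have := hCz z.re z.im hz'.1 hz'.2.1 (by rw [abs_of_pos (by linarith [hz'.2.2.1])]; exact hz'.2.2.1)
      rw [Complex.re_add_im, abs_of_pos (by linarith [hz'.2.2.1])] at this
      refine this.trans ?_
      have h1 := hz'.2.2.1
      have h2 := hz'.2.2.2
      gcongr)
  have han' : AnalyticOnNhd ℂ riemannZeta (Metric.closedBall c |1.6|) :=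
    han.mono (Metric.closedBall_subset_closedBall (by norm_num [abs_of_pos]))
  have hPb : ∀ ρ ∈ P, ρ ∈ Metric.closedBall c |1.6| := by
    intro ρ hρ
    obtain ⟨h0, h1, h2, h3⟩ := hP ρ hρ
    have h4 : ρ.re < 1 := by
      by_contra h
      exact riemannZeta_ne_zero_of_one_le_re (not_lt.mp h) h0
    rw [Metric.mem_closedBall, dist_eq_norm, abs_of_pos (by norm_num)]
    have : ‖ρ - c‖ ^ 2 ≤ 1.6 ^ 2 := by
      rw [Complex.sq_norm, Complex.normSq_apply, sub_re, sub_im, hcre, hcim]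
      have a1 : (ρ.re - 2) * (ρ.re - 2) ≤ 2.25 := by nlinarith
      have a2 : (ρ.im - (t + 1 / 2)) * (ρ.im - (t + 1 / 2)) ≤ 0.25 := by nlinarith
      norm_num at a1 a2 ⊢
      linarith
    exact le_of_sq_le_sq this (by norm_num)
  have hsum : (∑ ρ ∈ P, (zetaOrder ρ : ℝ)) ≤
      ((∑ᶠ u, MeromorphicOn.divisor riemannZeta (Metric.closedBall c |1.6|) u : ℤ) : ℝ) := by
    have hfin := (MeromorphicOn.divisor riemannZeta (Metric.closedBall c |1.6|)).finiteSupport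
      (isCompact_closedBall _ _)
    have hnn := MeromorphicOn.AnalyticOnNhd.divisor_nonneg han'
    rw [finsum_eq_sum_of_support_subset (s := hfin.toFinset ∪ P) _ (by
      intro x hx; simp only [Finset.coe_union, Set.Finite.coe_toFinset]; exact Or.inl hx)]
    push_cast
    refine le_trans (Finset.sum_le_sum fun ρ hρ => ?_)
      (Finset.sum_le_sum_of_subset_of_nonneg Finset.subset_union_right fun x _ _ => ?_)
    · rw [MeromorphicOn.AnalyticOnNhd.divisor_apply han' (hPb ρ hρ)]
      rw [← Nat.cast_analyticOrderNatAt (analyticOrderAt_riemannZeta_ne_top ρ)]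
      simp [zetaOrder]
    · exact_mod_cast hnn x
  refine hsum.trans (key.trans ?_)
  have hl1 : 1 ≤ Real.log t := by
    rw [Real.le_log_iff_exp_le (by linarith)]
    linarith [Real.exp_one_lt_d9]
  have hl2 : Real.log (Cz * (2 * t) ^ 2 / ‖riemannZeta c‖) ≤ (Real.log (12 * Cz) + 2) * Real.log t := by
    have h1 : Cz * (2 * t) ^ 2 / ‖riemannZeta c‖ ≤ 12 * Cz * t ^ 2 := by
      rw [div_le_iff₀ (by linarith)]
      have : 0 ≤ 12 * Cz * t ^ 2 := by positivity
      have := mul_le_mul_of_nonneg_left hc1 this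
      linarith
    have h2 : 0 < Cz * (2 * t) ^ 2 / ‖riemannZeta c‖ := by
      have : 0 < ‖riemannZeta c‖ := by linarith
      positivity
    refine (Real.log_le_log h2 h1).trans ?_
    rw [Real.log_mul (by positivity) (by positivity), Real.log_pow, add_mul]
    have h3 : 0 ≤ Real.log (12 * Cz) := Real.log_nonneg (by linarith)
    push_cast
    have := le_mul_of_one_le_right h3 hl1
    linarith
  calc _ ≤ (Real.log (12 * Cz) + 2) * Real.log t / Real.log (2.4 / 1.6) := by gcongr
    _ = (Real.log (12 * Cz) + 2) / Real.log (2.4 / 1.6) * Real.log t := by ring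
    _ ≤ _ := by gcongr; exact le_max_right _ _

lemma norm_sq_add_conj_sub (s ρ : ℂ) (a : ℝ) :
    ‖s + (starRingEnd ℂ) ρ - 2 * a‖ ^ 2 = ‖s - ρ‖ ^ 2 + 4 * (s.re - a) * (ρ.re - a) := by
  rw [Complex.sq_norm, Complex.sq_norm, Complex.normSq_apply, Complex.normSq_apply]
  simp
  ring

/-- The factor obtained from `ζ²` by reflecting the zeros in `P` across the line `Re s = a`. -/
lemma exists_reflected_zeta_sq (P : Finset ℂ) (hP : ∀ ρ ∈ P, ρ ≠ 1) (a : ℝ) (haP : ∀ ρ ∈ P, a ≤ ρ.re) :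
    ∃ F : ℂ → ℂ, (∀ z, z ≠ 1 → DifferentiableAt ℂ F z) ∧
      (∀ z, z ≠ 1 → z.re = a → ‖F z‖ = ‖riemannZeta z‖ ^ 2) ∧
      (∀ z κ b, z ≠ 1 → 0 ≤ κ → (∀ ρ ∈ P, 4 * (z.re - a) ≤ κ * ‖z - ρ‖ ^ 2 ∧ ρ.re - a ≤ b) →
        ‖F z‖ ≤ ‖riemannZeta z‖ ^ 2 * Real.exp (κ * b * ∑ ρ ∈ P, (zetaOrder ρ : ℝ))) ∧
      (∀ z δ, z ≠ 1 → 0 ≤ δ →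
        (∀ ρ ∈ P, δ * ‖z - ρ‖ ^ 2 ≤ 4 * (z.re - a) * (ρ.re - a)) →
        (δ * ∑ ρ ∈ P, (zetaOrder ρ : ℝ)) * ‖riemannZeta z‖ ^ 2 ≤ ‖F z‖) := by
  obtain ⟨g, hgd, hg, -⟩ := exists_zeta_factorization P hP
  have hz : ∀ z, z ≠ 1 → ‖riemannZeta z‖ ^ 2 = ‖g z‖ ^ 2 * ∏ ρ ∈ P, (‖z - ρ‖ ^ 2) ^ zetaOrder ρ := by
    intro z hz
    rw [hg z hz, norm_mul, mul_pow, norm_prod, ← Finset.prod_pow, mul_comm]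
    congr 1
    refine Finset.prod_congr rfl fun ρ _ => ?_
    rw [norm_pow, ← pow_mul, ← pow_mul, mul_comm]
  set F : ℂ → ℂ := fun z => g z ^ 2 * ∏ ρ ∈ P, ((z + (starRingEnd ℂ) ρ - 2 * a) ^ 2) ^ zetaOrder ρ with hF
  have hFn : ∀ z, ‖F z‖ = ‖g z‖ ^ 2 * ∏ ρ ∈ P,
      (‖z - ρ‖ ^ 2 + 4 * (z.re - a) * (ρ.re - a)) ^ zetaOrder ρ := by
    intro z
    simp only [hF]
    rw [norm_mul, norm_pow, norm_prod]
    congr 1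
    refine Finset.prod_congr rfl fun ρ _ => ?_
    rw [norm_pow, norm_pow, norm_sq_add_conj_sub]
  refine ⟨F, ?_, ?_, ?_, ?_⟩
  · intro z hz
    have h1 : DifferentiableAt ℂ g z := hgd.differentiableAt (isOpen_compl_singleton.mem_nhds hz)
    exact (h1.pow 2).mul (by fun_prop)
  · intro z h1 h2
    rw [hFn, hz z h1, h2]; simp
  · intro z κ b h1 hκ h2
    rw [hFn, hz z h1, mul_assoc, Finset.mul_sum, Real.exp_sum, ← Finset.prod_mul_distrib]
    refine mul_le_mul_of_nonneg_left (Finset.prod_le_prod (fun ρ hρ => ?_) fun ρ hρ => ?_) (by positivity)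
    · rw [← norm_sq_add_conj_sub]; positivity
    · rw [mul_comm (κ * b), Real.exp_nat_mul, ← mul_pow]
      have h0 := norm_sq_add_conj_sub z ρ a
      obtain ⟨h3, h4⟩ := h2 ρ hρ
      refine pow_le_pow_left₀ (by rw [← h0]; positivity) ?_ _
      have h5 : 0 ≤ ρ.re - a := sub_nonneg.mpr (haP ρ hρ)
      calc ‖z - ρ‖ ^ 2 + 4 * (z.re - a) * (ρ.re - a)
          ≤ ‖z - ρ‖ ^ 2 + κ * ‖z - ρ‖ ^ 2 * (ρ.re - a) := by gcongr
        _ ≤ ‖z - ρ‖ ^ 2 + κ * ‖z - ρ‖ ^ 2 * b := by gcongr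
        _ = ‖z - ρ‖ ^ 2 * (κ * b + 1) := by ring
        _ ≤ _ := by gcongr; exact Real.add_one_le_exp _
  · intro z δ h1 hδ h2
    have h3 : δ * ∑ ρ ∈ P, (zetaOrder ρ : ℝ) ≤ ∏ ρ ∈ P, (1 + δ) ^ zetaOrder ρ := by
      rw [Finset.prod_pow_eq_pow_sum]
      have := one_add_mul_le_pow (a := δ) (by linarith) (∑ ρ ∈ P, zetaOrder ρ)
      push_cast at this
      linarith
    rw [hFn, hz z h1]
    calc _ ≤ (∏ ρ ∈ P, (1 + δ) ^ zetaOrder ρ) * (‖g z‖ ^ 2 * ∏ ρ ∈ P, (‖z - ρ‖ ^ 2) ^ zetaOrder ρ) := by gcongr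
      _ = ‖g z‖ ^ 2 * ∏ ρ ∈ P, ((1 + δ) * ‖z - ρ‖ ^ 2) ^ zetaOrder ρ := by
        simp only [mul_pow, Finset.prod_mul_distrib]; ring
      _ ≤ _ := by
        refine mul_le_mul_of_nonneg_left (Finset.prod_le_prod (fun ρ hρ => by positivity) fun ρ hρ => ?_) (by positivity)
        refine pow_le_pow_left₀ (by positivity) ?_ _
        linarith [h2 ρ hρ]

lemma norm_riemannZeta_le_two {z : ℂ} (hz : 2 ≤ z.re) : ‖riemannZeta z‖ ≤ 2 := by
  have h1 := norm_riemannZeta_sub_one_le hz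
  have h2 := norm_add_le (riemannZeta z - 1) 1
  rw [sub_add_cancel, norm_one] at h2
  linarith

lemma continuousOn_norm_comp_vert {F : ℂ → ℂ} (x : ℝ) {A B : ℝ}
    (hF : ∀ y ∈ Icc A B, DifferentiableAt ℂ F (x + y * I)) :
    ContinuousOn (fun y : ℝ => ‖F (x + y * I)‖) (Icc A B) := by
  intro y hy
  refine ContinuousAt.continuousWithinAt (ContinuousAt.norm ?_)
  exact ContinuousAt.comp (g := F) (f := fun y : ℝ => (x + y * I : ℂ))
    (hF y hy).continuousAt (continuous_const.add (continuous_ofReal.mul continuous_const)).continuousAt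

lemma integral_exp_neg_sub_sq_le (t : ℝ) {H : ℝ} (hH : 0 ≤ H) :
    ∫ y in (t - H)..(t + H), Real.exp (-(y - t) ^ 2) ≤ 2 := by
  have := intervalIntegral.integral_comp_sub_right (a := t - H) (b := t + H)
    (fun v => Real.exp (-v ^ 2)) t
  rw [this, show t - H - t = -H by ring, show t + H - t = H by ring]
  exact intervalIntegral_exp_neg_sq_le H hH

lemma sum_zetaOrder_mul_le {P : Finset ℂ} {η B t H q M : ℝ} (hη : 0 < η) (hB : 1 ≤ B)
    (hBη : B * η ≤ 1 / 4) (hH : 5 / 2 ≤ H) (htH : 1 ≤ t - H) (hq : 0 < q)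
    (hP : ∀ ρ ∈ P, 1 / 2 < ρ.re ∧ ρ.re ≤ 1 / 2 - η + B * η ∧ |ρ.im - t| ≤ η)
    (hM1 : ∀ x : ℝ, 1 / 2 - η ≤ x → x ≤ 2 → ‖riemannZeta (x + (t - H : ℝ) * I)‖ ^ 2 ≤ M)
    (hM2 : ∀ x : ℝ, 1 / 2 - η ≤ x → x ≤ 2 → ‖riemannZeta (x + (t + H : ℝ) * I)‖ ^ 2 ≤ M) :
    (∑ ρ ∈ P, (zetaOrder ρ : ℝ)) * ‖riemannZeta (1 / 2 + t * I)‖ ^ 2 ≤ B * Real.exp 7 * (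
      q ^ (-η) * (∫ y in (t - H)..(t + H),
        ‖riemannZeta ((1 / 2 - η : ℝ) + y * I)‖ ^ 2 * (2 * η / (η ^ 2 + (y - t) ^ 2))) +
      8 * q ^ (3 / 2 : ℝ) * Real.exp (5 * (B * η) * ∑ ρ ∈ P, (zetaOrder ρ : ℝ)) +
      5 * (M * Real.exp (7 * (B * η) * ∑ ρ ∈ P, (zetaOrder ρ : ℝ))) * (q ^ (-η) + q ^ (3 / 2 : ℝ)) *
        Real.exp (-H ^ 2)) := by
  have hη4 : η ≤ 1 / 4 := (le_mul_of_one_le_left hη.le hB).trans hBη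
  set N := ∑ ρ ∈ P, (zetaOrder ρ : ℝ) with hN
  set a := 1 / 2 - η with ha
  have hone : ∀ z : ℂ, 1 ≤ z.im → z ≠ 1 := fun z hz h => by rw [h] at hz; norm_num at hz
  have hPim : ∀ ρ ∈ P, t - η ≤ ρ.im ∧ ρ.im ≤ t + η := fun ρ hρ => by
    have := abs_le.mp (hP ρ hρ).2.2
    exact ⟨by linarith [this.1], by linarith [this.2]⟩
  obtain ⟨F, hFd, hFa, hFu, hFl⟩ := exists_reflected_zeta_sq P
    (fun ρ hρ => hone ρ (by linarith [(hPim ρ hρ).1])) a (fun ρ hρ => by linarith [(hP ρ hρ).1])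
  set cs : ℂ := (1 / 2 - 2 * η : ℝ) + t * I with hcs
  have hcsre : cs.re = 1 / 2 - 2 * η := by simp [hcs]
  have hcsim : cs.im = t := by simp [hcs]
  set G : ℂ → ℂ := fun z => F z * ((2 * η : ℝ) / (z - cs)) with hG
  have hGn : ∀ z, ‖G z‖ = ‖F z‖ * (2 * η / ‖z - cs‖) := by
    intro z
    simp only [hG]
    rw [norm_mul, norm_div, Complex.norm_real, Real.norm_of_nonneg (by linarith)]
  have hGd : ∀ z : ℂ, a ≤ z.re → 1 ≤ z.im → DifferentiableAt ℂ G z := by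
    intro z h1 h2
    refine (hFd z (hone z h2)).mul (DifferentiableAt.div (by fun_prop) (by fun_prop) ?_)
    rw [sub_ne_zero]; rintro rfl; linarith
  have hkle : ∀ z : ℂ, 2 * η ≤ ‖z - cs‖ → ‖G z‖ ≤ ‖F z‖ := by
    intro z hz
    rw [hGn]
    exact mul_le_of_le_one_right (norm_nonneg _) ((div_le_one (by linarith)).mpr hz)
  have hb : ∀ ρ ∈ P, ρ.re - a ≤ B * η := fun ρ hρ => by linarith [(hP ρ hρ).2.1]
  have hhor : ∀ x y : ℝ, a ≤ x → x ≤ 2 → 1 ≤ y → H ≤ |y - t| → ‖riemannZeta (x + y * I)‖ ^ 2 ≤ M →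
      ‖G (x + y * I)‖ ≤ M * Real.exp (7 * (B * η) * N) := by
    intro x y h1 h2 h3 h4 h5
    have him : ((x : ℂ) + y * I).im = y := by simp
    refine (hkle _ ?_).trans ((hFu _ 7 (B * η) (hone _ (by rw [him]; exact h3)) (by norm_num)
      fun ρ hρ => ⟨?_, hb ρ hρ⟩).trans ?_)
    · refine le_trans ?_ (Complex.abs_im_le_norm _)
      rw [sub_im, hcsim, him]; linarith
    · have h6 : 1 ≤ ‖(x : ℂ) + y * I - ρ‖ := by
        refine le_trans ?_ (Complex.abs_im_le_norm _)
        rw [sub_im, him]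
        have h7 := abs_sub_abs_le_abs_sub (y - t) (ρ.im - t)
        rw [show y - t - (ρ.im - t) = y - ρ.im by ring] at h7
        linarith [(hP ρ hρ).2.2]
      have h7 : 1 ≤ ‖(x : ℂ) + y * I - ρ‖ ^ 2 := one_le_pow₀ h6
      simp only [add_re, ofReal_re, mul_re, I_re, mul_zero, ofReal_im, I_im, mul_one, sub_self, add_zero]
      linarith
    · gcongr
  have hHabs : |(t - H) - t| = H ∧ |(t + H) - t| = H := by
    constructor
    · rw [show t - H - t = -H by ring, abs_neg, abs_of_pos (by linarith)]
    · rw [show t + H - t = H by ring, abs_of_pos (by linarith)]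
  have key := norm_le_of_gaussian_cauchy (G := G) (a := a) (b := 2) (σ := 1 / 2) (t := t) (H := H)
    (Y := q) (M := M * Real.exp (7 * (B * η) * N)) hq (by linarith) (by norm_num) (by linarith) hH
    (fun z h1 _ h3 _ => hGd z h1 (by linarith))
    (fun x h1 h2 => hhor x _ h1 h2 htH hHabs.1.ge (hM1 x h1 h2))
    (fun x h1 h2 => hhor x _ h1 h2 (by linarith) hHabs.2.ge (hM2 x h1 h2))
  have ht0 : 1 ≤ t := by linarith
  have htt : t - H ≤ t + H := by linarith
  set c : ℂ := ((1 / 2 : ℝ) : ℂ) + t * I with hc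
  have hGc : ‖G c‖ = ‖F c‖ := by
    rw [hGn]
    have : c - cs = ((2 * η : ℝ) : ℂ) := by rw [hc, hcs]; push_cast; ring
    rw [this, Complex.norm_real, Real.norm_of_nonneg (by linarith), div_self (by linarith), mul_one]
  have hlow : (4 / B * N) * ‖riemannZeta c‖ ^ 2 ≤ ‖F c‖ := by
    have hcre : c.re = 1 / 2 := by simp [hc]
    have hcim : c.im = t := by simp [hc]
    refine hFl c (4 / B) (hone _ (by rw [hcim]; exact ht0)) (by positivity) fun ρ hρ => ?_
    obtain ⟨h1, h2, h3⟩ := hP ρ hρ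
    rw [hcre, Complex.sq_norm, Complex.normSq_apply, sub_re, sub_im, hcre, hcim, div_mul_eq_mul_div,
      div_le_iff₀ (by linarith)]
    have e1 : (t - ρ.im) * (t - ρ.im) ≤ η ^ 2 := by
      rw [← sq, ← sq_abs, abs_sub_comm]; gcongr
    set x := ρ.re - a with hx
    have hx1 : η ≤ x := by linarith
    have hx2 : x ≤ B * η := hb ρ hρ
    have e2 : 1 / 2 - ρ.re = η - x := by rw [hx, ha]; ring
    have e3 : 1 / 2 - a = η := by rw [ha]; ring
    rw [e2, e3]
    have e4 : (η - x) * (η - x) + (t - ρ.im) * (t - ρ.im) ≤ x * x := by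
      have := mul_nonneg hη.le (sub_nonneg.mpr hx1)
      linarith
    have e5 : x * x ≤ (B * η) * x := mul_le_mul_of_nonneg_right hx2 (by linarith)
    linarith
  have hzc : riemannZeta c = riemannZeta (1 / 2 + t * I) := by rw [hc]; push_cast; rfl
  rw [hzc] at hlow
  have hl : ∫ y in (t - H)..(t + H), ‖G (a + y * I)‖ * Real.exp (-(y - t) ^ 2) / ‖(a + y * I : ℂ) - c‖ ≤
      ∫ y in (t - H)..(t + H), ‖riemannZeta (a + y * I)‖ ^ 2 * (2 * η / (η ^ 2 + (y - t) ^ 2)) := by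
    have hec : Continuous fun y : ℝ => Real.exp (-(y - t) ^ 2) :=
      Real.continuous_exp.comp (((continuous_id.sub continuous_const).pow 2).neg)
    have hnc : Continuous fun y : ℝ => ‖(a + y * I : ℂ) - c‖ :=
      ((continuous_const.add (continuous_ofReal.mul continuous_const)).sub continuous_const).norm
    have hnn : ∀ y : ℝ, ‖(a + y * I : ℂ) - c‖ ^ 2 = η ^ 2 + (y - t) ^ 2 := by
      intro y
      rw [Complex.sq_norm, Complex.normSq_apply]; simp [hc, ha]; ring
    have hnn' : ∀ y : ℝ, ‖(a + y * I : ℂ) - cs‖ ^ 2 = η ^ 2 + (y - t) ^ 2 := by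
      intro y
      rw [Complex.sq_norm, Complex.normSq_apply]; simp [hcs, ha]; ring
    have hpos : ∀ y : ℝ, 0 < η ^ 2 + (y - t) ^ 2 := fun y => by positivity
    have hnp : ∀ y : ℝ, 0 < ‖(a + y * I : ℂ) - c‖ := fun y => by
      rw [norm_pos_iff]; intro h; have := hnn y; rw [h] at this; simp at this; linarith [hpos y]
    refine intervalIntegral.integral_mono_on htt ?_ ?_ fun y hy => ?_
    · refine ContinuousOn.intervalIntegrable ?_
      rw [uIcc_of_le htt]
      refine ContinuousOn.div (ContinuousOn.mul (continuousOn_norm_comp_vert a fun y hy =>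
        hGd _ (by simp) (by simp; linarith [hy.1])) hec.continuousOn) hnc.continuousOn fun y _ => (hnp y).ne'
    · refine ContinuousOn.intervalIntegrable ?_
      rw [uIcc_of_le htt]
      refine ContinuousOn.mul (ContinuousOn.pow (continuousOn_norm_comp_vert a fun y hy => ?_) 2)
        (Continuous.continuousOn (continuous_const.div
          (continuous_const.add ((continuous_id.sub continuous_const).pow 2)) fun y => (hpos y).ne'))
      exact differentiableAt_riemannZeta (hone _ (by simp; linarith [hy.1]))
    · have h1 : ‖(a + y * I : ℂ) - cs‖ = ‖(a + y * I : ℂ) - c‖ :=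
        (sq_eq_sq₀ (norm_nonneg _) (norm_nonneg _)).mp (by rw [hnn, hnn'])
      have h2 := hnp y
      rw [hGn, hFa _ (hone _ (by simp; linarith [hy.1])) (by simp), h1, ← hnn]
      have h3 : Real.exp (-(y - t) ^ 2) ≤ 1 := Real.exp_le_one_iff.mpr (by nlinarith)
      calc _ = ‖riemannZeta (a + y * I)‖ ^ 2 * (2 * η / ‖(a + y * I : ℂ) - c‖ ^ 2) * Real.exp (-(y - t) ^ 2) := by
            field_simp
        _ ≤ _ := mul_le_of_le_one_right (by positivity) h3
  have hr : ∫ y in (t - H)..(t + H), ‖G ((2 : ℝ) + y * I)‖ * Real.exp (-(y - t) ^ 2) ≤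
      8 * Real.exp (5 * (B * η) * N) := by
    have hec : Continuous fun y : ℝ => Real.exp (-(y - t) ^ 2) :=
      Real.continuous_exp.comp (((continuous_id.sub continuous_const).pow 2).neg)
    have h1 : ∀ y ∈ Icc (t - H) (t + H), ‖G ((2 : ℝ) + y * I)‖ * Real.exp (-(y - t) ^ 2) ≤
        (4 * Real.exp (5 * (B * η) * N)) * Real.exp (-(y - t) ^ 2) := by
      intro y hy
      refine mul_le_mul_of_nonneg_right ?_ (Real.exp_pos _).le
      have hre : (((2 : ℝ) : ℂ) + y * I).re = 2 := by simp
      refine (hkle _ ?_).trans ((hFu _ 5 (B * η) (hone _ (by simp; linarith [hy.1])) (by norm_num)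
        fun ρ hρ => ⟨?_, hb ρ hρ⟩).trans ?_)
      · refine le_trans ?_ (Complex.abs_re_le_norm _)
        refine le_trans ?_ (le_abs_self _)
        rw [sub_re, hcsre, hre]; linarith
      · have h6 : 5 / 4 ≤ ‖((2 : ℝ) : ℂ) + y * I - ρ‖ := by
          refine le_trans ?_ (Complex.abs_re_le_norm _)
          refine le_trans ?_ (le_abs_self _)
          rw [sub_re, hre]; linarith [hb ρ hρ]
        have h7 := pow_le_pow_left₀ (by norm_num) h6 2
        rw [hre]; linarith
      · have h8 := norm_riemannZeta_le_two (z := ((2 : ℝ) : ℂ) + y * I) (by rw [hre])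
        have h9 := pow_le_pow_left₀ (norm_nonneg _) h8 2
        gcongr; linarith
    have iG : IntervalIntegrable (fun y : ℝ => ‖G ((2 : ℝ) + y * I)‖ * Real.exp (-(y - t) ^ 2)) volume
        (t - H) (t + H) := by
      refine ContinuousOn.intervalIntegrable ?_
      rw [uIcc_of_le htt]
      exact ContinuousOn.mul (continuousOn_norm_comp_vert 2 fun y hy =>
        hGd _ (by simp; linarith) (by simp; linarith [hy.1])) hec.continuousOn
    have h2 := intervalIntegral.integral_mono_on htt iG
      ((hec.intervalIntegrable (μ := volume) _ _).const_mul _) h1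
    rw [intervalIntegral.integral_const_mul] at h2
    have h3 := mul_le_mul_of_nonneg_left (integral_exp_neg_sub_sq_le t (H := H) (by linarith))
      (by positivity : 0 ≤ 4 * Real.exp (5 * (B * η) * N))
    linarith
  rw [hGc] at key
  have hfin := hlow.trans key
  have e1 : a - 1 / 2 = -η := by rw [ha]; ring
  have e2 : (2 : ℝ) - 1 / 2 = 3 / 2 := by norm_num
  rw [e1, e2] at hfin
  have hq1 : 0 ≤ q ^ (-η) := by positivity
  have hq2 : 0 ≤ q ^ (3 / 2 : ℝ) := by positivity
  have i1 := mul_le_mul_of_nonneg_left hl hq1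
  have i2 := mul_le_mul_of_nonneg_left hr (by positivity : 0 ≤ q ^ (3 / 2 : ℝ) / (3 / 2))
  have i3 : q ^ (3 / 2 : ℝ) / (3 / 2) * (8 * Real.exp (5 * (B * η) * N)) ≤
      8 * q ^ (3 / 2 : ℝ) * Real.exp (5 * (B * η) * N) := by
    have : 0 ≤ q ^ (3 / 2 : ℝ) * Real.exp (5 * (B * η) * N) := by positivity
    linarith
  have hB0 : 0 < B := by linarith
  have h4 : N * ‖riemannZeta (1 / 2 + t * I)‖ ^ 2 = B / 4 * (4 / B * N * ‖riemannZeta (1 / 2 + t * I)‖ ^ 2) := by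
    field_simp
  rw [h4, mul_assoc B]
  have hX := mul_le_mul_of_nonneg_left hfin (by positivity : 0 ≤ B / 4)
  refine hX.trans ?_
  refine mul_le_mul (by linarith) ?_ (le_trans (by positivity) hfin) hB0.le
  refine mul_le_mul_of_nonneg_left ?_ (Real.exp_pos 7).le
  linarith

lemma integral_poisson_le {η : ℝ} (hη : 0 < η) (H : ℝ) :
    ∫ y in (-H)..H, η / (η ^ 2 + y ^ 2) ≤ 4 := by
  have hder : ∀ y ∈ uIcc (-H) H, HasDerivAt (fun y : ℝ => Real.arctan (y / η)) (η / (η ^ 2 + y ^ 2)) y := by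
    intro y _
    have h1 : HasDerivAt (fun y : ℝ => y / η) (1 / η) y := (hasDerivAt_id y).div_const η
    convert h1.arctan using 1
    field_simp
  have hc : Continuous fun y : ℝ => η / (η ^ 2 + y ^ 2) :=
    continuous_const.div (continuous_const.add (continuous_id.pow 2)) fun y => by positivity
  rw [intervalIntegral.integral_eq_sub_of_hasDerivAt hder (hc.intervalIntegrable _ _)]
  have h1 := Real.arctan_lt_pi_div_two (H / η)
  have h2 := Real.neg_pi_div_two_lt_arctan (-H / η)
  linarith [Real.pi_lt_four]

lemma poisson_le_three_mul {η u v t : ℝ} (hη : 0 < η) (h : |t - v| ≤ η) :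
    η / (η ^ 2 + (u - t) ^ 2) ≤ 3 * (η / (η ^ 2 + (u - v) ^ 2)) := by
  have h1 : (t - v) ^ 2 ≤ η ^ 2 := by rw [← sq_abs]; gcongr
  rw [← mul_div_assoc, div_le_div_iff₀ (by positivity) (by positivity)]
  have h2 : η ^ 2 + (u - v) ^ 2 ≤ 3 * (η ^ 2 + (u - t) ^ 2) := by
    nlinarith [sq_nonneg ((u - t) - (t - v)), sq_nonneg (u - t)]
  have := mul_le_mul_of_nonneg_left h2 hη.le
  linarith

/-- Summation over points lying in consecutive short intervals of a local Poisson average bound. -/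
lemma sum_mul_le_of_local {P : Finset ℂ} {m w : ℂ → ℝ} {g : ℝ → ℝ} {U η H D E : ℝ}
    (hU : 0 ≤ U) (hη : 0 < η) (hη1 : η ≤ 1) (hH : 0 ≤ H) (hD : 0 ≤ D) (hE : 0 ≤ E) (hm : ∀ ρ, 0 ≤ m ρ)
    (hP : ∀ ρ ∈ P, U < ρ.im ∧ ρ.im ≤ 2 * U)
    (hg : ContinuousOn g (Icc (U - H - 1) (2 * U + H + 2))) (hg0 : ∀ y, 0 ≤ g y)
    (hloc : ∀ Q ⊆ P, ∀ ρ₀ ∈ Q, (∀ ρ ∈ Q, |ρ.im - ρ₀.im| ≤ η) →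
      (∑ ρ ∈ Q, m ρ) * w ρ₀ ≤
        D * ((∫ y in (ρ₀.im - H)..(ρ₀.im + H), g y * (η / (η ^ 2 + (y - ρ₀.im) ^ 2))) + E)) :
    ∑ ρ ∈ P, m ρ * w ρ ≤
      D * (12 / η * (∫ y in (U - H - 1)..(2 * U + H + 2), g y) + (U / η + 1) * E) := by
  set k : ℝ → ℝ := fun w => η / (η ^ 2 + w ^ 2) with hk
  have hkc : Continuous k :=
    continuous_const.div (continuous_const.add (continuous_id.pow 2)) fun y => by positivity
  have hk0 : ∀ y, 0 ≤ k y := fun y => by simp only [hk]; positivity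
  have hg' : ContinuousOn g (Icc (U - (H + 1)) (2 * U + 1 + (H + 1))) := by
    convert hg using 2 <;> ring
  obtain ⟨hΦc, hΦi⟩ := integral_conv_le (A := U) (B := 2 * U + 1) (H := H + 1) (K := 4) (by linarith)
    (by linarith) hg' hg0 hkc hk0 (integral_poisson_le hη _)
  rw [show U - (H + 1) = U - H - 1 by ring, show 2 * U + 1 + (H + 1) = 2 * U + H + 2 by ring] at hΦi
  set Φ : ℝ → ℝ := fun t => ∫ y in (t - (H + 1))..(t + (H + 1)), g y * k (y - t) with hΦ
  have hΦ0 : ∀ t, 0 ≤ Φ t := fun t =>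
    intervalIntegral.integral_nonneg (by linarith) fun y _ => mul_nonneg (hg0 y) (hk0 _)
  set n : ℕ := ⌊U / η⌋₊ + 1 with hn
  have hnU : (n : ℝ) ≤ U / η + 1 := by
    rw [hn]; push_cast; linarith [Nat.floor_le (div_nonneg hU hη.le)]
  have hnη : n * η ≤ U + 1 := by
    have := mul_le_mul_of_nonneg_right hnU hη.le
    rw [add_mul, div_mul_cancel₀ _ hη.ne'] at this
    linarith
  set p : ℕ → ℝ := fun j => U + j * η with hp
  have hpm : ∀ j, p j ≤ p (j + 1) := fun j => by simp only [hp]; push_cast; linarith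
  have hpd : ∀ j, p (j + 1) - p j = η := fun j => by simp only [hp]; push_cast; ring
  have hpU : ∀ j, U ≤ p j := fun j => by simp only [hp]; have : 0 ≤ (j : ℝ) * η := by positivity
                                         linarith
  have hpn : ∀ j, j < n → p (j + 1) ≤ 2 * U + 1 := fun j hj => by
    have h1 : ((j + 1 : ℕ) : ℝ) ≤ n := by exact_mod_cast hj
    have h2 := mul_le_mul_of_nonneg_right h1 hη.le
    simp only [hp]; linarith
  have hΦint : ∀ j < n, IntervalIntegrable Φ volume (p j) (p (j + 1)) := fun j hj => by
    refine ContinuousOn.intervalIntegrable (hΦc.mono ?_)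
    rw [uIcc_of_le (hpm j)]
    exact Icc_subset_Icc (hpU j) (hpn j hj)
  set idx : ℂ → ℕ := fun ρ => ⌊(ρ.im - U) / η⌋₊ with hidx
  have hmaps : ∀ ρ ∈ P, idx ρ ∈ Finset.range n := by
    intro ρ hρ
    rw [Finset.mem_range, hn, Nat.lt_succ_iff]
    refine Nat.floor_le_floor (div_le_div_of_nonneg_right ?_ hη.le)
    linarith [(hP ρ hρ).2]
  have hmem : ∀ j, ∀ ρ ∈ P.filter (fun ρ => idx ρ = j), p j ≤ ρ.im ∧ ρ.im ≤ p (j + 1) := by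
    intro j ρ hρ
    obtain ⟨h1, h2⟩ := Finset.mem_filter.mp hρ
    have h3 : 0 ≤ (ρ.im - U) / η := div_nonneg (by linarith [(hP ρ h1).1]) hη.le
    have h4 := Nat.floor_le h3
    have h5 := Nat.lt_floor_add_one ((ρ.im - U) / η)
    simp only [hidx] at h2
    rw [h2] at h4 h5
    rw [le_div_iff₀ hη] at h4
    rw [div_lt_iff₀ hη] at h5
    simp only [hp]; push_cast
    constructor <;> linarith
  have hblock : ∀ j < n, ∑ ρ ∈ P.filter (fun ρ => idx ρ = j), m ρ * w ρ ≤
      D * (3 / η * (∫ v in (p j)..(p (j + 1)), Φ v) + E) := by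
    intro j hj
    rcases (P.filter (fun ρ => idx ρ = j)).eq_empty_or_nonempty with h | h
    · rw [h, Finset.sum_empty]
      have := intervalIntegral.integral_nonneg (μ := volume) (hpm j) fun v _ => hΦ0 v
      positivity
    obtain ⟨ρ₀, hρ₀, hmax⟩ := Finset.exists_max_image _ w h
    have h1 : ∑ ρ ∈ P.filter (fun ρ => idx ρ = j), m ρ * w ρ ≤
        (∑ ρ ∈ P.filter (fun ρ => idx ρ = j), m ρ) * w ρ₀ := by
      rw [Finset.sum_mul]
      exact Finset.sum_le_sum fun ρ hρ => mul_le_mul_of_nonneg_left (hmax ρ hρ) (hm ρ)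
    have h0 := hmem j ρ₀ hρ₀
    have h2 := hloc _ (Finset.filter_subset _ P) ρ₀ hρ₀ fun ρ hρ => by
      have h3 := hmem j ρ hρ
      rw [abs_le]; constructor <;> linarith [hpd j]
    refine h1.trans (h2.trans (mul_le_mul_of_nonneg_left ?_ hD))
    refine add_le_add ?_ le_rfl
    set t := ρ₀.im with ht
    set I₀ := ∫ y in (t - H)..(t + H), g y * (η / (η ^ 2 + (y - t) ^ 2)) with hI₀
    have h4 : ∀ v ∈ Icc (p j) (p (j + 1)), I₀ ≤ 3 * Φ v := by
      intro v hv
      have htv : |t - v| ≤ η := by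
        rw [abs_le]; constructor <;> linarith [hpd j, hv.1, hv.2]
      obtain ⟨htv1, htv2⟩ := abs_le.mp htv
      have hvU : U ≤ v := (hpU j).trans hv.1
      have hvU2 : v ≤ 2 * U + 1 := hv.2.trans (hpn j hj)
      have hvsub : Icc (v - (H + 1)) (v + (H + 1)) ⊆ Icc (U - H - 1) (2 * U + H + 2) :=
        Icc_subset_Icc (by linarith) (by linarith)
      have htsub : Icc (t - H) (t + H) ⊆ Icc (v - (H + 1)) (v + (H + 1)) :=
        Icc_subset_Icc (by linarith) (by linarith)
      have ic : ∀ x, ContinuousOn (fun y => g y * k (y - x)) (Icc (v - (H + 1)) (v + (H + 1))) := fun x =>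
        (hg.mono hvsub).mul (hkc.comp (continuous_id.sub continuous_const)).continuousOn
      have iv : IntervalIntegrable (fun y => g y * k (y - v)) volume (v - (H + 1)) (v + (H + 1)) :=
        ContinuousOn.intervalIntegrable (by rw [uIcc_of_le (by linarith)]; exact ic v)
      have iv' : IntervalIntegrable (fun y => g y * k (y - v)) volume (t - H) (t + H) :=
        ContinuousOn.intervalIntegrable (by rw [uIcc_of_le (by linarith)]; exact (ic v).mono htsub)
      have it : IntervalIntegrable (fun y => g y * k (y - t)) volume (t - H) (t + H) :=
        ContinuousOn.intervalIntegrable (by rw [uIcc_of_le (by linarith)]; exact (ic t).mono htsub)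
      have h5 : I₀ ≤ ∫ y in (t - H)..(t + H), 3 * (g y * k (y - v)) := by
        refine intervalIntegral.integral_mono_on (by linarith) it (iv'.const_mul 3) fun y _ => ?_
        have := mul_le_mul_of_nonneg_left (poisson_le_three_mul (u := y) hη htv) (hg0 y)
        simp only [hk]; linarith
      rw [intervalIntegral.integral_const_mul] at h5
      have h6 : ∫ y in (t - H)..(t + H), g y * k (y - v) ≤ Φ v :=
        intervalIntegral.integral_mono_interval (by linarith) (by linarith) (by linarith)
          (Eventually.of_forall fun y => mul_nonneg (hg0 y) (hk0 _)) iv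
      linarith
    have h7 := intervalIntegral.integral_mono_on (hpm j) (intervalIntegrable_const (μ := volume) (c := I₀))
      ((hΦint j hj).const_mul 3) h4
    rw [intervalIntegral.integral_const, hpd, intervalIntegral.integral_const_mul, smul_eq_mul] at h7
    rw [div_mul_eq_mul_div, le_div_iff₀ hη]
    linarith
  have hsum : ∑ j ∈ Finset.range n, ∫ v in (p j)..(p (j + 1)), Φ v = ∫ v in (p 0)..(p n), Φ v :=
    intervalIntegral.sum_integral_adjacent_intervals hΦint
  have hlast : ∫ v in (p 0)..(p n), Φ v ≤ ∫ v in U..(2 * U + 1), Φ v := by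
    refine intervalIntegral.integral_mono_interval ?_ ?_ ?_ (Eventually.of_forall hΦ0)
      (ContinuousOn.intervalIntegrable (by rw [uIcc_of_le (by linarith)]; exact hΦc))
    · simp [hp]
    · simp only [hp]; push_cast; have : 0 ≤ (n : ℝ) * η := by positivity
      linarith
    · simp only [hp]; linarith
  rw [← Finset.sum_fiberwise_of_maps_to hmaps]
  refine (Finset.sum_le_sum fun j hj => hblock j (Finset.mem_range.mp hj)).trans ?_
  rw [← Finset.mul_sum, Finset.sum_add_distrib, ← Finset.mul_sum, hsum, Finset.sum_const,
    Finset.card_range, nsmul_eq_mul]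
  refine mul_le_mul_of_nonneg_left (add_le_add ?_ (mul_le_mul_of_nonneg_right hnU hE)) hD
  have h8 := mul_le_mul_of_nonneg_left (hlast.trans hΦi) (by positivity : 0 ≤ 3 / η)
  refine h8.trans (le_of_eq ?_)
  ring

lemma exists_mul_log_add_le (K : ℝ) : ∃ L₀, 1 ≤ L₀ ∧ ∀ L, L₀ ≤ L → K * Real.log L + 1 ≤ L / 4 := by
  have h1 : (fun L : ℝ => K * Real.log L + 1) =o[atTop] (fun L : ℝ => L) :=
    (Real.isLittleO_log_id_atTop.const_mul_left K).add (Asymptotics.isLittleO_const_id_atTop 1)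
  obtain ⟨L₀, h⟩ := eventually_atTop.mp (h1.bound (by norm_num : (0 : ℝ) < 1 / 4))
  refine ⟨max L₀ 1, le_max_right _ _, fun L hL => ?_⟩
  have h2 := h L ((le_max_left _ _).trans hL)
  have h3 : 1 ≤ L := (le_max_right _ _).trans hL
  rw [Real.norm_eq_abs, Real.norm_of_nonneg (by linarith)] at h2
  linarith [le_abs_self (K * Real.log L + 1)]

lemma exp_log_sub_sq_le_one {c U : ℝ} (hU : 1 ≤ U) (hc : 0 ≤ c) (h : 16 * c ≤ U) :
    Real.exp (c * Real.log U) * Real.exp (-(U / 4) ^ 2) ≤ 1 := by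
  rw [← Real.exp_add, Real.exp_le_one_iff]
  have h1 : Real.log U ≤ U := (Real.log_le_sub_one_of_pos (by linarith)).trans (by linarith)
  have h2 := mul_le_mul_of_nonneg_left h1 hc
  nlinarith

set_option maxHeartbeats 1000000 in
/-- The contribution to the sum of `|ζ(1/2+iγ)|²` of the zeros close to the critical line. -/
lemma exists_near_sum_le (K : ℝ) (hK : 1 ≤ K) : ∃ C U₀, 0 < C ∧ ∀ U, U₀ ≤ U → ∀ P : Finset ℂ,
    (∀ ρ ∈ P, riemannZeta ρ = 0 ∧ 1 / 2 < ρ.re ∧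
      ρ.re ≤ 1 / 2 + K * Real.log (Real.log U) / Real.log U ∧ U < ρ.im ∧ ρ.im ≤ 2 * U) →
    ∑ ρ ∈ P, (zetaOrder ρ : ℝ) * ‖riemannZeta (1 / 2 + ρ.im * I)‖ ^ 2 ≤
      C * (U * Real.log U ^ 2 * Real.log (Real.log U)) := by
  obtain ⟨C₁, hC₁, hcount⟩ := exists_sum_zetaOrder_le
  obtain ⟨Cz, hCz, hz⟩ := exists_norm_riemannZeta_le
  obtain ⟨C₂, hC₂, hmom⟩ := exists_second_moment_le
  obtain ⟨L₀, -, hL₀⟩ := exists_mul_log_add_le K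
  set c := 2 * C₁ with hc
  have hc1 : 1 ≤ c := by linarith
  set p := 5 * c * K with hp
  have hp0 : 0 ≤ p := by positivity
  set E := 8 * Real.exp (5 * c) + 405 * Cz ^ 2 * (Real.exp p + 1) with hE
  have hE0 : 0 < E := by positivity
  refine ⟨(K + 1) * (2 * Real.exp 7 * Real.exp p) * (12 * C₂ + 2 * E),
    max (Real.exp 9) (max (Real.exp L₀) (16 * (4 + 2 * c))), by positivity, fun U hU P hP => ?_⟩
  have hU9 : Real.exp 9 ≤ U := (le_max_left _ _).trans hU
  have hUL : Real.exp L₀ ≤ U := ((le_max_left _ _).trans (le_max_right _ _)).trans hU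
  have hUc : 16 * (4 + 2 * c) ≤ U := ((le_max_right _ _).trans (le_max_right _ _)).trans hU
  have hU0 : 0 < U := (Real.exp_pos 9).trans_le hU9
  have hU96 : 96 ≤ U := by linarith
  set L := Real.log U with hL
  have hL9 : 9 ≤ L := (Real.le_log_iff_exp_le hU0).mpr hU9
  have hLL0 : L₀ ≤ L := (Real.le_log_iff_exp_le hU0).mpr hUL
  set l := Real.log L with hl
  have hl1 : 1 ≤ l := by
    rw [hl, Real.le_log_iff_exp_le (by linarith)]
    linarith [Real.exp_one_lt_d9]
  have hlL : l ≤ L := (Real.log_le_sub_one_of_pos (by linarith)).trans (by linarith)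
  set η := 1 / L with hη
  have hη0 : 0 < η := by positivity
  have hη4 : η ≤ 1 / 9 := one_div_le_one_div_of_le (by norm_num) hL9
  set B := K * l + 1 with hB
  have hB1 : 1 ≤ B := by rw [hB]; have : 0 ≤ K * l := by positivity
                         linarith
  have hBη : B * η ≤ 1 / 4 := by
    rw [hη, mul_one_div, div_le_iff₀ (by linarith)]; linarith [hL₀ L hLL0]
  have hlog2 : Real.log (2 * U) ≤ 2 * L := by
    rw [Real.log_mul (by norm_num) hU0.ne']; linarith [Real.log_two_lt_d9]
  have hexpL : Real.exp L = U := Real.exp_log hU0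
  have hB' : B * η * L = B := by rw [hη]; field_simp
  have hDE := sum_mul_le_of_local (P := P) (m := fun ρ => (zetaOrder ρ : ℝ))
    (w := fun ρ => ‖riemannZeta (1 / 2 + ρ.im * I)‖ ^ 2)
    (g := fun y => ‖riemannZeta ((1 / 2 - η : ℝ) + y * I)‖ ^ 2) (U := U) (η := η) (H := U / 4)
    (D := B * (2 * Real.exp 7 * Real.exp p)) (E := E) hU0.le hη0 (by linarith) (by linarith)
    (by positivity) hE0.le (fun ρ => Nat.cast_nonneg _) (fun ρ hρ => (hP ρ hρ).2.2.2)
    ((continuousOn_norm_comp_vert _ fun y hy => differentiableAt_riemannZeta fun h => by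
      have := congrArg Complex.im h; simp at this; linarith [hy.1]).pow 2)
    (fun y => by positivity) ?_
  · set J := ∫ y in (U - U / 4 - 1)..(2 * U + U / 4 + 2),
      ‖riemannZeta ((1 / 2 - η : ℝ) + y * I)‖ ^ 2 with hJ
    have hJ1 : J ≤ C₂ * (U * L) := by
      refine le_trans ?_ (hmom U (1 / 2 - η) hU9 ?_)
      · refine intervalIntegral.integral_mono_interval (by linarith) (by linarith) (by linarith)
          (Eventually.of_forall fun y => by positivity) (ContinuousOn.intervalIntegrable ?_)
        rw [uIcc_of_le (by linarith)]
        exact (continuousOn_norm_comp_vert _ fun y hy => differentiableAt_riemannZeta fun h => by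
          have := congrArg Complex.im h; simp at this; linarith [hy.1]).pow 2
      · rw [show (1 : ℝ) / 2 - η - 1 / 2 = -η by ring, abs_neg, abs_of_pos hη0, hη]
        gcongr; norm_num
    refine hDE.trans ?_
    have e1 : 12 / η * J ≤ 12 * C₂ * (U * L ^ 2) := by
      rw [show 12 / η = 12 * L by rw [hη]; field_simp]
      calc 12 * L * J ≤ 12 * L * (C₂ * (U * L)) := by gcongr
        _ = _ := by ring
    have e2 : (U / η + 1) * E ≤ 2 * E * (U * L ^ 2) := by
      rw [show U / η = U * L by rw [hη]; field_simp]
      have h1 : U * L ≤ U * L ^ 2 := by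
        rw [sq]; exact mul_le_mul_of_nonneg_left (by nlinarith) hU0.le
      have h2 : 1 ≤ U * L := by nlinarith
      have := mul_le_mul_of_nonneg_right (add_le_add h1 (h2.trans h1)) hE0.le
      linarith
    have e3 : B ≤ (K + 1) * l := by rw [hB]; linarith
    calc _ ≤ (K + 1) * l * (2 * Real.exp 7 * Real.exp p) * (12 * C₂ * (U * L ^ 2) + 2 * E * (U * L ^ 2)) := by
          refine mul_le_mul (mul_le_mul_of_nonneg_right e3 (by positivity)) (add_le_add e1 e2) ?_ (by positivity)
          have : 0 ≤ J := intervalIntegral.integral_nonneg (by linarith) fun y _ => by positivity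
          positivity
      _ = _ := by ring
  intro Q hQ ρ₀ hρ₀ hclose
  set t := ρ₀.im with ht
  obtain ⟨-, -, -, ht1, ht2⟩ := hP ρ₀ (hQ hρ₀)
  set N := ∑ ρ ∈ Q, (zetaOrder ρ : ℝ) with hN
  have hNle : N ≤ c * L := by
    have h1 := hcount (t - η) (by linarith) Q fun ρ hρ => by
      obtain ⟨h1, h2, -, -, -⟩ := hP ρ (hQ hρ)
      have h3 := abs_le.mp (hclose ρ hρ)
      exact ⟨h1, h2.le, by linarith, by linarith⟩
    have h2 : Real.log (t - η) ≤ 2 * L :=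
      (Real.log_le_log (by linarith) (by linarith)).trans hlog2
    have h3 := mul_le_mul_of_nonneg_left h2 (by linarith : 0 ≤ C₁)
    rw [hN, hc]; linarith
  have hMb : ∀ x y : ℝ, 1 / 2 - η ≤ x → x ≤ 2 → 1 ≤ y → y ≤ 3 * U →
      ‖riemannZeta (x + y * I)‖ ^ 2 ≤ (Cz * (3 * U) ^ 2) ^ 2 := by
    intro x y h1 h2 h3 h4
    have h5 := hz x y (by linarith) (by linarith) (by rw [abs_of_pos (by linarith)]; exact h3)
    rw [abs_of_pos (by linarith)] at h5
    refine pow_le_pow_left₀ (norm_nonneg _) (h5.trans ?_) 2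
    gcongr
  have hmain := sum_zetaOrder_mul_le (P := Q) (η := η) (B := B) (t := t) (H := U / 4)
    (q := Real.exp (-p * l)) (M := (Cz * (3 * U) ^ 2) ^ 2) hη0 hB1 hBη (by linarith) (by linarith)
    (Real.exp_pos _) (fun ρ hρ => by
      obtain ⟨-, h2, h3, -, -⟩ := hP ρ (hQ hρ)
      refine ⟨h2, h3.trans (le_of_eq ?_), hclose ρ hρ⟩
      rw [hB, hη]; ring)
    (fun x h1 h2 => hMb x _ h1 h2 (by linarith) (by linarith))
    (fun x h1 h2 => hMb x _ h1 h2 (by linarith) (by linarith))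
  rw [← hN] at hmain
  have hq1 : Real.exp (-p * l) ^ (-η) ≤ Real.exp p := by
    rw [← Real.exp_mul]
    apply Real.exp_le_exp.mpr
    have : l * η ≤ 1 := by rw [hη, mul_one_div, div_le_one (by linarith)]; exact hlL
    calc -p * l * -η = p * (l * η) := by ring
      _ ≤ p * 1 := by gcongr
      _ = p := mul_one p
  have hpl : 0 ≤ p * l := by positivity
  have hq2 : Real.exp (-p * l) ^ (3 / 2 : ℝ) ≤ Real.exp (-p * l) := by
    rw [← Real.exp_mul]
    apply Real.exp_le_exp.mpr
    linarith
  have hq3 : Real.exp (-p * l) ≤ 1 := Real.exp_le_one_iff.mpr (by linarith)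
  have hBN : B * η * N ≤ c * B := by
    calc B * η * N ≤ B * η * (c * L) := by gcongr
      _ = c * (B * η * L) := by ring
      _ = c * B := by rw [hB']
  have f1 : Real.exp (-p * l) ^ (3 / 2 : ℝ) * Real.exp (5 * (B * η) * N) ≤ Real.exp (5 * c) := by
    calc _ ≤ Real.exp (-p * l) * Real.exp (5 * (c * B)) := by
          refine mul_le_mul hq2 (Real.exp_le_exp.mpr (by linarith)) (Real.exp_pos _).le (Real.exp_pos _).le
      _ = _ := by rw [← Real.exp_add]; congr 1; rw [hp, hB]; ring
  have f2 : (Cz * (3 * U) ^ 2) ^ 2 * Real.exp (7 * (B * η) * N) * Real.exp (-(U / 4) ^ 2) ≤ 81 * Cz ^ 2 := by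
    have g1 : Real.exp (7 * (B * η) * N) ≤ Real.exp (2 * c * L) := by
      apply Real.exp_le_exp.mpr
      have h0 : 0 ≤ N := Finset.sum_nonneg fun ρ _ => Nat.cast_nonneg _
      have h1 := mul_le_mul_of_nonneg_right hBη h0
      linarith
    have g2 : U ^ 4 = Real.exp (4 * L) := by
      rw [show (4 : ℝ) * L = ((4 : ℕ) : ℝ) * L by norm_num, Real.exp_nat_mul, hexpL]
    calc _ = 81 * Cz ^ 2 * (U ^ 4 * Real.exp (7 * (B * η) * N) * Real.exp (-(U / 4) ^ 2)) := by ring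
      _ ≤ 81 * Cz ^ 2 * (U ^ 4 * Real.exp (2 * c * L) * Real.exp (-(U / 4) ^ 2)) := by gcongr
      _ = 81 * Cz ^ 2 * (Real.exp ((4 + 2 * c) * L) * Real.exp (-(U / 4) ^ 2)) := by
          rw [g2, ← Real.exp_add, ← add_mul]
      _ ≤ 81 * Cz ^ 2 * 1 :=
          mul_le_mul_of_nonneg_left (exp_log_sub_sq_le_one (by linarith) (by linarith) hUc) (by positivity)
      _ = _ := mul_one _
  refine hmain.trans ?_
  have e : ∫ y in (t - U / 4)..(t + U / 4),
      ‖riemannZeta ((1 / 2 - η : ℝ) + y * I)‖ ^ 2 * (2 * η / (η ^ 2 + (y - t) ^ 2)) =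
      2 * ∫ y in (t - U / 4)..(t + U / 4),
      ‖riemannZeta ((1 / 2 - η : ℝ) + y * I)‖ ^ 2 * (η / (η ^ 2 + (y - t) ^ 2)) := by
    rw [← intervalIntegral.integral_const_mul]
    congr 1; ext y; ring
  rw [e]
  set J := ∫ y in (t - U / 4)..(t + U / 4),
      ‖riemannZeta ((1 / 2 - η : ℝ) + y * I)‖ ^ 2 * (η / (η ^ 2 + (y - t) ^ 2)) with hJ
  have hJ0 : 0 ≤ J := intervalIntegral.integral_nonneg (by linarith) fun y _ => by positivity
  have i1 := mul_le_mul_of_nonneg_right hq1 (by linarith : 0 ≤ 2 * J)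
  have i3 := mul_le_mul f2 (add_le_add hq1 (hq2.trans hq3)) (by positivity) (by positivity)
  have hep : 1 ≤ Real.exp p := Real.one_le_exp hp0
  have i4 : E ≤ 2 * Real.exp p * E := by nlinarith
  calc _ ≤ B * Real.exp 7 * (2 * Real.exp p * J + E) := by
        refine mul_le_mul_of_nonneg_left ?_ (by positivity)
        rw [hE]
        generalize Real.exp (-p * l) ^ (-η) = A1 at *
        generalize Real.exp (-p * l) ^ (3 / 2 : ℝ) = A2 at *
        linarith
    _ ≤ B * Real.exp 7 * (2 * Real.exp p * J + 2 * Real.exp p * E) := by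
        refine mul_le_mul_of_nonneg_left (by linarith) (by positivity)
    _ = _ := by ring

/-- The truncated Dirichlet series of `1/ζ`. -/
def moebiusPoly (N : ℕ) : ℂ → ℂ := dirPoly (fun n => (ArithmeticFunction.moebius n : ℝ)) N

lemma abs_moebius_cast_le_one (n : ℕ) : |(ArithmeticFunction.moebius n : ℝ)| ≤ 1 := by
  exact_mod_cast ArithmeticFunction.abs_moebius_le_one

lemma norm_moebiusPoly_le (N : ℕ) {z : ℂ} (hz : 0 ≤ z.re) : ‖moebiusPoly N z‖ ≤ N := by
  unfold moebiusPoly dirPoly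
  refine (norm_sum_le _ _).trans ?_
  have : ∀ n ∈ Finset.Icc 1 N,
      ‖(((ArithmeticFunction.moebius n : ℝ)) : ℂ) * (n : ℂ) ^ (-z)‖ ≤ 1 := by
    intro n hn
    have hn1 := (Finset.mem_Icc.mp hn).1
    rw [norm_mul, norm_nat_cpow_neg (by omega), Complex.norm_real, Real.norm_eq_abs]
    refine mul_le_one₀ (abs_moebius_cast_le_one n) (by positivity) ?_
    exact Real.rpow_le_one_of_one_le_of_nonpos (by exact_mod_cast hn1) (by linarith)
  refine (Finset.sum_le_sum this).trans ?_
  simp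

lemma norm_riemannZeta_mul_moebiusPoly_sub_one_le {N : ℕ} (hN : N ≠ 0) {z : ℂ} (hz : z.re = 2) :
    ‖riemannZeta z * moebiusPoly N z - 1‖ ≤ 2 / N := by
  have hz1 : 1 < z.re := by rw [hz]; norm_num
  set f : ℕ → ℂ := fun n => (ArithmeticFunction.moebius n : ℂ) with hf
  have hs : Summable (LSeries.term f z) := ArithmeticFunction.LSeriesSummable_moebius_iff.mpr hz1
  have h1 : riemannZeta z * LSeries f z = 1 := by
    rw [← LSeries_one_eq_riemannZeta hz1]; exact LSeries_one_mul_Lseries_moebius hz1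
  have hterm : ∀ n : ℕ, LSeries.term f z n = f n * (n : ℂ) ^ (-z) := fun n =>
    LSeries.term_def₀ (by simp [hf]) z n
  have h2 : LSeries f z = moebiusPoly N z + ∑' n, LSeries.term f z (n + (N + 1)) := by
    rw [LSeries, ← hs.sum_add_tsum_nat_add (N + 1)]
    congr 1
    unfold moebiusPoly dirPoly
    rw [Finset.range_eq_Ico, Finset.sum_eq_sum_Ico_succ_bot (by omega), hterm 0]
    have : f 0 = 0 := by simp [hf]
    rw [this, zero_mul, zero_add]
    refine Finset.sum_congr rfl fun n _ => ?_
    rw [hterm]; simp [hf]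
  have hb : ∀ n : ℕ, ‖LSeries.term f z (n + (N + 1))‖ ≤ (((n + (N + 1) : ℕ) : ℝ) ^ 2)⁻¹ := by
    intro n
    have hn : n + (N + 1) ≠ 0 := by omega
    rw [hterm, norm_mul, norm_nat_cpow_neg hn, hz, Real.rpow_neg (by positivity)]
    have h3 : ‖f (n + (N + 1))‖ ≤ 1 := by
      have := abs_moebius_cast_le_one (n + (N + 1))
      rw [← Real.norm_eq_abs, ← Complex.norm_real] at this
      simpa [hf] using this
    have h4 : ((n + (N + 1) : ℕ) : ℝ) ^ (2 : ℝ) = ((n + (N + 1) : ℕ) : ℝ) ^ 2 := by norm_cast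
    rw [h4]
    exact mul_le_of_le_one_left (by positivity) h3
  have hs2 : Summable fun n => ‖LSeries.term f z (n + (N + 1))‖ :=
    ((summable_nat_add_iff (N + 1)).mpr hs).norm
  have ht : ‖∑' n, LSeries.term f z (n + (N + 1))‖ ≤ 1 / N := by
    refine (norm_tsum_le_tsum_norm hs2).trans ?_
    refine Real.tsum_le_of_sum_range_le (fun n => norm_nonneg _) fun m => ?_
    refine (Finset.sum_le_sum fun n _ => hb n).trans ?_
    have h5 := sum_Ioc_inv_sq_le_sub (α := ℝ) hN (Nat.le_add_left N m)
    have h6 : ∑ n ∈ Finset.range m, (((n + (N + 1) : ℕ) : ℝ) ^ 2)⁻¹ =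
        ∑ i ∈ Finset.Ioc N (m + N), ((i : ℝ) ^ 2)⁻¹ := by
      rw [Finset.range_eq_Ico, Finset.sum_Ico_add' (fun i : ℕ => ((i : ℝ) ^ 2)⁻¹) 0 m (N + 1)]
      congr 1
      ext i; simp only [Finset.mem_Ico, Finset.mem_Ioc]; omega
    rw [h6, one_div]
    refine h5.trans ?_
    have : (0 : ℝ) ≤ ((m + N : ℕ) : ℝ)⁻¹ := by positivity
    linarith
  have h7 : riemannZeta z * moebiusPoly N z - 1 =
      -(riemannZeta z * ∑' n, LSeries.term f z (n + (N + 1))) := by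
    rw [h2] at h1; linear_combination h1
  rw [h7, norm_neg, norm_mul]
  calc _ ≤ 2 * (1 / N : ℝ) := mul_le_mul (norm_riemannZeta_le_two hz.ge) ht (norm_nonneg _) (by norm_num)
    _ = _ := by ring

lemma integral_norm_sq_moebiusPoly_le {U : ℝ} (hU : Real.exp 9 ≤ U) :
    ∫ t in (U / 2)..(4 * U), ‖moebiusPoly ⌊U⌋₊ ((1 / 2 - 1 / Real.log U : ℝ) + t * I)‖ ^ 2 ≤
      40 * Real.exp 3 * (U * Real.log U ^ 2) := by
  have hU0 : 0 < U := (Real.exp_pos 9).trans_le hU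
  set L := Real.log U with hL
  have hL9 : 9 ≤ L := (Real.le_log_iff_exp_le hU0).mpr hU
  have hU1 : 1 ≤ U := by linarith [Real.add_one_le_exp (9 : ℝ)]
  set N := ⌊U⌋₊ with hN
  have hNU : (N : ℝ) ≤ U := Nat.floor_le hU0.le
  have hN1 : 1 ≤ N := Nat.one_le_floor_iff _ |>.mpr hU1
  have hlN : Real.log N ≤ L := Real.log_le_log (by exact_mod_cast hN1) hNU
  have hlN0 : 0 ≤ Real.log N := Real.log_natCast_nonneg N
  have h1 := integral_norm_sq_dirPoly_le (fun n => (ArithmeticFunction.moebius n : ℝ)) N (1 / 2 - 1 / L)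
    (by linarith : U / 2 ≤ 4 * U)
  have hV : ∑ n ∈ Finset.Icc 1 N, (ArithmeticFunction.moebius n : ℝ) ^ 2 * (n : ℝ) ^ (-1 - 1 / L) ≤ 1 + L := by
    have h2 := sum_rpow_neg_le (κ := 1 / L) (by positivity) (by rw [div_le_one (by linarith)]; linarith) N
    rw [one_div_one_div] at h2
    refine le_trans (Finset.sum_le_sum fun n _ => ?_) h2
    refine mul_le_of_le_one_left (by positivity) ?_
    rw [← sq_abs]
    exact pow_le_one₀ (abs_nonneg _) (abs_moebius_cast_le_one n)
  have h3 := sum_sq_rpow_le (x := 1 / 2 - 1 / L) (E := Real.exp 3) hV (Real.exp_pos 3).le fun n hn => by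
    obtain ⟨hn1, hn2⟩ := Finset.mem_Icc.mp hn
    have hn0 : (0 : ℝ) < n := by exact_mod_cast hn1
    rw [Real.rpow_def_of_pos hn0]
    apply Real.exp_le_exp.mpr
    have h4 : Real.log n ≤ L := Real.log_le_log hn0 ((by exact_mod_cast hn2 : (n : ℝ) ≤ N).trans hNU)
    calc Real.log n * (1 + 1 / L - 2 * (1 / 2 - 1 / L)) = Real.log n * (3 / L) := by ring
      _ ≤ L * (3 / L) := mul_le_mul_of_nonneg_right h4 (by positivity)
      _ = 3 := by field_simp
  refine h1.trans ?_
  have h5 : 4 * U - U / 2 + 8 * N * (1 + Real.log N) ≤ 20 * (U * L) := by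
    have : (N : ℝ) * (1 + Real.log N) ≤ U * (1 + L) :=
      mul_le_mul hNU (by linarith) (by linarith) hU0.le
    nlinarith
  calc _ ≤ 20 * (U * L) * (Real.exp 3 * (1 + L)) := by
        refine mul_le_mul h5 h3 (Finset.sum_nonneg fun n _ => by positivity) (by positivity)
    _ ≤ 20 * (U * L) * (Real.exp 3 * (2 * L)) := by
        refine mul_le_mul_of_nonneg_left (mul_le_mul_of_nonneg_left (by linarith) (Real.exp_pos 3).le)
          (by positivity)
    _ = _ := by ring

lemma norm_le_of_gaussian_cauchy_poisson {G : ℂ → ℂ} {a σ t H Y M δ A : ℝ} (hY : 0 < Y) (hδ : 0 < δ)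
    (ha : a + δ ≤ σ) (hσ : σ ≤ 1) (hab : -(1 / 2) ≤ a) (hH : 5 / 2 ≤ H)
    (hG : ∀ s : ℂ, a ≤ s.re → s.re ≤ 2 → t - H ≤ s.im → s.im ≤ t + H → DifferentiableAt ℂ G s)
    (hM1 : ∀ x : ℝ, a ≤ x → x ≤ 2 → ‖G (x + (t - H : ℝ) * I)‖ ≤ M)
    (hM2 : ∀ x : ℝ, a ≤ x → x ≤ 2 → ‖G (x + (t + H : ℝ) * I)‖ ≤ M)
    (hA : ∀ y ∈ Icc (t - H) (t + H), ‖G ((2 : ℝ) + y * I)‖ ≤ A) :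
    ‖G (σ + t * I)‖ ≤ Real.exp 7 * (
      Y ^ (a - σ) / δ * (∫ y in (t - H)..(t + H), ‖G (a + y * I)‖ * (1 / (1 ^ 2 + (y - t) ^ 2))) +
      2 * A * Y ^ (2 - σ) + 5 * M * (Y ^ (a - σ) + Y ^ (2 - σ)) * Real.exp (-H ^ 2)) := by
  have htt : t - H ≤ t + H := by linarith
  have hA0 : 0 ≤ A := (norm_nonneg _).trans (hA t ⟨by linarith, by linarith⟩)
  have key := norm_le_of_gaussian_cauchy (b := 2) hY (by linarith : a < σ) (by linarith) (by linarith) hH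
    hG hM1 hM2
  have hec : Continuous fun y : ℝ => Real.exp (-(y - t) ^ 2) :=
    Real.continuous_exp.comp (((continuous_id.sub continuous_const).pow 2).neg)
  have hnc : Continuous fun y : ℝ => ‖(a + y * I : ℂ) - (σ + t * I)‖ :=
    ((continuous_const.add (continuous_ofReal.mul continuous_const)).sub continuous_const).norm
  have hnp : ∀ y : ℝ, δ ≤ ‖(a + y * I : ℂ) - (σ + t * I)‖ := fun y => by
    refine le_trans ?_ (Complex.abs_re_le_norm _)
    simp only [sub_re, add_re, ofReal_re, mul_re, I_re, mul_zero, ofReal_im, I_im, mul_one, sub_self, add_zero]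
    rw [abs_sub_comm]
    exact le_trans (by linarith) (le_abs_self _)
  have hGa : ContinuousOn (fun y : ℝ => ‖G (a + y * I)‖) (Icc (t - H) (t + H)) :=
    continuousOn_norm_comp_vert a fun y hy =>
      hG _ (by simp) (by simp; linarith) (by simpa using hy.1) (by simpa using hy.2)
  have hG2 : ContinuousOn (fun y : ℝ => ‖G ((2 : ℝ) + y * I)‖) (Icc (t - H) (t + H)) :=
    continuousOn_norm_comp_vert 2 fun y hy =>
      hG _ (by simp; linarith) (by simp) (by simpa using hy.1) (by simpa using hy.2)
  have hk : ∀ y : ℝ, (0 : ℝ) < 1 ^ 2 + (y - t) ^ 2 := fun y => by positivity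
  have h1 : ∫ y in (t - H)..(t + H), ‖G (a + y * I)‖ * Real.exp (-(y - t) ^ 2) /
      ‖(a + y * I : ℂ) - (σ + t * I)‖ ≤
      1 / δ * ∫ y in (t - H)..(t + H), ‖G (a + y * I)‖ * (1 / (1 ^ 2 + (y - t) ^ 2)) := by
    rw [← intervalIntegral.integral_const_mul]
    refine intervalIntegral.integral_mono_on htt ?_ ?_ fun y hy => ?_
    · refine ContinuousOn.intervalIntegrable ?_
      rw [uIcc_of_le htt]
      exact (hGa.mul hec.continuousOn).div hnc.continuousOn fun y _ => (hδ.trans_le (hnp y)).ne'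
    · refine ContinuousOn.intervalIntegrable ?_
      rw [uIcc_of_le htt]
      exact continuousOn_const.mul (hGa.mul (Continuous.continuousOn (continuous_const.div
        (continuous_const.add ((continuous_id.sub continuous_const).pow 2)) fun y => (hk y).ne')))
    · have e1 : Real.exp (-(y - t) ^ 2) ≤ 1 / (1 ^ 2 + (y - t) ^ 2) := by
        rw [Real.exp_neg, ← one_div]
        exact one_div_le_one_div_of_le (hk y) (by linarith [Real.add_one_le_exp ((y - t) ^ 2)])
      have e2 := one_div_le_one_div_of_le hδ (hnp y)
      calc _ = 1 / ‖(a + y * I : ℂ) - (σ + t * I)‖ * (‖G (a + y * I)‖ * Real.exp (-(y - t) ^ 2)) := by ring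
        _ ≤ _ := mul_le_mul e2 (mul_le_mul_of_nonneg_left e1 (norm_nonneg _)) (by positivity) (by positivity)
  have h2 : ∫ y in (t - H)..(t + H), ‖G ((2 : ℝ) + y * I)‖ * Real.exp (-(y - t) ^ 2) ≤ A * 2 := by
    have h3 : ∫ y in (t - H)..(t + H), ‖G ((2 : ℝ) + y * I)‖ * Real.exp (-(y - t) ^ 2) ≤
        ∫ y in (t - H)..(t + H), A * Real.exp (-(y - t) ^ 2) := by
      refine intervalIntegral.integral_mono_on htt ?_ ((hec.intervalIntegrable _ _).const_mul _) fun y hy =>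
        mul_le_mul_of_nonneg_right (hA y hy) (Real.exp_pos _).le
      refine ContinuousOn.intervalIntegrable ?_
      rw [uIcc_of_le htt]
      exact hG2.mul hec.continuousOn
    rw [intervalIntegral.integral_const_mul] at h3
    exact h3.trans (mul_le_mul_of_nonneg_left (integral_exp_neg_sub_sq_le t (by linarith)) hA0)
  refine key.trans (mul_le_mul_of_nonneg_left ?_ (Real.exp_pos 7).le)
  have i1 := mul_le_mul_of_nonneg_left h1 (by positivity : 0 ≤ Y ^ (a - σ))
  have i2 : Y ^ (2 - σ) / (2 - σ) ≤ Y ^ (2 - σ) := div_le_self (by positivity) (by linarith)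
  have i3 := mul_le_mul i2 h2 (intervalIntegral.integral_nonneg htt fun y _ => by positivity) (by positivity)
  refine add_le_add (add_le_add (i1.trans (le_of_eq (by ring))) (i3.trans (le_of_eq (by ring)))) le_rfl

lemma exists_norm_zeta_le_pow : ∃ C, 1 ≤ C ∧ ∀ U x y : ℝ, 1 ≤ U → -(1 / 2) ≤ x → x ≤ 2 → 1 ≤ y →
    y ≤ 3 * U → ‖riemannZeta (x + y * I)‖ ≤ C * U ^ 2 := by
  obtain ⟨C, hC, h⟩ := exists_norm_riemannZeta_le
  refine ⟨9 * C, by linarith, fun U x y hU hx hx2 hy hy2 => ?_⟩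
  have h5 := h x y hx (by linarith) (by rw [abs_of_pos (by linarith)]; exact hy)
  rw [abs_of_pos (by linarith)] at h5
  refine h5.trans ?_
  calc C * y ^ 2 ≤ C * (3 * U) ^ 2 := by gcongr
    _ = _ := by ring

lemma pow_mul_exp_neg_sq_le {U : ℝ} (n : ℕ) (hU : 1 ≤ U) (h : 16 * (n : ℝ) ≤ U) :
    U ^ n * Real.exp (-(U / 4) ^ 2) ≤ 1 := by
  have h1 := exp_log_sub_sq_le_one hU (Nat.cast_nonneg n) h
  rwa [Real.exp_nat_mul, Real.exp_log (by linarith)] at h1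

lemma exists_norm_pow_four_le : ∃ C, 0 < C ∧ ∀ U t : ℝ, Real.exp 9 ≤ U → U ≤ t → t ≤ 2 * U →
    ‖riemannZeta (1 / 2 + t * I)‖ ^ 4 ≤ C * Real.log U * ((∫ y in (t - U / 4)..(t + U / 4),
      ‖riemannZeta ((1 / 2 - 1 / Real.log U : ℝ) + y * I)‖ ^ 4 * (1 / (1 ^ 2 + (y - t) ^ 2))) + 1) := by
  obtain ⟨Cz, hCz, hz⟩ := exists_norm_zeta_le_pow
  refine ⟨Real.exp 7 * (33 + 10 * Cz ^ 4), by positivity, fun U t hU ht1 ht2 => ?_⟩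
  have hU0 : 0 < U := (Real.exp_pos 9).trans_le hU
  have hU128 : 128 ≤ U := by
    have h1 : (2 : ℝ) ≤ Real.exp 1 := by linarith [Real.add_one_le_exp (1 : ℝ)]
    have h2 := pow_le_pow_left₀ (by norm_num) h1 9
    rw [← Real.exp_nat_mul] at h2
    norm_num at h2
    linarith
  set L := Real.log U with hL
  have hL9 : 9 ≤ L := (Real.le_log_iff_exp_le hU0).mpr hU
  have hη : 1 / L ≤ 1 / 9 := one_div_le_one_div_of_le (by norm_num) hL9
  have hη0 : 0 < 1 / L := by positivity
  have hb : ∀ x y : ℝ, 1 / 2 - 1 / L ≤ x → x ≤ 2 → 1 ≤ y → y ≤ 3 * U →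
      ‖riemannZeta (x + y * I) ^ 4‖ ≤ (Cz * U ^ 2) ^ 4 := fun x y h1 h2 h3 h4 => by
    rw [norm_pow]
    exact pow_le_pow_left₀ (norm_nonneg _) (hz U x y (by linarith) (by linarith) h2 h3 h4) 4
  have key := norm_le_of_gaussian_cauchy_poisson (G := fun s => riemannZeta s ^ 4) (a := 1 / 2 - 1 / L)
    (σ := 1 / 2) (t := t) (H := U / 4) (Y := 1) (M := (Cz * U ^ 2) ^ 4) (δ := 1 / L) (A := 16)
    one_pos hη0 (by linarith) (by norm_num) (by linarith) (by linarith)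
    (fun s _ _ h3 _ => (differentiableAt_riemannZeta fun h => by
      rw [h] at h3; norm_num at h3; linarith).pow 4)
    (fun x h1 h2 => hb x _ h1 h2 (by linarith) (by linarith))
    (fun x h1 h2 => hb x _ h1 h2 (by linarith) (by linarith))
    (fun y _ => by
      rw [norm_pow]
      have := pow_le_pow_left₀ (norm_nonneg _)
        (norm_riemannZeta_le_two (z := ((2 : ℝ) : ℂ) + y * I) (by simp)) 4
      linarith)
  simp only [norm_pow, Real.one_rpow] at key
  rw [show (((1 / 2 : ℝ) : ℂ)) = 1 / 2 by norm_num] at key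
  refine key.trans ?_
  set J := ∫ y in (t - U / 4)..(t + U / 4),
      ‖riemannZeta ((1 / 2 - 1 / L : ℝ) + y * I)‖ ^ 4 * (1 / (1 ^ 2 + (y - t) ^ 2)) with hJ
  have hJ0 : 0 ≤ J := intervalIntegral.integral_nonneg (by linarith) fun y _ => by positivity
  have h1 := mul_le_mul_of_nonneg_left (pow_mul_exp_neg_sq_le 8 (by linarith) (by norm_num; linarith) :
    U ^ 8 * Real.exp (-(U / 4) ^ 2) ≤ 1) (by positivity : 0 ≤ 10 * Cz ^ 4)
  rw [one_div_one_div, mul_assoc (Real.exp 7), mul_assoc (Real.exp 7)]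
  refine mul_le_mul_of_nonneg_left ?_ (Real.exp_pos 7).le
  have hc : 33 ≤ 33 + 10 * Cz ^ 4 := by linarith [show 0 ≤ 10 * Cz ^ 4 by positivity]
  have h3 : (33 + 10 * Cz ^ 4) * 1 ≤ (33 + 10 * Cz ^ 4) * L := by gcongr; linarith
  have h4 : 33 * (L * J) ≤ (33 + 10 * Cz ^ 4) * (L * J) :=
    mul_le_mul_of_nonneg_right hc (by positivity)
  have h5 : 0 ≤ L * J := by positivity
  calc _ = L * J + 32 + 10 * Cz ^ 4 * (U ^ 8 * Real.exp (-(U / 4) ^ 2)) := by ring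
    _ ≤ (33 + 10 * Cz ^ 4) * (L * J) + (33 + 10 * Cz ^ 4) * L := by linarith
    _ = _ := by ring

/-- At a zero far from the critical line the function `ζ M - 1` has modulus one, which forces its
local average to the left of the critical line to be large. -/
lemma exists_one_le_of_far : ∃ U₀, ∀ U, U₀ ≤ U → ∀ ρ : ℂ, riemannZeta ρ = 0 →
    1 / 2 + 82 * Real.log (Real.log U) / Real.log U ≤ ρ.re → U < ρ.im → ρ.im ≤ 2 * U →
    1 ≤ 2 * Real.exp 7 * (Real.log U ^ 40)⁻¹ * ∫ y in (ρ.im - U / 4)..(ρ.im + U / 4),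
      ‖riemannZeta ((1 / 2 - 1 / Real.log U : ℝ) + y * I) *
        moebiusPoly ⌊U⌋₊ ((1 / 2 - 1 / Real.log U : ℝ) + y * I) - 1‖ * (1 / (1 ^ 2 + (y - ρ.im) ^ 2)) := by
  obtain ⟨Cz, hCz, hz⟩ := exists_norm_zeta_le_pow
  refine ⟨max (Real.exp 44) (80 * Cz * Real.exp 7), fun U hU ρ hρ0 hρ hρ1 hρ2 => ?_⟩
  have hU44 : Real.exp 44 ≤ U := (le_max_left _ _).trans hU
  have hUz : 80 * Cz * Real.exp 7 ≤ U := (le_max_right _ _).trans hU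
  have hU0 : 0 < U := (Real.exp_pos 44).trans_le hU44
  have he7 : 1 ≤ Real.exp 7 := Real.one_le_exp (by norm_num)
  have hU80 : 80 ≤ U := by nlinarith
  set L := Real.log U with hL
  have hL44 : 44 ≤ L := (Real.le_log_iff_exp_le hU0).mpr hU44
  have hexpL : Real.exp L = U := Real.exp_log hU0
  have hη : 1 / L ≤ 1 / 9 := one_div_le_one_div_of_le (by norm_num) (by linarith)
  have hη0 : 0 < 1 / L := by positivity
  set l := Real.log L with hl
  have hl0 : 0 ≤ l := Real.log_nonneg (by linarith)
  have hl1 : 1 ≤ l := by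
    rw [hl, Real.le_log_iff_exp_le (by linarith)]
    linarith [Real.exp_one_lt_d9]
  have hre1 : ρ.re < 1 := by
    by_contra h
    exact riemannZeta_ne_zero_of_one_le_re (not_lt.mp h) hρ0
  set N := ⌊U⌋₊ with hN
  have hNU : (N : ℝ) ≤ U := Nat.floor_le hU0.le
  have hNU2 : U / 2 ≤ N := by have := Nat.lt_floor_add_one U; rw [← hN] at this; linarith
  have hN0 : N ≠ 0 := by rintro h; rw [h] at hNU2; norm_num at hNU2; linarith
  set a := 1 / 2 - 1 / L with ha
  set t := ρ.im with ht
  set F : ℂ → ℂ := fun s => riemannZeta s * moebiusPoly N s - 1 with hF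
  have hη' : 1 / L ≤ 82 * l / L := by gcongr; linarith
  have hb : ∀ x y : ℝ, a ≤ x → x ≤ 2 → 1 ≤ y → y ≤ 3 * U → ‖F (x + y * I)‖ ≤ 2 * Cz * U ^ 3 := by
    intro x y h1 h2 h3 h4
    have e1 := hz U x y (by linarith) (by linarith) h2 h3 h4
    have e2 : ‖moebiusPoly N (x + y * I)‖ ≤ U :=
      (norm_moebiusPoly_le N (by simp; linarith)).trans hNU
    have e3 : 1 ≤ Cz * U ^ 3 := one_le_mul_of_one_le_of_one_le hCz (one_le_pow₀ (by linarith))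
    calc ‖F (x + y * I)‖ ≤ ‖riemannZeta (x + y * I)‖ * ‖moebiusPoly N (x + y * I)‖ + 1 := by
          rw [← norm_mul, ← norm_one (α := ℂ)]; exact norm_sub_le _ _
      _ ≤ (Cz * U ^ 2) * U + 1 := add_le_add (mul_le_mul e1 e2 (norm_nonneg _) (by positivity)) le_rfl
      _ ≤ _ := by linarith
  have key := norm_le_of_gaussian_cauchy_poisson (G := F) (a := a)
    (σ := ρ.re) (t := t) (H := U / 4) (Y := Real.exp (L / 2)) (M := 2 * Cz * U ^ 3) (δ := 1 / L) (A := 4 / U)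
    (Real.exp_pos _) hη0 (by linarith) hre1.le (by linarith) (by linarith)
    (fun s _ _ h3 _ => ((differentiableAt_riemannZeta fun h => by
      rw [h] at h3; norm_num at h3; linarith).mul (differentiable_dirPoly _ _ s)).sub_const 1)
    (fun x h1 h2 => hb x _ h1 h2 (by linarith) (by linarith))
    (fun x h1 h2 => hb x _ h1 h2 (by linarith) (by linarith))
    (fun y _ => by
      refine (norm_riemannZeta_mul_moebiusPoly_sub_one_le hN0 (by simp)).trans ?_
      rw [div_le_div_iff₀ (by linarith) hU0]; linarith)
  have hFρ : ‖F (ρ.re + t * I)‖ = 1 := by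
    rw [ht, Complex.re_add_im]; simp [hF, hρ0]
  rw [hFρ] at key
  set J := ∫ y in (t - U / 4)..(t + U / 4), ‖F (a + y * I)‖ * (1 / (1 ^ 2 + (y - t) ^ 2)) with hJ
  have hJ0 : 0 ≤ J := intervalIntegral.integral_nonneg (by linarith) fun y _ => by positivity
  have hY1 : Real.exp (L / 2) ^ (a - ρ.re) ≤ (L ^ 41)⁻¹ := by
    rw [← Real.exp_mul, show (L ^ 41)⁻¹ = Real.exp (-(((41 : ℕ) : ℝ) * l)) by
      rw [Real.exp_neg, Real.exp_nat_mul, Real.exp_log (by linarith)]]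
    apply Real.exp_le_exp.mpr
    have e1 : a - ρ.re ≤ -(82 * l / L) := by linarith
    calc L / 2 * (a - ρ.re) ≤ L / 2 * -(82 * l / L) := by gcongr
      _ = _ := by field_simp; norm_num
  have hY1' : Real.exp (L / 2) ^ (a - ρ.re) ≤ 1 :=
    hY1.trans (inv_le_one_of_one_le₀ (one_le_pow₀ (by linarith)))
  have hY2 : Real.exp (L / 2) ^ (2 - ρ.re) ≤ Real.exp (3 / 4 * L) := by
    rw [← Real.exp_mul]
    apply Real.exp_le_exp.mpr
    have : 2 - ρ.re ≤ 3 / 2 := by have : 0 < 82 * l / L := by positivity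
                                  linarith
    calc L / 2 * (2 - ρ.re) ≤ L / 2 * (3 / 2) := by gcongr
      _ = _ := by ring
  have hY2' : Real.exp (L / 2) ^ (2 - ρ.re) ≤ U :=
    hY2.trans ((Real.exp_le_exp.mpr (by linarith)).trans hexpL.le)
  have t1 : Real.exp (L / 2) ^ (a - ρ.re) / (1 / L) * J ≤ (L ^ 40)⁻¹ * J := by
    refine mul_le_mul_of_nonneg_right ?_ hJ0
    rw [div_div_eq_mul_div, div_one]
    calc _ ≤ (L ^ 41)⁻¹ * L := mul_le_mul_of_nonneg_right hY1 (by linarith)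
      _ = _ := by field_simp
  have t2 : Real.exp 7 * (2 * (4 / U) * Real.exp (L / 2) ^ (2 - ρ.re)) ≤ 1 / 4 := by
    calc _ ≤ Real.exp 7 * (2 * (4 / U) * Real.exp (3 / 4 * L)) := by gcongr
      _ = 8 * (Real.exp 7 * Real.exp (3 / 4 * L) / Real.exp L) := by rw [hexpL]; ring
      _ = 8 * Real.exp (7 - L / 4) := by
          rw [← Real.exp_add, ← Real.exp_sub]; congr 2; ring
      _ ≤ 8 * Real.exp (-4) := by gcongr; linarith
      _ ≤ 1 / 4 := by
          have h1 : (2.7 : ℝ) ≤ Real.exp 1 := by linarith [Real.exp_one_gt_d9]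
          have h2 := pow_le_pow_left₀ (by norm_num) h1 4
          rw [← Real.exp_nat_mul] at h2
          have h3 : 32 ≤ Real.exp 4 := by norm_num at h2; linarith
          rw [Real.exp_neg, ← div_eq_mul_inv, div_le_div_iff₀ (by linarith) (by norm_num)]
          linarith
  have t3 : Real.exp 7 * (5 * (2 * Cz * U ^ 3) *
      (Real.exp (L / 2) ^ (a - ρ.re) + Real.exp (L / 2) ^ (2 - ρ.re)) * Real.exp (-(U / 4) ^ 2)) ≤ 1 / 4 := by
    have h1 := pow_mul_exp_neg_sq_le 5 (by linarith) (by norm_num; linarith : 16 * ((5 : ℕ) : ℝ) ≤ U)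
    calc _ ≤ Real.exp 7 * (5 * (2 * Cz * U ^ 3) * (2 * U) * Real.exp (-(U / 4) ^ 2)) := by
          refine mul_le_mul_of_nonneg_left (mul_le_mul_of_nonneg_right (mul_le_mul_of_nonneg_left ?_
            (by positivity)) (Real.exp_pos _).le) (Real.exp_pos _).le
          linarith
      _ = 20 * Cz * Real.exp 7 / U * (U ^ 5 * Real.exp (-(U / 4) ^ 2)) := by field_simp; norm_num
      _ ≤ 20 * Cz * Real.exp 7 / U * 1 := mul_le_mul_of_nonneg_left h1 (by positivity)
      _ ≤ 1 / 4 := by rw [mul_one, div_le_div_iff₀ hU0 (by norm_num)]; linarith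
  have t1' := mul_le_mul_of_nonneg_left t1 (Real.exp_pos 7).le
  have : 1 ≤ Real.exp 7 * ((L ^ 40)⁻¹ * J) + 1 / 4 + 1 / 4 := by
    rw [mul_add, mul_add] at key
    linarith
  linarith

set_option maxHeartbeats 1000000 in
/-- The contribution to the sum of `|ζ(1/2+iγ)|²` of the zeros far from the critical line. -/
lemma exists_far_sum_le : ∃ C U₀, 0 < C ∧ ∀ U, U₀ ≤ U → ∀ P : Finset ℂ,
    (∀ ρ ∈ P, riemannZeta ρ = 0 ∧
      1 / 2 + 82 * Real.log (Real.log U) / Real.log U ≤ ρ.re ∧ U < ρ.im ∧ ρ.im ≤ 2 * U) →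
    ∑ ρ ∈ P, (zetaOrder ρ : ℝ) * ‖riemannZeta (1 / 2 + ρ.im * I)‖ ^ 2 ≤ C * U := by
  obtain ⟨C₁, hC₁, hcount⟩ := exists_sum_zetaOrder_le
  obtain ⟨C₄, hC₄, hfour⟩ := exists_norm_pow_four_le
  obtain ⟨C₂, hC₂, hmom⟩ := exists_fourth_moment_le
  obtain ⟨U₁, hU₁⟩ := exists_one_le_of_far
  set c := 2 * C₁ * (C₄ + 2 * Real.exp 7) with hc
  have hc0 : 0 < c := by positivity
  refine ⟨c * (12 * (C₂ + 40 * Real.exp 3 + 7) + 2), max (Real.exp 9) U₁, by positivity, fun U hU P hP => ?_⟩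
  have hU9 : Real.exp 9 ≤ U := (le_max_left _ _).trans hU
  have hUU₁ : U₁ ≤ U := (le_max_right _ _).trans hU
  have hU0 : 0 < U := (Real.exp_pos 9).trans_le hU9
  have hU96 : 96 ≤ U := by
    have h1 : (2 : ℝ) ≤ Real.exp 1 := by linarith [Real.add_one_le_exp (1 : ℝ)]
    have h2 := pow_le_pow_left₀ (by norm_num) h1 9
    rw [← Real.exp_nat_mul] at h2
    norm_num at h2
    linarith
  set L := Real.log U with hL
  have hL9 : 9 ≤ L := (Real.le_log_iff_exp_le hU0).mpr hU9
  have hlog2 : Real.log (2 * U) ≤ 2 * L := by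
    rw [Real.log_mul (by norm_num) hU0.ne']; linarith [Real.log_two_lt_d9]
  set a := 1 / 2 - 1 / L with ha
  set N := ⌊U⌋₊ with hN
  have hcz : ∀ {A B : ℝ}, 0 < A → ContinuousOn (fun y : ℝ => ‖riemannZeta (a + y * I)‖) (Icc A B) :=
    fun hA => continuousOn_norm_comp_vert _ fun y hy => differentiableAt_riemannZeta fun h => by
      have := congrArg Complex.im h; simp at this; linarith [hy.1]
  have hcm : ∀ {A B : ℝ}, ContinuousOn (fun y : ℝ => ‖moebiusPoly N (a + y * I)‖) (Icc A B) :=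
    continuousOn_norm_comp_vert _ fun y hy => differentiable_dirPoly _ _ _
  set g : ℝ → ℝ := fun y => ‖riemannZeta (a + y * I)‖ ^ 4 + ‖moebiusPoly N (a + y * I)‖ ^ 2 + 2 with hg
  have hgc : ∀ {A B : ℝ}, 0 < A → ContinuousOn g (Icc A B) := fun hA =>
    (((hcz hA).pow 4).add (hcm.pow 2)).add continuousOn_const
  have hg0 : ∀ y, 0 ≤ g y := fun y => by simp only [hg]; positivity
  have hDE := sum_mul_le_of_local (P := P) (m := fun ρ => (zetaOrder ρ : ℝ))
    (w := fun ρ => ‖riemannZeta (1 / 2 + ρ.im * I)‖ ^ 2)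
    (g := g) (U := U) (η := 1) (H := U / 4)
    (D := c * (L ^ 9)⁻¹) (E := 1) hU0.le one_pos le_rfl (by linarith)
    (by positivity) one_pos.le (fun ρ => Nat.cast_nonneg _) (fun ρ hρ => (hP ρ hρ).2.2)
    (hgc (by linarith)) hg0 ?_
  · have hgi : ∫ y in (U - U / 4 - 1)..(2 * U + U / 4 + 2), g y ≤ (C₂ + 40 * Real.exp 3 + 7) * (U * L ^ 9) := by
      have h1 : ∫ y in (U - U / 4 - 1)..(2 * U + U / 4 + 2), g y ≤ ∫ y in (U / 2)..(4 * U), g y := by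
        refine intervalIntegral.integral_mono_interval (by linarith) (by linarith) (by linarith)
          (Eventually.of_forall hg0) (ContinuousOn.intervalIntegrable ?_)
        rw [uIcc_of_le (by linarith)]
        exact hgc (by linarith)
      have i1 : IntervalIntegrable (fun y : ℝ => ‖riemannZeta (a + y * I)‖ ^ 4) volume (U / 2) (4 * U) :=
        ContinuousOn.intervalIntegrable (by rw [uIcc_of_le (by linarith)]; exact (hcz (by linarith)).pow 4)
      have i2 : IntervalIntegrable (fun y : ℝ => ‖moebiusPoly N (a + y * I)‖ ^ 2) volume (U / 2) (4 * U) :=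
        ContinuousOn.intervalIntegrable (by rw [uIcc_of_le (by linarith)]; exact hcm.pow 2)
      have h2 : ∫ y in (U / 2)..(4 * U), g y = (∫ y in (U / 2)..(4 * U), ‖riemannZeta (a + y * I)‖ ^ 4) +
          (∫ y in (U / 2)..(4 * U), ‖moebiusPoly N (a + y * I)‖ ^ 2) + (4 * U - U / 2) * 2 := by
        rw [hg, intervalIntegral.integral_add (i1.add i2) intervalIntegrable_const,
          intervalIntegral.integral_add i1 i2, intervalIntegral.integral_const, smul_eq_mul]
      have h3 := hmom U a hU9 (by
        rw [show a - 1 / 2 = -(1 / L) by rw [ha]; ring, abs_neg, abs_of_pos (by positivity)]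
        gcongr; norm_num)
      have h4 := integral_norm_sq_moebiusPoly_le hU9
      have h5 : L ^ 2 ≤ L ^ 9 := pow_le_pow_right₀ (by linarith) (by norm_num)
      have h6 : U * L ^ 2 ≤ U * L ^ 9 := by gcongr
      have h7 : U * 1 ≤ U * L ^ 9 := by gcongr; exact one_le_pow₀ (by linarith)
      have h8 : 40 * Real.exp 3 * (U * L ^ 2) ≤ 40 * Real.exp 3 * (U * L ^ 9) := by gcongr
      rw [h2] at h1
      linarith
    refine hDE.trans ?_
    rw [div_one, div_one, mul_one]
    have h9 : U + 1 ≤ 2 * (U * L ^ 9) := by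
      have h7 : U * 1 ≤ U * L ^ 9 := by gcongr; exact one_le_pow₀ (by linarith)
      linarith
    calc _ ≤ c * (L ^ 9)⁻¹ * (12 * ((C₂ + 40 * Real.exp 3 + 7) * (U * L ^ 9)) + 2 * (U * L ^ 9)) := by
          refine mul_le_mul_of_nonneg_left (add_le_add (mul_le_mul_of_nonneg_left hgi (by norm_num)) h9)
            (by positivity)
      _ = _ := by field_simp
  intro Q hQ ρ₀ hρ₀ hclose
  set t := ρ₀.im with ht
  obtain ⟨hz0, hfar, ht1, ht2⟩ := hP ρ₀ (hQ hρ₀)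
  have hl0 : 0 ≤ 82 * Real.log L / L := by
    have := Real.log_nonneg (by linarith : 1 ≤ L)
    positivity
  have hcnt : ∀ s : ℝ, U - 1 ≤ s → s ≤ 2 * U → ∀ R ⊆ Q, (∀ ρ ∈ R, s ≤ ρ.im ∧ ρ.im ≤ s + 1) →
      ∑ ρ ∈ R, (zetaOrder ρ : ℝ) ≤ C₁ * (2 * L) := by
    intro s hs hs2 R hR hR2
    refine (hcount s (by linarith) R fun ρ hρ => ?_).trans ?_
    · obtain ⟨h1, h2, -, -⟩ := hP ρ (hQ (hR hρ))
      exact ⟨h1, by linarith, hR2 ρ hρ⟩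
    · exact mul_le_mul_of_nonneg_left ((Real.log_le_log (by linarith) hs2).trans hlog2) (by linarith)
  have hNle : ∑ ρ ∈ Q, (zetaOrder ρ : ℝ) ≤ 4 * C₁ * L := by
    rw [← Finset.sum_filter_add_sum_filter_not Q (fun ρ => ρ.im ≤ t)]
    have h1 := hcnt (t - 1) (by linarith) (by linarith) (Q.filter fun ρ => ρ.im ≤ t)
      (Finset.filter_subset _ _) fun ρ hρ => by
        obtain ⟨h1, h2⟩ := Finset.mem_filter.mp hρ
        have := abs_le.mp (hclose ρ h1)
        constructor <;> linarith
    have h2 := hcnt t (by linarith) (by linarith) (Q.filter fun ρ => ¬ ρ.im ≤ t)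
      (Finset.filter_subset _ _) fun ρ hρ => by
        obtain ⟨h1, h2⟩ := Finset.mem_filter.mp hρ
        have := abs_le.mp (hclose ρ h1)
        constructor <;> linarith
    linarith
  set W := ‖riemannZeta (1 / 2 + t * I)‖ with hW
  have hfarle := hU₁ U hUU₁ ρ₀ hz0 hfar ht1 ht2
  rw [← hL, ← ha, ← ht, ← hN] at hfarle
  have hfourle := hfour U t hU9 ht1.le ht2
  rw [← hL, ← ha, ← hW] at hfourle
  set J := ∫ y in (t - U / 4)..(t + U / 4), g y * (1 / (1 ^ 2 + (y - t) ^ 2)) with hJ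
  have hk : ∀ y : ℝ, (0 : ℝ) < 1 ^ 2 + (y - t) ^ 2 := fun y => by positivity
  have hkc : Continuous fun y : ℝ => (1 : ℝ) / (1 ^ 2 + (y - t) ^ 2) := continuous_const.div
    (continuous_const.add ((continuous_id.sub continuous_const).pow 2)) fun y => (hk y).ne'
  have htt : t - U / 4 ≤ t + U / 4 := by linarith
  have hmonoJ : ∀ h : ℝ → ℝ, ContinuousOn h (Icc (t - U / 4) (t + U / 4)) → (∀ y, h y ≤ g y) →
      ∫ y in (t - U / 4)..(t + U / 4), h y * (1 / (1 ^ 2 + (y - t) ^ 2)) ≤ J := by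
    intro h hh hle
    refine intervalIntegral.integral_mono_on htt ?_ ?_ fun y _ =>
      mul_le_mul_of_nonneg_right (hle y) (by have := hk y; positivity)
    · refine ContinuousOn.intervalIntegrable ?_
      rw [uIcc_of_le htt]; exact hh.mul hkc.continuousOn
    · refine ContinuousOn.intervalIntegrable ?_
      rw [uIcc_of_le htt]; exact (hgc (by linarith)).mul hkc.continuousOn
  have j1 := hmonoJ _ ((hcz (by linarith)).pow 4) fun y => by
    simp only [hg, Pi.pow_apply]; linarith [sq_nonneg ‖moebiusPoly N (a + y * I)‖]
  have j2 := hmonoJ (fun y => ‖riemannZeta (a + y * I) * moebiusPoly N (a + y * I) - 1‖)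
    (continuousOn_norm_comp_vert (F := fun s => riemannZeta s * moebiusPoly N s - 1) a fun y hy =>
      ((differentiableAt_riemannZeta fun h => by
        have := congrArg Complex.im h; simp at this; linarith [hy.1]).mul
        (differentiable_dirPoly _ _ _)).sub_const 1) fun y => by
    simp only [hg]
    refine (norm_sub_le _ _).trans ?_
    rw [norm_mul, norm_one]
    set x := ‖riemannZeta (a + y * I)‖
    set z := ‖moebiusPoly N (a + y * I)‖
    have q1 : x * z ≤ x ^ 2 + z ^ 2 := by nlinarith [sq_nonneg (x - z), sq_nonneg (x + z)]
    have q2 : x ^ 2 ≤ x ^ 4 + 1 := by nlinarith [sq_nonneg (x ^ 2 - 1)]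
    linarith
  simp only [Pi.pow_apply] at j1
  have k1 : W ^ 4 ≤ C₄ * L * (J + 1) := hfourle.trans (by gcongr)
  have hJ0 : 0 ≤ J := intervalIntegral.integral_nonneg htt fun y _ =>
    mul_nonneg (hg0 y) (by have := hk y; positivity)
  have k2 : 1 ≤ 2 * Real.exp 7 * (L ^ 40)⁻¹ * (J + 1) :=
    hfarle.trans (mul_le_mul_of_nonneg_left (j2.trans (by linarith)) (by positivity))
  have k3 : W ^ 2 ≤ ((L ^ 20)⁻¹ * W ^ 4 + L ^ 20) / 2 := by
    have h1 : (L ^ 20)⁻¹ * L ^ 20 = 1 := by field_simp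
    have h2 := mul_nonneg (by positivity : 0 ≤ (L ^ 20)⁻¹) (sq_nonneg (W ^ 2 - L ^ 20))
    have h3 : (L ^ 20)⁻¹ * (W ^ 2 - L ^ 20) ^ 2 =
        (L ^ 20)⁻¹ * W ^ 4 - 2 * ((L ^ 20)⁻¹ * L ^ 20) * W ^ 2 + ((L ^ 20)⁻¹ * L ^ 20) * L ^ 20 := by ring
    rw [h3, h1] at h2
    linarith
  have k4 : W ^ 2 ≤ (C₄ + 2 * Real.exp 7) / 2 * (L ^ 10)⁻¹ * (J + 1) := by
    have m1 := mul_le_mul_of_nonneg_left k1 (by positivity : 0 ≤ (L ^ 20)⁻¹)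
    have m2 := mul_le_mul_of_nonneg_left k2 (by positivity : 0 ≤ L ^ 20)
    have m3 : (L ^ 20)⁻¹ * (C₄ * L * (J + 1)) = C₄ * (J + 1) * (L ^ 19)⁻¹ := by field_simp
    have m4 : L ^ 20 * (2 * Real.exp 7 * (L ^ 40)⁻¹ * (J + 1)) = 2 * Real.exp 7 * (J + 1) * (L ^ 20)⁻¹ := by
      field_simp
    have m5 : (L ^ 19)⁻¹ ≤ (L ^ 10)⁻¹ :=
      inv_anti₀ (by positivity) (pow_le_pow_right₀ (by linarith) (by norm_num))
    have m6 : (L ^ 20)⁻¹ ≤ (L ^ 10)⁻¹ :=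
      inv_anti₀ (by positivity) (pow_le_pow_right₀ (by linarith) (by norm_num))
    have m7 := mul_le_mul_of_nonneg_left m5 (by positivity : 0 ≤ C₄ * (J + 1))
    have m8 := mul_le_mul_of_nonneg_left m6 (by positivity : 0 ≤ 2 * Real.exp 7 * (J + 1))
    linarith
  calc _ ≤ 4 * C₁ * L * ((C₄ + 2 * Real.exp 7) / 2 * (L ^ 10)⁻¹ * (J + 1)) :=
        mul_le_mul hNle k4 (by positivity) (by positivity)
    _ = c * (L ^ 9)⁻¹ * (J + 1) := by rw [hc]; field_simp; ring

lemma exists_dyadic_sum_le : ∃ C U₀, 0 < C ∧ 3 ≤ U₀ ∧ ∀ U, U₀ ≤ U → ∀ P : Finset ℂ,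
    (∀ ρ ∈ P, riemannZeta ρ = 0 ∧ 1 / 2 < ρ.re ∧ U < ρ.im ∧ ρ.im ≤ 2 * U) →
    ∑ ρ ∈ P, (zetaOrder ρ : ℝ) * ‖riemannZeta (1 / 2 + ρ.im * I)‖ ^ 2 ≤
      C * (U * Real.log U ^ 2 * Real.log (Real.log U)) := by
  obtain ⟨C₁, U₁, hC₁, h₁⟩ := exists_near_sum_le 82 (by norm_num)
  obtain ⟨C₂, U₂, hC₂, h₂⟩ := exists_far_sum_le
  refine ⟨C₁ + C₂, max (Real.exp 9) (max U₁ U₂), by positivity, ?_, fun U hU P hP => ?_⟩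
  · exact le_trans (by linarith [Real.add_one_le_exp (9 : ℝ)]) (le_max_left _ _)
  have hU9 : Real.exp 9 ≤ U := (le_max_left _ _).trans hU
  have hUU₁ : U₁ ≤ U := ((le_max_left _ _).trans (le_max_right _ _)).trans hU
  have hUU₂ : U₂ ≤ U := ((le_max_right _ _).trans (le_max_right _ _)).trans hU
  have hU0 : 0 < U := (Real.exp_pos 9).trans_le hU9
  have hL9 : 9 ≤ Real.log U := (Real.le_log_iff_exp_le hU0).mpr hU9
  have hl1 : 1 ≤ Real.log (Real.log U) := by
    rw [Real.le_log_iff_exp_le (by linarith)]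
    linarith [Real.exp_one_lt_d9]
  rw [← Finset.sum_filter_add_sum_filter_not P
    (fun ρ => ρ.re ≤ 1 / 2 + 82 * Real.log (Real.log U) / Real.log U)]
  have a1 := h₁ U hUU₁ (P.filter fun ρ => ρ.re ≤ 1 / 2 + 82 * Real.log (Real.log U) / Real.log U)
    fun ρ hρ => by
      obtain ⟨q1, q2⟩ := Finset.mem_filter.mp hρ
      obtain ⟨r1, r2, r3⟩ := hP ρ q1
      exact ⟨r1, r2, q2, r3⟩
  have a2 := h₂ U hUU₂ (P.filter fun ρ => ¬ ρ.re ≤ 1 / 2 + 82 * Real.log (Real.log U) / Real.log U)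
    fun ρ hρ => by
      obtain ⟨q1, q2⟩ := Finset.mem_filter.mp hρ
      obtain ⟨r1, r2, r3⟩ := hP ρ q1
      exact ⟨r1, (not_le.mp q2).le, r3⟩
  have a3 : U ≤ U * Real.log U ^ 2 * Real.log (Real.log U) := by
    rw [mul_assoc]
    refine le_mul_of_one_le_right hU0.le (one_le_mul_of_one_le_of_one_le (one_le_pow₀ (by linarith)) hl1)
  have a4 := mul_le_mul_of_nonneg_left a3 hC₂.le
  linarith

lemma log_log_three_pos : 0 < Real.log (Real.log 3) := by
  refine Real.log_pos ?_
  rw [Real.lt_log_iff_exp_lt (by norm_num)]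
  linarith [Real.exp_one_lt_d9]

lemma mul_log_sq_mul_log_log_mono {x y : ℝ} (hx : 3 ≤ x) (hxy : x ≤ y) :
    x * Real.log x ^ 2 * Real.log (Real.log x) ≤ y * Real.log y ^ 2 * Real.log (Real.log y) := by
  have h3 : 1 < Real.log 3 := by
    rw [Real.lt_log_iff_exp_lt (by norm_num)]; linarith [Real.exp_one_lt_d9]
  have h1 : Real.log 3 ≤ Real.log x := Real.log_le_log (by norm_num) hx
  have h2 : Real.log x ≤ Real.log y := Real.log_le_log (by linarith) hxy
  have h4 : Real.log (Real.log x) ≤ Real.log (Real.log y) := Real.log_le_log (by linarith) h2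
  have h5 : 0 ≤ Real.log (Real.log x) := Real.log_nonneg (by linarith)
  refine mul_le_mul (mul_le_mul hxy (pow_le_pow_left₀ (by linarith) h2 2) (by positivity) (by linarith))
    h4 h5 (by have : 0 ≤ y := by linarith
              positivity)

lemma log_sq_mul_log_log_half_le {T : ℝ} (hT : 6 ≤ T) :
    T / 2 * Real.log (T / 2) ^ 2 * Real.log (Real.log (T / 2)) ≤
      T * Real.log T ^ 2 * Real.log (Real.log T) / 2 := by
  have h3 : 1 < Real.log 3 := by
    rw [Real.lt_log_iff_exp_lt (by norm_num)]; linarith [Real.exp_one_lt_d9]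
  have h1 : Real.log 3 ≤ Real.log (T / 2) := Real.log_le_log (by norm_num) (by linarith)
  have h2 : Real.log (T / 2) ≤ Real.log T := Real.log_le_log (by linarith) (by linarith)
  have h4 : Real.log (Real.log (T / 2)) ≤ Real.log (Real.log T) := Real.log_le_log (by linarith) h2
  have h5 : 0 ≤ Real.log (Real.log (T / 2)) := Real.log_nonneg (by linarith)
  have h6 := mul_le_mul (pow_le_pow_left₀ (by linarith) h2 2) h4 h5 (by positivity)
  have h7 := mul_le_mul_of_nonneg_left h6 (by linarith : 0 ≤ T / 2)
  linarith

/-- The sum of `|ζ(1/2+iγ)|²` over the zeros to the right of the critical line. -/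
lemma exists_off_sum_le : ∃ C, 0 < C ∧ ∀ T, 3 ≤ T → ∀ P : Finset ℂ,
    (∀ ρ ∈ P, riemannZeta ρ = 0 ∧ 1 / 2 < ρ.re ∧ 1 < ρ.im ∧ ρ.im ≤ T) →
    ∑ ρ ∈ P, (zetaOrder ρ : ℝ) * ‖riemannZeta (1 / 2 + ρ.im * I)‖ ^ 2 ≤
      C * (T * Real.log T ^ 2 * Real.log (Real.log T)) := by
  obtain ⟨C₀, U₀, hC₀, hU₀, hdy⟩ := exists_dyadic_sum_le
  have hbig : ∀ n : ℕ, ∀ T, U₀ ≤ T → T ≤ 2 ^ (n + 1) * U₀ → ∀ P : Finset ℂ,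
      (∀ ρ ∈ P, riemannZeta ρ = 0 ∧ 1 / 2 < ρ.re ∧ U₀ < ρ.im ∧ ρ.im ≤ T) →
      ∑ ρ ∈ P, (zetaOrder ρ : ℝ) * ‖riemannZeta (1 / 2 + ρ.im * I)‖ ^ 2 ≤
        C₀ * (T * Real.log T ^ 2 * Real.log (Real.log T)) := by
    intro n
    have hbase : ∀ T, U₀ ≤ T → T ≤ 2 * U₀ → ∀ P : Finset ℂ,
        (∀ ρ ∈ P, riemannZeta ρ = 0 ∧ 1 / 2 < ρ.re ∧ U₀ < ρ.im ∧ ρ.im ≤ T) →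
        ∑ ρ ∈ P, (zetaOrder ρ : ℝ) * ‖riemannZeta (1 / 2 + ρ.im * I)‖ ^ 2 ≤
          C₀ * (T * Real.log T ^ 2 * Real.log (Real.log T)) := by
      intro T hT1 hT2 P hP
      refine (hdy U₀ le_rfl P fun ρ hρ => ?_).trans
        (mul_le_mul_of_nonneg_left (mul_log_sq_mul_log_log_mono hU₀ hT1) hC₀.le)
      obtain ⟨r1, r2, r3, r4⟩ := hP ρ hρ
      exact ⟨r1, r2, r3, by linarith⟩
    induction n with
    | zero => simpa using hbase
    | succ n ih =>
      intro T hT1 hT2 P hP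
      rcases le_or_gt T (2 * U₀) with h | h
      · exact hbase T hT1 h P hP
      rw [← Finset.sum_filter_add_sum_filter_not P (fun ρ => ρ.im ≤ T / 2)]
      have a1 := ih (T / 2) (by linarith) (by rw [pow_succ] at hT2; linarith) (P.filter fun ρ => ρ.im ≤ T / 2)
        fun ρ hρ => by
          obtain ⟨q1, q2⟩ := Finset.mem_filter.mp hρ
          obtain ⟨r1, r2, r3, r4⟩ := hP ρ q1
          exact ⟨r1, r2, r3, q2⟩
      have a2 := hdy (T / 2) (by linarith) (P.filter fun ρ => ¬ ρ.im ≤ T / 2) fun ρ hρ => by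
        obtain ⟨q1, q2⟩ := Finset.mem_filter.mp hρ
        obtain ⟨r1, r2, r3, r4⟩ := hP ρ q1
        exact ⟨r1, r2, not_le.mp q2, by linarith⟩
      have a3 := mul_le_mul_of_nonneg_left (log_sq_mul_log_log_half_le (by linarith : 6 ≤ T)) hC₀.le
      linarith
  have hfin : (Icc (0 : ℝ) 1 ×ℂ Icc (1 : ℝ) U₀ ∩ riemannZetaZeros).Finite :=
    IsCompact.inter_riemannZetaZeros_finite (isCompact_Icc.reProdIm isCompact_Icc)
  set C₁ := ∑ ρ ∈ hfin.toFinset, (zetaOrder ρ : ℝ) * ‖riemannZeta (1 / 2 + ρ.im * I)‖ ^ 2 with hC₁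
  have hC₁0 : 0 ≤ C₁ := Finset.sum_nonneg fun ρ _ => by positivity
  set X := 3 * Real.log 3 ^ 2 * Real.log (Real.log 3) with hX
  have hX0 : 0 < X := by
    have := log_log_three_pos
    have h3 : 0 < Real.log 3 := Real.log_pos (by norm_num)
    positivity
  refine ⟨C₀ + C₁ / X, by positivity, fun T hT P hP => ?_⟩
  have hXT : X ≤ T * Real.log T ^ 2 * Real.log (Real.log T) := mul_log_sq_mul_log_log_mono le_rfl hT
  set Y := T * Real.log T ^ 2 * Real.log (Real.log T) with hY
  rw [← Finset.sum_filter_add_sum_filter_not P (fun ρ => ρ.im ≤ U₀)]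
  have a1 : ∑ ρ ∈ P.filter (fun ρ => ρ.im ≤ U₀), (zetaOrder ρ : ℝ) * ‖riemannZeta (1 / 2 + ρ.im * I)‖ ^ 2 ≤
      C₁ := by
    refine Finset.sum_le_sum_of_subset_of_nonneg (fun ρ hρ => ?_) fun ρ _ _ => by positivity
    obtain ⟨q1, q2⟩ := Finset.mem_filter.mp hρ
    obtain ⟨r1, r2, r3, r4⟩ := hP ρ q1
    have hre1 : ρ.re < 1 := by
      by_contra h
      exact riemannZeta_ne_zero_of_one_le_re (not_lt.mp h) r1
    rw [hfin.mem_toFinset]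
    refine ⟨?_, r1⟩
    rw [Complex.mem_reProdIm]
    exact ⟨⟨by linarith, hre1.le⟩, r3.le, q2⟩
  have a2 : ∑ ρ ∈ P.filter (fun ρ => ¬ ρ.im ≤ U₀), (zetaOrder ρ : ℝ) * ‖riemannZeta (1 / 2 + ρ.im * I)‖ ^ 2 ≤
      C₀ * Y := by
    rcases le_or_gt U₀ T with h | h
    · obtain ⟨n, hn⟩ := pow_unbounded_of_one_lt T (one_lt_two (α := ℝ))
      refine hbig n T h ?_ _ fun ρ hρ => ?_
      · have h1 : (2 : ℝ) ^ n ≤ 2 ^ (n + 1) := pow_le_pow_right₀ (by norm_num) (by omega)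
        have h2 : (2 : ℝ) ^ (n + 1) * 1 ≤ 2 ^ (n + 1) * U₀ := by gcongr; linarith
        linarith
      · obtain ⟨q1, q2⟩ := Finset.mem_filter.mp hρ
        obtain ⟨r1, r2, r3, r4⟩ := hP ρ q1
        exact ⟨r1, r2, not_le.mp q2, r4⟩
    · rw [Finset.filter_false_of_mem, Finset.sum_empty]
      · have : 0 < Y := hX0.trans_le hXT
        positivity
      · intro ρ hρ; have := (hP ρ hρ).2.2.2; simp; linarith
  have a3 : C₁ ≤ C₁ / X * Y := by
    rw [div_mul_eq_mul_div, le_div_iff₀ hX0]; gcongr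
  linarith

/-- Two continuous logarithms of the same function on a preconnected set differ by a constant. -/
lemma sub_eq_sub_of_exp_eq {X : Type*} [TopologicalSpace X] {s : Set X} (hs : IsPreconnected s)
    {f₁ f₂ : X → ℂ} (h₁ : ContinuousOn f₁ s) (h₂ : ContinuousOn f₂ s)
    (h : ∀ x ∈ s, Complex.exp (f₁ x) = Complex.exp (f₂ x)) {x y : X} (hx : x ∈ s) (hy : y ∈ s) :
    f₁ x - f₂ x = f₁ y - f₂ y := by
  have key : ∀ a ∈ s, Complex.exp (f₁ a - f₂ a) = 1 := fun a ha => by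
    rw [Complex.exp_sub, h a ha, div_self (Complex.exp_ne_zero _)]
  refine Complex.isCoveringMap_exp.constOn_of_comp (g := fun a => f₁ a - f₂ a) hs (h₁.sub h₂)
    (fun a ha a' ha' => ?_) hx hy
  ext
  simp only [key a' ha', key a ha]

/-- A nonempty convex set is simply connected. -/
lemma isSimplyConnected_of_convex {U : Set ℂ} (hU : Convex ℝ U) (hne : U.Nonempty) :
    IsSimplyConnected U := by
  have : ContractibleSpace U := hU.contractibleSpace hne
  unfold IsSimplyConnected
  infer_instance

/-- A continuous logarithm of a differentiable function is differentiable. -/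
lemma hasDerivAt_of_exp_eventuallyEq {h f : ℝ → ℂ} {f' : ℂ} {t₀ : ℝ} (hc : ContinuousAt h t₀)
    (he : ∀ᶠ t in nhds t₀, Complex.exp (h t) = f t) (hf : HasDerivAt f f' t₀) :
    HasDerivAt h (f' / f t₀) t₀ := by
  have h0 : f t₀ ≠ 0 := by rw [← he.self_of_nhds]; exact Complex.exp_ne_zero _
  have hd : HasDerivAt (fun t => f t / f t₀) (f' / f t₀) t₀ := hf.div_const _
  have hl : HasDerivAt (fun t => Complex.log (f t / f t₀)) (f' / f t₀ / (f t₀ / f t₀)) t₀ :=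
    hd.clog_real (by rw [div_self h0]; exact Complex.one_mem_slitPlane)
  rw [div_self h0, div_one] at hl
  refine (hl.const_add (h t₀)).congr_of_eventuallyEq ?_
  have hcont : ContinuousAt (fun t => (h t - h t₀).im) t₀ :=
    Complex.continuous_im.continuousAt.comp (hc.sub continuousAt_const)
  have hz : (h t₀ - h t₀).im = 0 := by simp
  have e1 : ∀ᶠ t in nhds t₀, (h t - h t₀).im < π :=
    hcont.eventually_lt_const (hz.trans_lt Real.pi_pos)
  have e2 : ∀ᶠ t in nhds t₀, -π < (h t - h t₀).im :=
    hcont.eventually_const_lt ((neg_lt_zero.2 Real.pi_pos).trans_eq hz.symm)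
  filter_upwards [e1, e2, he] with t a1 a2 a3
  have : f t / f t₀ = Complex.exp (h t - h t₀) := by
    rw [Complex.exp_sub, a3, he.self_of_nhds]
  rw [this, Complex.log_exp a2 a1.le]
  ring

lemma riemannZeta_mem_slitPlane {z : ℂ} (hz : 2 ≤ z.re) : riemannZeta z ∈ Complex.slitPlane := by
  have := Complex.mem_slitPlane_of_norm_lt_one (z := riemannZeta z - 1)
    (lt_of_le_of_lt (norm_riemannZeta_sub_one_le hz) (by norm_num))
  simpa using this

lemma continuous_const_add_mul_I (a : ℂ) : Continuous (fun t : ℝ => a + t * I) :=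
  continuous_const.add (Complex.continuous_ofReal.mul continuous_const)

/-- The jump of `arg` when crossing the horizontal line through `ρ` on the critical line. -/
lemma exists_arg_decomp (ρ : ℂ) : ∃ d : ℝ → ℝ, Continuous d ∧ ∀ t : ℝ, ρ.im ≠ t →
    (Complex.log (1/2 + t * I - ρ)).im = d t + π * ((if 1/2 < ρ.re then 2 else
      if ρ.re = 1/2 then 1 else 0 : ℕ) : ℝ) * (if ρ.im ≤ t then 1 else 0) := by
  have hw : Continuous (fun t : ℝ => 1/2 + (t:ℂ) * I - ρ) :=
    (continuous_const_add_mul_I _).sub continuous_const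
  have hre : ∀ t : ℝ, (1/2 + (t:ℂ) * I - ρ).re = 1/2 - ρ.re := fun t => by simp
  have him : ∀ t : ℝ, (1/2 + (t:ℂ) * I - ρ).im = t - ρ.im := fun t => by simp
  rcases lt_trichotomy ρ.re (1/2) with h | h | h
  · refine ⟨fun t => (Complex.log (1/2 + t * I - ρ)).im, ?_, fun t _ => ?_⟩
    · refine Complex.continuous_im.comp (hw.clog fun t => ?_)
      exact Or.inl (by rw [hre]; linarith)
    · rw [if_neg h.not_gt, if_neg h.ne]; simp
  · refine ⟨fun t => -(π / 2), continuous_const, fun t ht => ?_⟩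
    rw [if_neg (by rw [h]; exact lt_irrefl _), if_pos h, Complex.log_im]
    rcases lt_or_gt_of_ne ht with h1 | h1
    · rw [if_pos h1.le, Complex.arg_eq_pi_div_two_iff.2 ⟨by rw [hre, h]; ring, by
        rw [him]; linarith⟩]
      push_cast; ring
    · rw [if_neg h1.not_ge, Complex.arg_eq_neg_pi_div_two_iff.2 ⟨by rw [hre, h]; ring, by
        rw [him]; linarith⟩]
      ring
  · refine ⟨fun t => (Complex.log (-(1/2 + t * I - ρ))).im - π, ?_, fun t ht => ?_⟩
    · refine (Complex.continuous_im.comp (hw.neg.clog fun t => ?_)).sub continuous_const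
      refine Or.inl ?_
      change 0 < (-(1/2 + (t:ℂ) * I - ρ)).re
      rw [Complex.neg_re, hre]; linarith
    · simp only [Complex.log_im]
      rw [if_pos h]
      rcases lt_or_gt_of_ne ht with h1 | h1
      · rw [if_pos h1.le, Complex.arg_neg_eq_arg_sub_pi_of_im_pos (by rw [him]; linarith)]
        push_cast; ring
      · rw [if_neg h1.not_ge, Complex.arg_neg_eq_arg_add_pi_of_im_neg (by rw [him]; linarith)]
        ring

/-- The value at the endpoint of the continuous logarithm of `ζ` along the broken path
from `2` to `2 + it` to `1/2 + it`. -/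
lemma exists_lift_formula (T : ℝ) (hT : 1 ≤ T) : ∃ P : Finset ℂ,
    (∀ ρ, ρ ∈ P ↔ riemannZeta ρ = 0 ∧ ρ.re ∈ Icc (0:ℝ) 3 ∧ ρ.im ∈ Icc (1/2:ℝ) (T+1)) ∧
    ∃ G : ℝ → ℂ, ContinuousOn G (Ioo (1/2:ℝ) (T+1)) ∧
      ∀ t ∈ Ioo (1/2:ℝ) (T+1), (∀ ρ ∈ P, ρ.im ≠ t) → ∀ θ : ℝ → ℂ, ContinuousOn θ (Icc 0 2) →
        θ 0 = Complex.log (riemannZeta 2) →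
        (∀ u ∈ Icc (0:ℝ) 1, Complex.exp (θ u) = riemannZeta (2 + u * t * I)) →
        (∀ u ∈ Icc (1:ℝ) 2, Complex.exp (θ u) = riemannZeta (2 - 3/2 * (u - 1) + t * I)) →
        θ 2 = G t + ∑ ρ ∈ P, (zetaOrder ρ : ℂ) * Complex.log (1/2 + t * I - ρ) := by
  have hfin : (Icc (0:ℝ) 3 ×ℂ Icc (1/2:ℝ) (T+1) ∩ riemannZetaZeros).Finite :=
    IsCompact.inter_riemannZetaZeros_finite (isCompact_Icc.reProdIm isCompact_Icc)
  refine ⟨hfin.toFinset, ?_⟩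
  set P := hfin.toFinset with hPdef
  have hP : ∀ ρ, ρ ∈ P ↔ riemannZeta ρ = 0 ∧ ρ.re ∈ Icc (0:ℝ) 3 ∧ ρ.im ∈ Icc (1/2:ℝ) (T+1) := by
    intro ρ
    rw [hPdef, Set.Finite.mem_toFinset, Set.mem_inter_iff, Complex.mem_reProdIm, and_comm]
    rfl
  refine ⟨hP, ?_⟩
  have hP1 : ∀ ρ ∈ P, ρ ≠ 1 := fun ρ hρ h => by
    have := ((hP ρ).1 hρ).2.2.1
    rw [h, Complex.one_im] at this
    norm_num at this
  have hPre : ∀ ρ ∈ P, ρ.re < 1 := fun ρ hρ => by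
    by_contra hc
    exact riemannZeta_ne_zero_of_one_le_re (not_lt.1 hc) ((hP ρ).1 hρ).1
  obtain ⟨g, hgd, hgz, hg0⟩ := exists_zeta_factorization P hP1
  set R : Set ℂ := Ioo (0:ℝ) 3 ×ℂ Ioo (1/2:ℝ) (T+1) with hR
  have hR1 : ∀ z ∈ R, z ≠ 1 := fun z hz h => by
    have := (Complex.mem_reProdIm.1 hz).2.1
    rw [h, Complex.one_im] at this
    norm_num at this
  have hRo : IsOpen R := isOpen_Ioo.reProdIm isOpen_Ioo
  have hRc : Convex ℝ R := ((convex_Ioo (0:ℝ) 3).linear_preimage Complex.reLm).inter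
    ((convex_Ioo (1/2:ℝ) (T+1)).linear_preimage Complex.imLm)
  have hmem : ∀ σ t : ℝ, σ ∈ Ioo (0:ℝ) 3 → t ∈ Ioo (1/2:ℝ) (T+1) → (σ + t * I : ℂ) ∈ R :=
    fun σ t hσ ht => Complex.mem_reProdIm.2 ⟨by simpa using hσ, by simpa using ht⟩
  have hRne : R.Nonempty := ⟨_, hmem 1 1 ⟨by norm_num, by norm_num⟩ ⟨by norm_num, by linarith⟩⟩
  obtain ⟨F, hFc, hFe⟩ := Complex.exists_continuousOn_eqOn_exp_comp (X := ℂ) (U := R) (g := g)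
    (isSimplyConnected_of_convex hRc hRne) hRo
    (hgd.continuousOn.mono fun z hz => hR1 z hz) (by
      rintro ⟨z, hz, h0⟩
      have hzm := Complex.mem_reProdIm.1 hz
      refine hg0 z ((hP z).2 ⟨?_, Ioo_subset_Icc_self hzm.1, Ioo_subset_Icc_self hzm.2⟩) h0
      rw [hgz z (hR1 z hz), h0, mul_zero])
  have hexpL : ∀ z ∈ R, (∀ ρ ∈ P, z ≠ ρ) →
      Complex.exp (F z + ∑ ρ ∈ P, (zetaOrder ρ : ℂ) * Complex.log (z - ρ)) = riemannZeta z := by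
    intro z hz hne
    rw [Complex.exp_add, Complex.exp_sum, hgz z (hR1 z hz), mul_comm,
      show Complex.exp (F z) = g z from hFe hz]
    congr 1
    refine Finset.prod_congr rfl fun ρ hρ => ?_
    rw [Complex.exp_nat_mul, Complex.exp_log (sub_ne_zero.2 (hne ρ hρ))]
  have hcontL : ∀ (s : Set ℝ) (w : ℝ → ℂ), ContinuousOn w s → (∀ x ∈ s, w x ∈ R) →
      (∀ x ∈ s, ∀ ρ ∈ P, w x - ρ ∈ Complex.slitPlane) →
      ContinuousOn (fun x => F (w x) + ∑ ρ ∈ P, (zetaOrder ρ : ℂ) * Complex.log (w x - ρ)) s := by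
    intro s w hw hwR hws
    refine (hFc.comp hw hwR).add (continuousOn_finsetSum _ fun ρ hρ => ?_)
    exact continuousOn_const.mul ((hw.sub continuousOn_const).clog fun x hx => hws x hx ρ hρ)
  -- the constant
  set Λ : ℂ → ℂ := fun z => F z + ∑ ρ ∈ P, (zetaOrder ρ : ℂ) * Complex.log (z - ρ) with hΛ
  have hz2c : ∀ (s : Set ℝ) (w : ℝ → ℂ), ContinuousOn w s → (∀ x ∈ s, (w x).re = 2) →
      ContinuousOn (fun x => Complex.log (riemannZeta (w x))) s := by
    intro s w hw hre x hx
    have h1 : w x ≠ 1 := fun h => by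
      have := hre x hx; rw [h, Complex.one_re] at this; norm_num at this
    have hc : ContinuousWithinAt (fun x => riemannZeta (w x)) s x :=
      (differentiableAt_riemannZeta h1).continuousAt.comp_continuousWithinAt (hw x hx)
    exact hc.clog (riemannZeta_mem_slitPlane (hre x hx).ge)
  have h2R : ∀ t ∈ Ioo (1/2:ℝ) (T+1), (2 + t * I : ℂ) ∈ R := fun t ht => by
    simpa using hmem 2 t ⟨by norm_num, by norm_num⟩ ht
  have h2slit : ∀ t : ℝ, ∀ ρ ∈ P, (2 + t * I : ℂ) - ρ ∈ Complex.slitPlane := fun t ρ hρ =>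
    Or.inl (by
      have := hPre ρ hρ
      simp; linarith)
  have hE : ∀ t ∈ Ioo (1/2:ℝ) (T+1), Complex.log (riemannZeta (2 + t * I)) - Λ (2 + t * I) =
      Complex.log (riemannZeta (2 + (1:ℝ) * I)) - Λ (2 + (1:ℝ) * I) := by
    intro t ht
    refine sub_eq_sub_of_exp_eq (s := Ioo (1/2:ℝ) (T+1))
      (f₁ := fun t : ℝ => Complex.log (riemannZeta (2 + t * I)))
      (f₂ := fun t : ℝ => Λ (2 + t * I)) isPreconnected_Ioo
      (hz2c _ _ (continuous_const_add_mul_I 2).continuousOn (fun x _ => by simp))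
      (hcontL _ _ (continuous_const_add_mul_I 2).continuousOn h2R fun x _ => h2slit x)
      (fun x hx => ?_) ht ⟨by norm_num, by linarith⟩
    rw [hΛ]
    simp only
    rw [hexpL _ (h2R x hx) fun ρ hρ h => by
        have := Complex.slitPlane_ne_zero (h2slit x ρ hρ); exact this (sub_eq_zero.2 h),
      Complex.exp_log (Complex.slitPlane_ne_zero (riemannZeta_mem_slitPlane (by simp)))]
  set E := Complex.log (riemannZeta (2 + (1:ℝ) * I)) - Λ (2 + (1:ℝ) * I) with hEdef
  refine ⟨fun t => E + F (1/2 + t * I), ?_, ?_⟩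
  · refine continuousOn_const.add (hFc.comp (continuous_const_add_mul_I _).continuousOn ?_)
    intro t ht
    simpa using hmem (1/2) t ⟨by norm_num, by norm_num⟩ ht
  intro t ht htP θ hθc hθ0 hθ1 hθ2
  have e1 : θ 1 = Complex.log (riemannZeta (2 + t * I)) := by
    have hw : Continuous (fun u : ℝ => (2 + u * t * I : ℂ)) :=
      continuous_const.add ((Complex.continuous_ofReal.mul continuous_const).mul continuous_const)
    have := sub_eq_sub_of_exp_eq (s := Icc (0:ℝ) 1) (f₁ := θ)
      (f₂ := fun u : ℝ => Complex.log (riemannZeta (2 + u * t * I))) isPreconnected_Icc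
      (hθc.mono (Icc_subset_Icc le_rfl (by norm_num)))
      (hz2c _ _ hw.continuousOn (fun x _ => by simp))
      (fun u hu => by
        rw [hθ1 u hu, Complex.exp_log]
        exact Complex.slitPlane_ne_zero (riemannZeta_mem_slitPlane (by simp)))
      (x := 1) (y := 0) ⟨by norm_num, le_rfl⟩ ⟨le_rfl, by norm_num⟩
    simp only [Complex.ofReal_one, Complex.ofReal_zero, one_mul, zero_mul, add_zero, hθ0,
      sub_self] at this
    exact sub_eq_zero.1 this
  have hw : Continuous (fun u : ℝ => (2 - 3/2 * (u - 1) + t * I : ℂ)) :=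
    (continuous_const.sub (continuous_const.mul
      (Complex.continuous_ofReal.sub continuous_const))).add continuous_const
  have hwR : ∀ u ∈ Icc (1:ℝ) 2, (2 - 3/2 * (u - 1) + t * I : ℂ) ∈ R := fun u hu => by
    have := hmem (2 - 3/2 * (u - 1)) t ⟨by linarith [hu.2], by linarith [hu.1]⟩ ht
    push_cast at this
    exact this
  have hws : ∀ u ∈ Icc (1:ℝ) 2, ∀ ρ ∈ P,
      (2 - 3/2 * (u - 1) + t * I : ℂ) - ρ ∈ Complex.slitPlane := fun u _ ρ hρ => Or.inr (by
    have h := htP ρ hρ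
    have : ((2 - 3/2 * (u - 1) + t * I : ℂ) - ρ).im = t - ρ.im := by
      simp
    rw [this]
    exact sub_ne_zero.2 h.symm)
  have e2 := sub_eq_sub_of_exp_eq (s := Icc (1:ℝ) 2) (f₁ := θ)
      (f₂ := fun u : ℝ => Λ (2 - 3/2 * (u - 1) + t * I)) isPreconnected_Icc
      (hθc.mono (Icc_subset_Icc (by norm_num) le_rfl))
      (hcontL _ _ hw.continuousOn hwR hws)
      (fun u hu => by
        rw [hθ2 u hu, hΛ]
        simp only
        rw [hexpL _ (hwR u hu) fun ρ hρ h =>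
          Complex.slitPlane_ne_zero (hws u hu ρ hρ) (sub_eq_zero.2 h)])
      (x := 2) (y := 1) ⟨by norm_num, le_rfl⟩ ⟨le_rfl, by norm_num⟩
  have a1 : (2 - 3/2 * (((2:ℝ):ℂ) - 1) + t * I : ℂ) = 1/2 + t * I := by push_cast; ring
  have a2 : (2 - 3/2 * (((1:ℝ):ℂ) - 1) + t * I : ℂ) = 2 + t * I := by push_cast; ring
  simp only [a1, a2] at e2
  have e3 : θ 2 = E + Λ (1/2 + t * I) := by
    rw [← hE t ht, ← e1]
    linear_combination e2
  rw [e3, hΛ]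
  ring

/-- The jump of `S` contributed by the zero `ρ`. -/
def zeroJump (ρ : ℂ) : ℕ :=
  zetaOrder ρ * (if 1/2 < ρ.re then 2 else if ρ.re = 1/2 then 1 else 0)

/-- `S` is the sum of a continuous logarithm of `χ` on the critical line and a step function
that jumps at the ordinates of the zeros of `ζ` on and to the right of the critical line. -/
lemma exists_S_structure {S : ℝ → ℝ} (hS : IsS S) {T : ℝ} (hT : 1 ≤ T) :
    ∃ (P : Finset ℂ) (D : ℝ → ℝ), (∀ ρ ∈ P, riemannZeta ρ = 0) ∧
      ContinuousOn D (Ioo (1/2:ℝ) (T+1)) ∧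
      (∀ t ∈ Ioo (1/2:ℝ) (T+1),
        S t = D t + ∑ ρ ∈ P, (zeroJump ρ : ℝ) * (if ρ.im ≤ t then 1 else 0)) ∧
      ∀ t ∈ Ioo (1/2:ℝ) (T+1), Complex.exp (2 * π * I * D t) = chi (1/2 + t * I) := by
  obtain ⟨P, hP, G, hGc, hG⟩ := exists_lift_formula T hT
  choose d hdc hd using exists_arg_decomp
  set D : ℝ → ℝ := fun t => ((G t).im + ∑ ρ ∈ P, (zetaOrder ρ : ℝ) * d ρ t) / π with hD
  have hDc : ContinuousOn D (Ioo (1/2:ℝ) (T+1)) :=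
    ((Complex.continuous_im.comp_continuousOn hGc).add (continuousOn_finsetSum _ fun ρ _ =>
      (continuous_const.mul (hdc ρ)).continuousOn)).div_const _
  have hnat : ∀ t : ℝ, ∃ n : ℕ,
      ∑ ρ ∈ P, (zeroJump ρ : ℝ) * (if ρ.im ≤ t then 1 else 0) = n := fun t =>
    ⟨∑ ρ ∈ P, zeroJump ρ * (if ρ.im ≤ t then 1 else 0), by push_cast; rfl⟩
  have hgood : ∀ t ∈ Ioo (1/2:ℝ) (T+1), (∀ ρ ∈ P, ρ.im ≠ t) →
      S t = D t + ∑ ρ ∈ P, (zeroJump ρ : ℝ) * (if ρ.im ≤ t then 1 else 0) ∧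
      Complex.exp (2 * π * I * D t) = chi (1/2 + t * I) := by
    intro t ht htP
    obtain ⟨θ, h1, h2, h3, h4, h5⟩ := hS.1 t (by linarith [ht.1]) fun σ hσ1 hσ2 h0 =>
      htP _ ((hP _).2 ⟨h0, by simp only [add_re, ofReal_re, mul_re, I_re, mul_zero, ofReal_im, I_im,
        mul_one, sub_self, add_zero]; exact ⟨by linarith, by linarith⟩, by
          simpa using ⟨by simpa using ht.1.le, ht.2.le⟩⟩) (by simp)
    have hθ := hG t ht htP θ h1 h2 h3 h4
    have e1 : S t = D t + ∑ ρ ∈ P, (zeroJump ρ : ℝ) * (if ρ.im ≤ t then 1 else 0) := by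
      rw [h5, hθ, hD, Complex.add_im, Complex.im_sum, ← sub_eq_iff_eq_add', ← sub_div,
        add_sub_add_left_eq_sub, ← Finset.sum_sub_distrib, Finset.sum_div]
      refine Finset.sum_congr rfl fun ρ hρ => ?_
      rw [show ((zetaOrder ρ : ℂ) * Complex.log (1/2 + t * I - ρ)).im =
        (zetaOrder ρ : ℝ) * (Complex.log (1/2 + t * I - ρ)).im by simp, hd ρ t (htP ρ hρ),
        zeroJump, Nat.cast_mul]
      field_simp
      ring
    refine ⟨e1, ?_⟩
    have hz : Complex.exp (θ 2) = riemannZeta (1/2 + t * I) := by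
      rw [h4 2 ⟨by norm_num, le_rfl⟩]
      congr 1
      push_cast
      ring
    have hz0 : riemannZeta (1/2 + t * I) ≠ 0 := by rw [← hz]; exact Complex.exp_ne_zero _
    have hfe := riemannZeta_eq_chi_mul (s := 1/2 + t * I) (by simpa using (by linarith [ht.1] : t ≠ 0))
    have hconj : (1 - (1/2 + t * I) : ℂ) = (starRingEnd ℂ) (1/2 + t * I) := by
      apply Complex.ext <;> norm_num
    obtain ⟨n, hn⟩ := hnat t
    have e2 : (2 * π * I * D t : ℂ) =
        θ 2 - (starRingEnd ℂ) (θ 2) - n * (2 * π * I) := by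
      have : (θ 2).im = π * (D t + n) := by
        rw [← hn, ← e1, h5]; field_simp
      rw [Complex.sub_conj, this]
      push_cast
      ring
    rw [e2, Complex.exp_sub, Complex.exp_nat_mul_two_pi_mul_I, div_one, Complex.exp_sub,
      Complex.exp_conj, hz, div_eq_iff ((map_ne_zero _).2 hz0), ← riemannZeta_conj, ← hconj]
    exact hfe
  have hev : ∀ t ∈ Ioo (1/2:ℝ) (T+1), ∀ᶠ s in nhdsWithin t (Ioi t),
      s ∈ Ioo (1/2:ℝ) (T+1) ∧ ∀ ρ ∈ P, ρ.im ≠ s := by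
    intro t ht
    have a1 : ∀ᶠ s in nhdsWithin t (Ioi t), s ∈ Ioo (1/2:ℝ) (T+1) :=
      nhdsWithin_le_nhds (isOpen_Ioo.mem_nhds ht)
    have a2 : ∀ᶠ s in nhdsWithin t (Ioi t), ∀ ρ ∈ P, ρ.im ≠ s := by
      rw [Filter.eventually_all_finset]
      intro ρ _
      rcases le_or_gt ρ.im t with h | h
      · filter_upwards [self_mem_nhdsWithin] with s hs
        exact (h.trans_lt hs).ne
      · filter_upwards [nhdsWithin_le_nhds (Iio_mem_nhds h)] with s hs
        exact (ne_of_lt hs).symm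
    exact a1.and a2
  refine ⟨P, D, fun ρ hρ => ((hP ρ).1 hρ).1, hDc, fun t ht => ?_, fun t ht => ?_⟩
  · have hDt : Tendsto D (nhdsWithin t (Ioi t)) (nhds (D t)) :=
      ((hDc.continuousAt (isOpen_Ioo.mem_nhds ht)).tendsto).mono_left nhdsWithin_le_nhds
    have hstep : ∀ᶠ s in nhdsWithin t (Ioi t), ∀ ρ ∈ P, (ρ.im ≤ s ↔ ρ.im ≤ t) := by
      rw [Filter.eventually_all_finset]
      intro ρ _
      rcases le_or_gt ρ.im t with h | h
      · filter_upwards [self_mem_nhdsWithin] with s hs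
        exact ⟨fun _ => h, fun _ => (h.trans_lt hs).le⟩
      · filter_upwards [nhdsWithin_le_nhds (Iio_mem_nhds h)] with s hs
        exact ⟨fun h' => absurd h' (not_le.2 hs), fun h' => absurd h' (not_le.2 h)⟩
    refine tendsto_nhds_unique (hS.2 t (by linarith [ht.1])) ?_
    refine (hDt.add_const _).congr' ?_
    filter_upwards [hev t ht, hstep] with s hs hs'
    rw [(hgood s hs.1 hs.2).1]
    congr 1
    exact Finset.sum_congr rfl fun ρ hρ => by simp only [hs' ρ hρ]
  · have hc1 : ContinuousAt (fun s => Complex.exp (2 * π * I * D s)) t :=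
      (continuousAt_const.mul (Complex.continuous_ofReal.continuousAt.comp
        (hDc.continuousAt (isOpen_Ioo.mem_nhds ht)))).cexp
    have hc2 : ContinuousAt (fun s : ℝ => chi (1/2 + s * I)) t :=
      ContinuousAt.comp (g := chi) (f := fun s : ℝ => (1/2 + s * I : ℂ))
        (differentiableAt_chi (by simpa using (by linarith [ht.1] : t ≠ 0))).continuousAt
        (continuous_const_add_mul_I _).continuousAt
    refine tendsto_nhds_unique (l := nhdsWithin t (Ioi t)) (hc1.tendsto.mono_left nhdsWithin_le_nhds)
      ((hc2.tendsto.mono_left nhdsWithin_le_nhds).congr' ?_)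
    filter_upwards [hev t ht] with s hs
    exact (hgood s hs.1 hs.2).2.symm

lemma half_add_mul_I_ne_one (t : ℝ) : (1/2 + t * I : ℂ) ≠ 1 := fun h => by
  have := congrArg Complex.re h
  norm_num at this

lemma hasDerivAt_riemannZeta_half (t : ℝ) :
    HasDerivAt (fun t : ℝ => riemannZeta (1/2 + t * I)) (deriv riemannZeta (1/2 + t * I) * I) t := by
  have h1 : HasDerivAt (fun t : ℝ => (1/2 + t * I : ℂ)) (1 * I) t :=
    (((hasDerivAt_id t).ofReal_comp).mul_const I).const_add _
  have h2 := (differentiableAt_riemannZeta (half_add_mul_I_ne_one t)).hasDerivAt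
  have := HasDerivAt.comp t h2 h1
  rwa [one_mul] at this

lemma continuous_norm_sq_riemannZeta_half :
    Continuous (fun t : ℝ => ‖riemannZeta (1/2 + t * I)‖ ^ 2) :=
  (continuous_iff_continuousAt.2 fun t =>
    (hasDerivAt_riemannZeta_half t).continuousAt.norm).pow 2

/-- The squared modulus of `ζ` on the critical line is continuously differentiable. -/
lemma exists_deriv_norm_sq_riemannZeta_half : ∃ W' : ℝ → ℝ, Continuous W' ∧
    ∀ t : ℝ, HasDerivAt (fun t : ℝ => ‖riemannZeta (1/2 + t * I)‖ ^ 2) (W' t) t := by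
  refine ⟨fun t => 2 * inner ℝ (riemannZeta (1/2 + t * I)) (deriv riemannZeta (1/2 + t * I) * I),
    ?_, fun t => (hasDerivAt_riemannZeta_half t).norm_sq⟩
  refine continuous_const.mul (Continuous.inner ?_ ?_)
  · exact continuous_iff_continuousAt.2 fun t => (hasDerivAt_riemannZeta_half t).continuousAt
  · refine Continuous.mul ?_ continuous_const
    exact continuous_iff_continuousAt.2 fun t =>
      ContinuousAt.comp (g := deriv riemannZeta) (f := fun t : ℝ => (1/2 + t * I : ℂ))
        (analyticAt_riemannZeta (half_add_mul_I_ne_one t)).deriv.continuousAt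
        (continuous_const_add_mul_I _).continuousAt

/-- Mean square of `ζ` on the critical line. -/
lemma exists_integral_norm_sq_riemannZeta_half_le : ∃ C : ℝ, 0 < C ∧ ∀ T : ℝ, 3 ≤ T →
    ∫ t in (1:ℝ)..T, ‖riemannZeta (1/2 + t * I)‖ ^ 2 ≤ C * (T * Real.log T) := by
  obtain ⟨C, hC, hsm⟩ := exists_second_moment_le
  have h_integrable : ∀ a b : ℝ, IntervalIntegrable (fun t : ℝ => ‖riemannZeta (1/2 + t * I)‖ ^ 2)
      volume a b := fun a b => continuous_norm_sq_riemannZeta_half.intervalIntegrable a b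
  have hnn : ∀ t : ℝ, 0 ≤ ‖riemannZeta (1/2 + t * I)‖ ^ 2 := fun t => by positivity
  have hmono : ∀ a b c d : ℝ, c ≤ a → a ≤ b → b ≤ d →
      ∫ t in a..b, ‖riemannZeta (1/2 + t * I)‖ ^ 2 ≤
        ∫ t in c..d, ‖riemannZeta (1/2 + t * I)‖ ^ 2 := fun a b c d h1 h2 h3 =>
    intervalIntegral.integral_mono_interval h1 h2 h3 (Eventually.of_forall hnn) (h_integrable c d)
  set A := Real.exp 9 with hA
  have hA1 : 1 ≤ A := Real.one_le_exp (by norm_num)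
  set M := ∫ t in (1:ℝ)..A, ‖riemannZeta (1/2 + t * I)‖ ^ 2 with hM
  have hM0 : 0 ≤ M := intervalIntegral.integral_nonneg hA1 fun t _ => hnn t
  have key : ∀ n : ℕ, ∀ T : ℝ, 1 ≤ T → T ≤ 2 ^ n * A →
      ∫ t in (1:ℝ)..T, ‖riemannZeta (1/2 + t * I)‖ ^ 2 ≤ M + 2 * C * (T * Real.log T) := by
    intro n
    induction n with
    | zero =>
      intro T h1 h2
      rw [pow_zero, one_mul] at h2
      have := hmono 1 T 1 A le_rfl h1 h2
      have h3 : 0 ≤ 2 * C * (T * Real.log T) := by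
        have := Real.log_nonneg h1
        positivity
      linarith
    | succ n ih =>
      intro T h1 h2
      rcases le_or_gt T A with h | h
      · have := hmono 1 T 1 A le_rfl h1 h
        have h3 : 0 ≤ 2 * C * (T * Real.log T) := by
          have := Real.log_nonneg h1
          positivity
        linarith
      · have hA2 : 2 ≤ A := by
          have := Real.add_one_le_exp (9:ℝ); linarith
        have i1 := ih (T/2) (by linarith) (by rw [pow_succ] at h2; linarith)
        have i2 := hsm T (1/2) h.le (by
          rw [sub_self, abs_zero]
          exact div_nonneg (by norm_num) (Real.log_nonneg h1))
        have i3 := hmono (T/2) T (T/2) (4*T) le_rfl (by linarith) (by linarith)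
        have i4 := intervalIntegral.integral_add_adjacent_intervals (h_integrable 1 (T/2)) (h_integrable (T/2) T)
        have i5 : Real.log (T/2) ≤ Real.log T := Real.log_le_log (by linarith) (by linarith)
        have i6 : 2 * C * (T/2 * Real.log (T/2)) ≤ 2 * C * (T/2 * Real.log T) :=
          mul_le_mul_of_nonneg_left (mul_le_mul_of_nonneg_left i5 (by linarith)) (by linarith)
        push_cast at i2
        rw [← i4]
        linarith
  refine ⟨M + 2 * C, by linarith, fun T hT => ?_⟩
  obtain ⟨n, hn⟩ := pow_unbounded_of_one_lt T (by norm_num : (1:ℝ) < 2)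
  have h1 := key n T (by linarith) (hn.le.trans (le_mul_of_one_le_right (by positivity) hA1))
  have hl : 1 ≤ T * Real.log T := by
    have : 1 ≤ Real.log T := by
      rw [Real.le_log_iff_exp_le (by linarith)]
      linarith [Real.exp_one_lt_d9]
    nlinarith
  have : M ≤ M * (T * Real.log T) := le_mul_of_one_le_right hM0 hl
  linarith

lemma continuousAt_deriv_chi {s : ℂ} (hs : s.im ≠ 0) : ContinuousAt (deriv chi) s := by
  have hd : DifferentiableOn ℂ chi {z : ℂ | z.im ≠ 0} := fun z hz =>
    (differentiableAt_chi hz).differentiableWithinAt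
  have ho : IsOpen {z : ℂ | z.im ≠ 0} := isOpen_ne.preimage Complex.continuous_im
  exact (hd.analyticAt (ho.mem_nhds hs)).deriv.continuousAt

lemma continuousOn_deriv_chi_half :
    ContinuousOn (fun t : ℝ => deriv chi (1/2 + t * I)) (Ioi 0) := fun t ht =>
  (ContinuousAt.comp (g := deriv chi) (f := fun t : ℝ => (1/2 + t * I : ℂ))
    (continuousAt_deriv_chi (by simpa using ne_of_gt ht))
    (continuous_const_add_mul_I _).continuousAt).continuousWithinAt

lemma exists_norm_deriv_chi_half_le : ∃ C : ℝ, 0 < C ∧ ∀ t : ℝ, 1 ≤ t →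
    ‖deriv chi (1/2 + t * I)‖ ≤ C * (1 + Real.log t) := by
  obtain ⟨C, hC, hchi⟩ := exists_norm_chi_le
  obtain ⟨M, hM⟩ := (isCompact_Icc (a := (1:ℝ)) (b := 2)).exists_bound_of_continuousOn
    (continuousOn_deriv_chi_half.mono fun t ht => lt_of_lt_of_le one_pos ht.1)
  have hM0 : 0 ≤ M := (norm_nonneg _).trans (hM 1 ⟨le_rfl, by norm_num⟩)
  have hCe : 0 < C * Real.exp 1 := mul_pos (by linarith) (Real.exp_pos _)
  refine ⟨M + C * Real.exp 1, by linarith, fun t ht => ?_⟩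
  have hl : 0 ≤ Real.log t := Real.log_nonneg ht
  rcases le_or_gt t 2 with h2 | h2
  · refine (hM t ⟨ht, h2⟩).trans ?_
    have : 0 ≤ M * Real.log t := mul_nonneg hM0 hl
    have : 0 ≤ C * Real.exp 1 * (1 + Real.log t) := by positivity
    linarith
  · set r := 1 / (1 + Real.log t) with hr
    have hr0 : 0 < r := by positivity
    have hr1 : r ≤ 1 := by
      rw [hr, div_le_one (by linarith)]; linarith
    have hball : ∀ z ∈ Metric.closedBall (1/2 + t * I : ℂ) r,
        |z.re - 1/2| ≤ r ∧ |z.im - t| ≤ r := by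
      intro z hz
      rw [Metric.mem_closedBall, Complex.dist_eq] at hz
      have h1 := (Complex.abs_re_le_norm (z - (1/2 + t * I))).trans hz
      have h2 := (Complex.abs_im_le_norm (z - (1/2 + t * I))).trans hz
      constructor
      · simpa using h1
      · simpa using h2
    have him : ∀ z ∈ Metric.closedBall (1/2 + t * I : ℂ) r, 1 ≤ z.im ∧ z.im ≤ 2 * t := by
      intro z hz
      have := abs_le.1 (hball z hz).2
      constructor <;> linarith
    have hb := norm_deriv_le_of_forall_mem_sphere_norm_le (f := chi) (c := 1/2 + t * I)
      (C := C * Real.exp 1) hr0 (by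
        refine DifferentiableOn.diffContOnCl fun z hz => ?_
        rw [closure_ball _ hr0.ne'] at hz
        exact (differentiableAt_chi (by linarith [(him z hz).1])).differentiableWithinAt) (by
        intro z hz
        have hz' := Metric.sphere_subset_closedBall hz
        obtain ⟨a1, a2⟩ := hball z hz'
        obtain ⟨b1, b2⟩ := him z hz'
        have a1' := abs_le.1 a1
        have hc := hchi z.re z.im (by linarith) (by linarith) (by rwa [abs_of_pos (by linarith)])
        rw [Complex.re_add_im, abs_of_pos (by linarith : 0 < z.im)] at hc
        refine hc.trans (mul_le_mul_of_nonneg_left ?_ (by linarith))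
        rw [Real.rpow_def_of_pos (by linarith)]
        refine Real.exp_le_exp.2 ?_
        have l1 : Real.log z.im ≤ 1 + Real.log t := by
          refine (Real.log_le_log (by linarith) b2).trans ?_
          rw [Real.log_mul (by norm_num) (by linarith)]
          linarith [Real.log_two_lt_d9]
        have l0 : 0 ≤ Real.log z.im := Real.log_nonneg b1
        calc Real.log z.im * (1/2 - z.re) ≤ Real.log z.im * r :=
              mul_le_mul_of_nonneg_left (by linarith) l0
          _ ≤ (1 + Real.log t) * r := mul_le_mul_of_nonneg_right l1 hr0.le
          _ = 1 := by rw [hr]; field_simp)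
    refine hb.trans ?_
    rw [hr, div_div_eq_mul_div, div_one]
    have : 0 ≤ M * (1 + Real.log t) := mul_nonneg hM0 (by linarith)
    linarith

/-- The derivative of a continuous real phase `D` with `exp (2πiD) = χ` on the critical line. -/
lemma hasDerivAt_of_exp_eq_chi {D : ℝ → ℝ} {U : Set ℝ} (hU : IsOpen U) (hpos : ∀ t ∈ U, 0 < t)
    (hDc : ContinuousOn D U)
    (hD : ∀ t ∈ U, Complex.exp (2 * π * I * D t) = chi (1/2 + t * I)) {t : ℝ} (ht : t ∈ U) :
    HasDerivAt D ((deriv chi (1/2 + t * I) / chi (1/2 + t * I)).re / (2 * π)) t := by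
  have him : (1/2 + t * I : ℂ).im ≠ 0 := by simpa using (hpos t ht).ne'
  have h1 : HasDerivAt (fun t : ℝ => (1/2 + t * I : ℂ)) (1 * I) t :=
    (((hasDerivAt_id t).ofReal_comp).mul_const I).const_add _
  have h2 := HasDerivAt.comp t (differentiableAt_chi him).hasDerivAt h1
  have hc : ContinuousAt (fun s => (2 * π * I * D s : ℂ)) t :=
    continuousAt_const.mul (Complex.continuous_ofReal.continuousAt.comp
      (hDc.continuousAt (hU.mem_nhds ht)))
  have h3 := hasDerivAt_of_exp_eventuallyEq hc
    (Filter.eventually_of_mem (hU.mem_nhds ht) hD) h2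
  have h4 := Complex.reCLM.hasFDerivAt.comp_hasDerivAt t (h3.const_mul (1 / (2 * π * I) : ℂ))
  have hpi : (π : ℂ) ≠ 0 := Complex.ofReal_ne_zero.2 Real.pi_ne_zero
  refine (h4.congr_deriv ?_).congr_of_eventuallyEq (Eventually.of_forall fun s => ?_)
  · rw [Complex.reCLM_apply, one_mul]
    rw [show (1 / (2 * π * I) : ℂ) * (deriv chi (1/2 + t * I) * I /
        chi (1/2 + t * I)) =
        (deriv chi (1/2 + t * I) / chi (1/2 + t * I)) / ((2 * π : ℝ) : ℂ) by
      have := chi_ne_zero him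
      push_cast
      field_simp]
    rw [Complex.div_ofReal_re]
  · change D s = ((1 / (2 * π * I) : ℂ) * (2 * π * I * D s)).re
    rw [← mul_assoc, one_div, inv_mul_cancel₀ (by simp [hpi]), one_mul, Complex.ofReal_re]

lemma intervalIntegrable_step_mul {W' : ℝ → ℝ} (hW' : Continuous W') (γ a b : ℝ) :
    IntervalIntegrable (fun t => (if γ ≤ t then 1 else 0) * W' t) volume a b := by
  have : (fun t => (if γ ≤ t then 1 else 0) * W' t) = (Ici γ).indicator W' := by
    ext t
    by_cases h : γ ≤ t
    · rw [if_pos h, one_mul, Set.indicator_of_mem (show t ∈ Ici γ from h)]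
    · rw [if_neg h, zero_mul, Set.indicator_of_notMem (show t ∉ Ici γ from h)]
  rw [this]
  exact ⟨(hW'.intervalIntegrable a b).1.indicator measurableSet_Ici,
    (hW'.intervalIntegrable a b).2.indicator measurableSet_Ici⟩

/-- Integration by parts against a unit step. -/
lemma step_integral_by_parts {W W' : ℝ → ℝ} (hW' : Continuous W')
    (hW : ∀ t, HasDerivAt W (W' t) t) (γ : ℝ) {a T : ℝ} (hT : a ≤ T) :
    W T * (if γ ≤ T then 1 else 0) - W a * (if γ ≤ a then 1 else 0)
      - ∫ t in a..T, (if γ ≤ t then 1 else 0) * W' t = if a < γ ∧ γ ≤ T then W γ else 0 := by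
  have hftc : ∀ x y, ∫ t in x..y, W' t = W y - W x := fun x y =>
    intervalIntegral.integral_eq_sub_of_hasDerivAt (fun t _ => hW t) (hW'.intervalIntegrable x y)
  have hone : ∀ x y, x ≤ y → γ ≤ x →
      ∫ t in x..y, (if γ ≤ t then 1 else 0) * W' t = W y - W x := by
    intro x y hxy hx
    rw [← hftc]
    refine intervalIntegral.integral_congr fun t ht => ?_
    rw [Set.uIcc_of_le hxy] at ht
    simp only [if_pos (hx.trans ht.1), one_mul]
  have hzero : ∀ x y, x ≤ y → y ≤ γ → ∫ t in x..y, (if γ ≤ t then 1 else 0) * W' t = 0 := by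
    intro x y hxy hy
    refine intervalIntegral.integral_zero_ae ?_
    have : ∀ᵐ t : ℝ, t ≠ y := by simp [ae_iff]
    filter_upwards [this] with t hty ht
    rw [Set.uIoc_of_le hxy] at ht
    rw [if_neg (not_le.2 (lt_of_lt_of_le (lt_of_le_of_ne ht.2 hty) hy)), zero_mul]
  rcases le_or_gt γ a with h | h
  · rw [hone a T hT h, if_pos (h.trans hT), if_pos h, if_neg fun h' => absurd h'.1 (not_lt.2 h)]
    ring
  · rcases le_or_gt γ T with h' | h'
    · rw [← intervalIntegral.integral_add_adjacent_intervals
        (intervalIntegrable_step_mul hW' γ a γ) (intervalIntegrable_step_mul hW' γ γ T),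
        hzero a γ h.le le_rfl, hone γ T h' le_rfl, if_pos h', if_neg (not_le.2 h),
        if_pos ⟨h, h'⟩]
      ring
    · rw [hzero a T hT h'.le, if_neg (not_le.2 h'), if_neg (not_le.2 h),
        if_neg fun h'' => absurd h''.2 (not_le.2 h')]
      ring

lemma sq_eq_norm_sq_riemannZeta {Z : ℝ → ℝ}
    (hZsq : ∀ t : ℝ, ((Z t : ℂ)) ^ 2 * chi (1/2 + t * I) = (riemannZeta (1/2 + t * I)) ^ 2)
    {t : ℝ} (ht : t ≠ 0) : Z t ^ 2 = ‖riemannZeta (1/2 + t * I)‖ ^ 2 := by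
  have := congrArg norm (hZsq t)
  rw [norm_mul, norm_pow, norm_pow, norm_chi_half ht, mul_one, Complex.norm_real,
    Real.norm_eq_abs, sq_abs] at this
  exact this

/-- The Stieltjes integral, written by parts, is the integral against the smooth part of `S`
plus the contribution of its jumps. -/
lemma abs_stieltjes_le {S : ℝ → ℝ} (hS : IsS S) {T : ℝ} (hT : 1 ≤ T)
    {W' : ℝ → ℝ} (hW'c : Continuous W')
    (hW' : ∀ t : ℝ, HasDerivAt (fun t : ℝ => ‖riemannZeta (1/2 + t * I)‖ ^ 2) (W' t) t) :
    ∃ P : Finset ℂ, (∀ ρ ∈ P, riemannZeta ρ = 0) ∧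
      |‖riemannZeta (1/2 + T * I)‖ ^ 2 * S T - ‖riemannZeta (1/2 + (1:ℝ) * I)‖ ^ 2 * S 1
        - ∫ t in (1:ℝ)..T, S t * W' t| ≤
      (∫ t in (1:ℝ)..T, ‖deriv chi (1/2 + t * I)‖ * ‖riemannZeta (1/2 + t * I)‖ ^ 2) +
      ∑ ρ ∈ P, (zeroJump ρ : ℝ) *
        (if 1 < ρ.im ∧ ρ.im ≤ T then ‖riemannZeta (1/2 + ρ.im * I)‖ ^ 2 else 0) := by
  obtain ⟨P, D, hP, hDc, hSD, hDchi⟩ := exists_S_structure hS hT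
  refine ⟨P, hP, ?_⟩
  set W : ℝ → ℝ := fun t => ‖riemannZeta (1/2 + t * I)‖ ^ 2 with hWdef
  have hWc : Continuous W := continuous_norm_sq_riemannZeta_half
  set D' : ℝ → ℝ := fun t =>
    (deriv chi (1/2 + t * I) / chi (1/2 + t * I)).re / (2 * π) with hD'def
  have hsub : Icc 1 T ⊆ Ioo (1/2:ℝ) (T+1) := fun t ht =>
    ⟨by linarith [ht.1], by linarith [ht.2]⟩
  have hD' : ∀ t ∈ Ioo (1/2:ℝ) (T+1), HasDerivAt D (D' t) t := fun t ht =>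
    hasDerivAt_of_exp_eq_chi isOpen_Ioo (fun s hs => by linarith [hs.1]) hDc hDchi ht
  have him : ∀ t ∈ Icc (1:ℝ) T, (1/2 + t * I : ℂ).im ≠ 0 := fun t ht => by
    simpa using (by linarith [ht.1] : t ≠ 0)
  have hdchi : ContinuousOn (fun t : ℝ => deriv chi (1/2 + t * I)) (Icc 1 T) :=
    continuousOn_deriv_chi_half.mono fun t ht => lt_of_lt_of_le one_pos ht.1
  have hchic : ContinuousOn (fun t : ℝ => chi (1/2 + t * I)) (Icc 1 T) := fun t ht =>
    (ContinuousAt.comp (g := chi) (f := fun t : ℝ => (1/2 + t * I : ℂ))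
      (differentiableAt_chi (him t ht)).continuousAt
      (continuous_const_add_mul_I _).continuousAt).continuousWithinAt
  have hD'c : ContinuousOn D' (Icc 1 T) :=
    (Complex.continuous_re.comp_continuousOn
      (hdchi.div hchic fun t ht => chi_ne_zero (him t ht))).div_const _
  have hD'le : ∀ t ∈ Icc (1:ℝ) T, |D' t| ≤ ‖deriv chi (1/2 + t * I)‖ := by
    intro t ht
    rw [hD'def]
    simp only
    rw [abs_div, abs_of_pos Real.two_pi_pos]
    have h1 := Complex.abs_re_le_norm (deriv chi (1/2 + t * I) / chi (1/2 + t * I))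
    rw [norm_div, norm_chi_half (by linarith [ht.1] : t ≠ 0), div_one] at h1
    have h2 : (1:ℝ) ≤ 2 * π := by linarith [Real.pi_gt_three]
    exact (div_le_self (abs_nonneg _) h2).trans h1
  have hu : Set.uIcc 1 T = Icc 1 T := Set.uIcc_of_le hT
  have hDcI : ContinuousOn D (Set.uIcc 1 T) := by rw [hu]; exact hDc.mono hsub
  have hparts : ∫ t in (1:ℝ)..T, D t * W' t = D T * W T - D 1 * W 1 -
      ∫ t in (1:ℝ)..T, D' t * W t :=
    intervalIntegral.integral_mul_deriv_eq_deriv_mul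
      (fun t ht => hD' t (hsub (by rwa [hu] at ht))) (fun t _ => hW' t)
      (ContinuousOn.intervalIntegrable (by rw [hu]; exact hD'c)) (hW'c.intervalIntegrable _ _)
  have h_integrable : ∫ t in (1:ℝ)..T, S t * W' t = (∫ t in (1:ℝ)..T, D t * W' t) +
      ∑ ρ ∈ P, (zeroJump ρ : ℝ) * ∫ t in (1:ℝ)..T, (if ρ.im ≤ t then 1 else 0) * W' t := by
    have hsumint : IntervalIntegrable (fun t => ∑ ρ ∈ P, (zeroJump ρ : ℝ) *
        ((if ρ.im ≤ t then 1 else 0) * W' t)) volume 1 T := by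
      have := IntervalIntegrable.sum P fun ρ _ =>
        (intervalIntegrable_step_mul hW'c ρ.im 1 T).const_mul (zeroJump ρ : ℝ)
      rw [Finset.sum_fn] at this
      exact this
    have hDint : IntervalIntegrable (fun t => D t * W' t) volume 1 T :=
      (hDcI.mul hW'c.continuousOn).intervalIntegrable
    simp only [← intervalIntegral.integral_const_mul]
    rw [← intervalIntegral.integral_finsetSum fun ρ _ =>
      (intervalIntegrable_step_mul hW'c ρ.im 1 T).const_mul _,
      ← intervalIntegral.integral_add hDint hsumint]
    refine intervalIntegral.integral_congr fun t ht => ?_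
    rw [hu] at ht
    rw [hSD t (hsub ht), add_mul, Finset.sum_mul]
    congr 1
    exact Finset.sum_congr rfl fun ρ _ => by ring
  have hQ : W T * S T - W 1 * S 1 - ∫ t in (1:ℝ)..T, S t * W' t =
      (∫ t in (1:ℝ)..T, D' t * W t) + ∑ ρ ∈ P, (zeroJump ρ : ℝ) *
        (if 1 < ρ.im ∧ ρ.im ≤ T then W ρ.im else 0) := by
    rw [h_integrable, hparts, hSD T (hsub ⟨hT, le_rfl⟩), hSD 1 (hsub ⟨le_rfl, hT⟩)]
    have : ∑ ρ ∈ P, (zeroJump ρ : ℝ) * (if 1 < ρ.im ∧ ρ.im ≤ T then W ρ.im else 0) =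
        W T * (∑ ρ ∈ P, (zeroJump ρ : ℝ) * (if ρ.im ≤ T then 1 else 0)) -
        W 1 * (∑ ρ ∈ P, (zeroJump ρ : ℝ) * (if ρ.im ≤ 1 then 1 else 0)) -
        ∑ ρ ∈ P, (zeroJump ρ : ℝ) * ∫ t in (1:ℝ)..T, (if ρ.im ≤ t then 1 else 0) * W' t := by
      rw [Finset.mul_sum, Finset.mul_sum, ← Finset.sum_sub_distrib, ← Finset.sum_sub_distrib]
      refine Finset.sum_congr rfl fun ρ _ => ?_
      rw [← step_integral_by_parts hW'c hW' ρ.im hT]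
      ring
    rw [this]
    ring
  change |W T * S T - W 1 * S 1 - ∫ t in (1:ℝ)..T, S t * W' t| ≤ _
  rw [hQ]
  have hsum : 0 ≤ ∑ ρ ∈ P, (zeroJump ρ : ℝ) *
      (if 1 < ρ.im ∧ ρ.im ≤ T then W ρ.im else 0) :=
    Finset.sum_nonneg fun ρ _ => mul_nonneg (Nat.cast_nonneg _) (by
      split_ifs
      · exact sq_nonneg _
      · exact le_rfl)
  refine (abs_add_le _ _).trans ?_
  rw [abs_of_nonneg hsum]
  refine add_le_add ?_ le_rfl
  refine (intervalIntegral.abs_integral_le_integral_abs hT).trans ?_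
  refine intervalIntegral.integral_mono_on hT
    (ContinuousOn.intervalIntegrable (by rw [hu]; exact (hD'c.mul hWc.continuousOn).abs))
    (ContinuousOn.intervalIntegrable (by rw [hu]; exact hdchi.norm.mul hWc.continuousOn))
    fun t ht => ?_
  rw [abs_mul, abs_of_nonneg (sq_nonneg _ : 0 ≤ W t)]
  exact mul_le_mul_of_nonneg_right (hD'le t ht) (sq_nonneg _)

/-- The jumps contribute only through zeros off the critical line. -/
lemma sum_zeroJump_le {P : Finset ℂ} (hP : ∀ ρ ∈ P, riemannZeta ρ = 0) {T : ℝ} :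
    ∑ ρ ∈ P, (zeroJump ρ : ℝ) *
        (if 1 < ρ.im ∧ ρ.im ≤ T then ‖riemannZeta (1/2 + ρ.im * I)‖ ^ 2 else 0) ≤
      2 * ∑ ρ ∈ P.filter (fun ρ => 1/2 < ρ.re ∧ 1 < ρ.im ∧ ρ.im ≤ T),
        (zetaOrder ρ : ℝ) * ‖riemannZeta (1/2 + ρ.im * I)‖ ^ 2 := by
  rw [Finset.mul_sum, Finset.sum_filter]
  refine Finset.sum_le_sum fun ρ hρ => ?_
  by_cases h : 1 < ρ.im ∧ ρ.im ≤ T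
  · rw [if_pos h]
    rcases lt_trichotomy ρ.re (1/2) with h1 | h1 | h1
    · rw [if_neg fun h' => absurd h'.1 h1.not_gt, zeroJump, if_neg h1.not_gt, if_neg h1.ne]
      simp
    · have : (1/2 + ρ.im * I : ℂ) = ρ := by
        apply Complex.ext
        · simp [h1]
        · simp
      rw [this, hP ρ hρ, if_neg fun h' => absurd h'.1 (by rw [h1]; exact lt_irrefl _)]
      simp
    · rw [if_pos ⟨h1, h⟩, zeroJump, if_pos h1]
      push_cast
      exact le_of_eq (by ring)
  · rw [if_neg h, if_neg fun h' => h h'.2, mul_zero]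

theorem statement15 (S : ℝ → ℝ) (hS : IsS S)
    (Z : ℝ → ℝ) (hZd : Differentiable ℝ Z)
    (hZsq : ∀ t : ℝ, ((Z t : ℂ)) ^ 2 * chi (1/2 + t * I) = (riemannZeta (1/2 + t * I)) ^ 2)
    : ∀ ε : ℝ, 0 < ε → ∃ K : ℝ, ∀ T : ℝ, 3 ≤ T →
      |‖riemannZeta (1/2 + T * I)‖ ^ 2 * S T - ‖riemannZeta (1/2 + I)‖ ^ 2 * S 1
          - 2 * ∫ t in (1:ℝ)..T, S t * Z t * deriv Z t| ≤
        K * T * (Real.log T) ^ 2 * (Real.log (Real.log T)) ^ (3/2 + ε : ℝ) := by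
  intro ε hε
  obtain ⟨W', hW'c, hW'⟩ := exists_deriv_norm_sq_riemannZeta_half
  obtain ⟨C₁, hC₁, hoff⟩ := exists_off_sum_le
  obtain ⟨C₂, hC₂, hmean⟩ := exists_integral_norm_sq_riemannZeta_half_le
  obtain ⟨C₃, hC₃, hchi⟩ := exists_norm_deriv_chi_half_le
  set l := Real.log (Real.log 3) with hl
  have hl0 : 0 < l := log_log_three_pos
  refine ⟨(2 * C₃ * C₂ / l + 2 * C₁) * l ^ (-(1/2 + ε)), fun T hT => ?_⟩
  have hT1 : 1 ≤ T := by linarith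
  have hlog1 : 1 ≤ Real.log T := by
    rw [Real.le_log_iff_exp_le (by linarith)]
    linarith [Real.exp_one_lt_d9]
  have hlog3 : 0 < Real.log 3 := Real.log_pos (by norm_num)
  have hll : l ≤ Real.log (Real.log T) :=
    Real.log_le_log hlog3 (Real.log_le_log (by norm_num) hT)
  set L := Real.log (Real.log T) with hL
  have hL0 : 0 < L := hl0.trans_le hll
  have hderiv : ∀ t : ℝ, 1 ≤ t → 2 * (Z t * deriv Z t) = W' t := by
    intro t ht
    have h1 : HasDerivAt (fun s => Z s ^ 2) (2 * (Z t * deriv Z t)) t := by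
      exact ((hZd t).hasDerivAt.fun_pow 2).congr_deriv (by push_cast; ring)
    refine h1.unique ((hW' t).congr_of_eventuallyEq ?_)
    filter_upwards [isOpen_ne.mem_nhds (by linarith : t ≠ 0)] with s hs
    exact sq_eq_norm_sq_riemannZeta hZsq hs
  have h_integrable : 2 * ∫ t in (1:ℝ)..T, S t * Z t * deriv Z t = ∫ t in (1:ℝ)..T, S t * W' t := by
    rw [← intervalIntegral.integral_const_mul]
    refine intervalIntegral.integral_congr fun t ht => ?_
    rw [Set.uIcc_of_le hT1] at ht
    rw [← hderiv t ht.1]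
    ring
  obtain ⟨P, hP, hle⟩ := abs_stieltjes_le hS hT1 hW'c hW'
  rw [Complex.ofReal_one, one_mul, ← h_integrable] at hle
  refine hle.trans ?_
  have hWc := continuous_norm_sq_riemannZeta_half
  have b1 : ∫ t in (1:ℝ)..T, ‖deriv chi (1/2 + t * I)‖ * ‖riemannZeta (1/2 + t * I)‖ ^ 2 ≤
      2 * C₃ * C₂ * (T * Real.log T ^ 2) := by
    calc ∫ t in (1:ℝ)..T, ‖deriv chi (1/2 + t * I)‖ * ‖riemannZeta (1/2 + t * I)‖ ^ 2
        ≤ ∫ t in (1:ℝ)..T, (2 * C₃ * Real.log T) * ‖riemannZeta (1/2 + t * I)‖ ^ 2 := by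
          refine intervalIntegral.integral_mono_on hT1 (ContinuousOn.intervalIntegrable ?_)
            ((continuous_const.mul hWc).intervalIntegrable _ _) fun t ht => ?_
          · rw [Set.uIcc_of_le hT1]
            exact (continuousOn_deriv_chi_half.mono fun t ht =>
              lt_of_lt_of_le one_pos ht.1).norm.mul hWc.continuousOn
          · refine mul_le_mul_of_nonneg_right ((hchi t ht.1).trans ?_) (sq_nonneg _)
            have := Real.log_le_log (by linarith [ht.1]) ht.2
            have := mul_le_mul_of_nonneg_left
              (by linarith : 1 + Real.log t ≤ 2 * Real.log T) hC₃.le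
            linarith
      _ = (2 * C₃ * Real.log T) * ∫ t in (1:ℝ)..T, ‖riemannZeta (1/2 + t * I)‖ ^ 2 :=
          intervalIntegral.integral_const_mul _ _
      _ ≤ (2 * C₃ * Real.log T) * (C₂ * (T * Real.log T)) :=
          mul_le_mul_of_nonneg_left (hmean T hT) (by positivity)
      _ = 2 * C₃ * C₂ * (T * Real.log T ^ 2) := by ring
  have b2 := hoff T hT (P.filter (fun ρ => 1/2 < ρ.re ∧ 1 < ρ.im ∧ ρ.im ≤ T))
    fun ρ hρ => ⟨hP ρ (Finset.mem_filter.1 hρ).1, (Finset.mem_filter.1 hρ).2⟩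
  have b3 := sum_zeroJump_le hP (T := T)
  have hpos : 0 ≤ T * Real.log T ^ 2 := by positivity
  have b4 : 2 * C₃ * C₂ * (T * Real.log T ^ 2) ≤
      2 * C₃ * C₂ / l * (T * Real.log T ^ 2 * L) := by
    rw [show 2 * C₃ * C₂ / l * (T * Real.log T ^ 2 * L) =
      2 * C₃ * C₂ * (T * Real.log T ^ 2) * (L / l) by ring]
    exact le_mul_of_one_le_right (by positivity) ((one_le_div hl0).2 hll)
  have b5 : L ≤ l ^ (-(1/2 + ε)) * L ^ (3/2 + ε) := by
    have e1 : L ^ (3/2 + ε) = L ^ (1/2 + ε) * L := by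
      rw [← Real.rpow_add_one hL0.ne']; congr 1; ring
    have e2 : l ^ (1/2 + ε) ≤ L ^ (1/2 + ε) := Real.rpow_le_rpow hl0.le hll (by linarith)
    have e3 : 0 < l ^ (1/2 + ε) := Real.rpow_pos_of_pos hl0 _
    rw [e1, Real.rpow_neg hl0.le, ← mul_assoc]
    refine le_mul_of_one_le_left hL0.le ?_
    rw [inv_mul_eq_div]
    exact (one_le_div e3).2 e2
  have hK : 0 ≤ 2 * C₃ * C₂ / l + 2 * C₁ := by positivity
  calc _ ≤ (2 * C₃ * C₂ / l + 2 * C₁) * (T * Real.log T ^ 2) * L := by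
        have : (2 * C₃ * C₂ / l + 2 * C₁) * (T * Real.log T ^ 2) * L =
          2 * C₃ * C₂ / l * (T * Real.log T ^ 2 * L) + 2 * (C₁ * (T * Real.log T ^ 2 * L)) := by
          ring
        linarith
    _ ≤ (2 * C₃ * C₂ / l + 2 * C₁) * (T * Real.log T ^ 2) *
        (l ^ (-(1/2 + ε)) * L ^ (3/2 + ε)) :=
        mul_le_mul_of_nonneg_left b5 (mul_nonneg hK hpos)
    _ = _ := by ring
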